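/- Let n ≥ 3 and let (p,q) be a Schrödinger-admissible pair in dimension n with p > 2. There is a constant C = C(n,p) such that for every measurable w : ℝ^n → ℂ with |w(x)| ≤ ⟨x⟩^{-1} for all x, and every Schwartz function g on ℝ × ℝ^n, the retarded (Duhamel-type) integral F(t,x) = ∫_{−∞}^{t} [ e^{i(t−s)Δ}( w · g(s,·) ) ](x) ds satisfies ‖F‖_{L^p_t L^q_x} ≤ C ‖g‖_{L²(ℝ×ℝ^n)}. -/

import Mathlib

open MeasureTheory ENNReal SchwartzMap

/-- The free Schrödinger evolution `(e^{itΔ}f)(x)`, given for `t ≠ 0` by the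
explicit convolution formula with the principal branch of the complex power. -/
noncomputable def schrod (n : ℕ) (t : ℝ) (f : EuclideanSpace ℝ (Fin n) → ℂ)
    (x : EuclideanSpace ℝ (Fin n)) : ℂ :=
  if t = 0 then f x
  else (4 * Real.pi * Complex.I * (t : ℂ)) ^ (-(n : ℂ) / 2) *
    ∫ y : EuclideanSpace ℝ (Fin n),
      Complex.exp (Complex.I * (‖x - y‖ : ℂ) ^ 2 / (4 * (t : ℂ))) * f y

/-- The mixed norm `‖F‖_{L^p_t L^q_x}`, with exponents in `ℝ≥0∞`. -/
noncomputable def mixedNorm {n : ℕ} (p q : ℝ≥0∞)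
    (F : ℝ → EuclideanSpace ℝ (Fin n) → ℂ) : ℝ≥0∞ :=
  if p = ⊤ then essSup (fun t => eLpNorm (F t) q volume) volume
  else (∫⁻ t : ℝ, (eLpNorm (F t) q volume) ^ p.toReal) ^ (1 / p.toReal)

open scoped FourierTransform ComplexConjugate

section HeatKernel

variable {V : Type*} [NormedAddCommGroup V] [InnerProductSpace ℝ V]

/-- The complex Gaussian whose Fourier transform is `exp (-4π² z ‖ξ‖²)`. -/
noncomputable def complexHeatKernel (z : ℂ) (v : V) : ℂ :=
  (4 * Real.pi * z) ^ (-(Module.finrank ℝ V : ℂ) / 2) * Complex.exp (-(‖v‖ : ℂ) ^ 2 / (4 * z))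

@[fun_prop]
lemma continuous_complexHeatKernel (z : ℂ) : Continuous (complexHeatKernel z : V → ℂ) := by
  unfold complexHeatKernel; fun_prop

@[fun_prop]
lemma measurable_complexHeatKernel [MeasurableSpace V] [BorelSpace V] (z : ℂ) :
    Measurable (complexHeatKernel z : V → ℂ) :=
  (continuous_complexHeatKernel z).measurable

lemma norm_complexHeatKernel_le {z : ℂ} (hz : 0 < z.re) (v : V) :
    ‖complexHeatKernel z v‖ ≤ (4 * Real.pi * ‖z‖) ^ (-(Module.finrank ℝ V : ℝ) / 2) := by
  have hz0 : z ≠ 0 := by rintro rfl; simp at hz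
  have hπ : (Real.pi : ℂ) ≠ 0 := by exact_mod_cast Real.pi_ne_zero
  rw [complexHeatKernel, norm_mul]
  have h1 : ‖(4 * Real.pi * z) ^ (-(Module.finrank ℝ V : ℂ) / 2)‖ =
      (4 * Real.pi * ‖z‖) ^ (-(Module.finrank ℝ V : ℝ) / 2) := by
    rw [show (-(Module.finrank ℝ V : ℂ) / 2) = ((-(Module.finrank ℝ V : ℝ) / 2 : ℝ) : ℂ) by
      push_cast; ring, Complex.norm_cpow_of_ne_zero (by simp [hz0, hπ])]
    simp [abs_of_pos Real.pi_pos]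
  rw [h1]
  refine mul_le_of_le_one_right (by positivity) ?_
  rw [Complex.norm_exp, Real.exp_le_one_iff]
  rw [show -(‖v‖ : ℂ) ^ 2 / (4 * z) = ((-‖v‖ ^ 2 / 4 : ℝ) : ℂ) * z⁻¹ by
    push_cast; field_simp, Complex.re_ofReal_mul, Complex.inv_re]
  have : 0 ≤ z.re / Complex.normSq z := div_nonneg hz.le (Complex.normSq_nonneg _)
  nlinarith [mul_nonneg (sq_nonneg ‖v‖) this]

end HeatKernel

section Plancherel

variable {V : Type*} [NormedAddCommGroup V] [InnerProductSpace ℝ V] [FiniteDimensional ℝ V]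
  [MeasurableSpace V] [BorelSpace V]

lemma fourier_gaussian_eq_complexHeatKernel {z : ℂ} (hz : 0 < z.re) (v : V) :
    𝓕 (fun ξ : V ↦ Complex.exp (-(4 * Real.pi ^ 2 * z) * ‖ξ‖ ^ 2)) v = complexHeatKernel z v := by
  have hπ : (Real.pi : ℂ) ≠ 0 := by exact_mod_cast Real.pi_ne_zero
  have hz0 : z ≠ 0 := by rintro rfl; simp at hz
  have hb : 0 < (4 * (Real.pi : ℂ) ^ 2 * z).re := by
    have : (4 * (Real.pi : ℂ) ^ 2 * z).re = 4 * Real.pi ^ 2 * z.re := by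
      rw [show (4 * (Real.pi : ℂ) ^ 2 * z) = ((4 * Real.pi ^ 2 : ℝ) : ℂ) * z by push_cast; ring,
        Complex.re_ofReal_mul]
    rw [this]; positivity
  have hre : 0 < (4 * (Real.pi : ℂ) * z).re := by
    rw [show (4 * (Real.pi : ℂ) * z) = ((4 * Real.pi : ℝ) : ℂ) * z by push_cast; ring,
        Complex.re_ofReal_mul]
    positivity
  rw [fourier_gaussian_innerProductSpace hb, complexHeatKernel]
  congr 1
  · rw [show (Real.pi : ℂ) / (4 * Real.pi ^ 2 * z) = (4 * Real.pi * z)⁻¹ by field_simp,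
      Complex.inv_cpow, neg_div, Complex.cpow_neg]
    intro h
    have := Complex.arg_eq_pi_iff.1 h
    linarith [this.1]
  · congr 1
    field_simp

lemma integrable_gaussian_fourier {z : ℂ} (hz : 0 < z.re) :
    Integrable (fun ξ : V ↦ Complex.exp (-(4 * Real.pi ^ 2 * z) * ‖ξ‖ ^ 2)) := by
  have hb : 0 < (4 * (Real.pi : ℂ) ^ 2 * z).re := by
    have : (4 * (Real.pi : ℂ) ^ 2 * z).re = 4 * Real.pi ^ 2 * z.re := by
      rw [show (4 * (Real.pi : ℂ) ^ 2 * z) = ((4 * Real.pi ^ 2 : ℝ) : ℂ) * z by push_cast; ring,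
        Complex.re_ofReal_mul]
    rw [this]; positivity
  simpa using GaussianFourier.integrable_cexp_neg_mul_sq_norm_add hb 0 (0 : V)

theorem integral_gaussian_mul_fourier_mul_conj_fourier {z : ℂ} (hz : 0 < z.re) {f h : V → ℂ}
    (hf : Integrable f) (hh : Integrable h) :
    ∫ ξ, Complex.exp (-(4 * Real.pi ^ 2 * z) * ‖ξ‖ ^ 2) * (𝓕 f ξ * conj (𝓕 h ξ)) =
      ∫ p : V × V, complexHeatKernel z (p.1 - p.2) * (f p.2 * conj (h p.1)) := by
  have hhc : Integrable (fun x ↦ conj (h x)) :=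
    (RCLike.conjCLE (K := ℂ)).toContinuousLinearMap.integrable_comp hh
  have key : ∀ ξ, 𝓕 f ξ * conj (𝓕 h ξ) = ∫ p : V × V,
      Complex.exp (((-2 * Real.pi * inner ℝ (p.2 - p.1) ξ : ℝ) : ℂ) * Complex.I) *
        (conj (h p.1) * f p.2) := by
    intro ξ
    rw [Real.fourier_eq', Real.fourier_eq', ← integral_conj, mul_comm, ← integral_prod_mul]
    refine integral_congr_ae (Filter.Eventually.of_forall fun p ↦ ?_)
    simp only [smul_eq_mul, map_mul, ← Complex.exp_conj, Complex.conj_ofReal, Complex.conj_I]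
    rw [show ((-2 * Real.pi * inner ℝ (p.2 - p.1) ξ : ℝ) : ℂ) * Complex.I =
      ((-2 * Real.pi * inner ℝ p.1 ξ : ℝ) : ℂ) * -Complex.I +
      ((-2 * Real.pi * inner ℝ p.2 ξ : ℝ) : ℂ) * Complex.I by
        rw [inner_sub_left]; push_cast; ring, Complex.exp_add]
    ring
  have hint : Integrable (Function.uncurry fun (ξ : V) (p : V × V) ↦
      Complex.exp (-(4 * Real.pi ^ 2 * z) * ‖ξ‖ ^ 2) *
      (Complex.exp (((-2 * Real.pi * inner ℝ (p.2 - p.1) ξ : ℝ) : ℂ) * Complex.I) *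
        (conj (h p.1) * f p.2))) (volume.prod volume) := by
    have h1 := (integrable_gaussian_fourier (V := V) hz).mul_prod (hhc.mul_prod hf)
    refine (h1.bdd_mul (c := 1) (f := fun q : V × V × V ↦
      Complex.exp (((-2 * Real.pi * inner ℝ (q.2.2 - q.2.1) q.1 : ℝ) : ℂ) * Complex.I))
      (Continuous.aestronglyMeasurable (by fun_prop))
      (Filter.Eventually.of_forall fun q ↦ ?_)).congr
      (Filter.Eventually.of_forall fun q ↦ ?_)
    · rw [Complex.norm_exp_ofReal_mul_I]
    · simp only [Function.uncurry]; ring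
  calc _ = ∫ ξ, ∫ p : V × V, Complex.exp (-(4 * Real.pi ^ 2 * z) * ‖ξ‖ ^ 2) *
      (Complex.exp (((-2 * Real.pi * inner ℝ (p.2 - p.1) ξ : ℝ) : ℂ) * Complex.I) *
        (conj (h p.1) * f p.2)) := by
        refine integral_congr_ae (Filter.Eventually.of_forall fun ξ ↦ ?_)
        simp only [key, integral_const_mul]
    _ = ∫ p : V × V, ∫ ξ, Complex.exp (-(4 * Real.pi ^ 2 * z) * ‖ξ‖ ^ 2) *
      (Complex.exp (((-2 * Real.pi * inner ℝ (p.2 - p.1) ξ : ℝ) : ℂ) * Complex.I) *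
        (conj (h p.1) * f p.2)) := integral_integral_swap hint
    _ = _ := by
        refine integral_congr_ae (Filter.Eventually.of_forall fun p ↦ ?_)
        have hk := fourier_gaussian_eq_complexHeatKernel hz (p.2 - p.1)
        have hsym : complexHeatKernel z (p.1 - p.2) = complexHeatKernel z (p.2 - p.1) := by
          simp only [complexHeatKernel, norm_sub_rev]
        simp only
        rw [hsym, ← hk, Real.fourier_eq', ← integral_mul_const]
        refine integral_congr_ae (Filter.Eventually.of_forall fun ξ ↦ ?_)
        simp only [smul_eq_mul]
        rw [real_inner_comm]
        ring

end Plancherel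

lemma ENNReal.two_mul_mul_le_sq_add_sq (a b : ℝ≥0∞) : 2 * (a * b) ≤ a ^ 2 + b ^ 2 := by
  wlog h : a ≤ b generalizing a b
  · rw [mul_comm a, add_comm]; exact this b a (le_of_not_ge h)
  obtain ⟨c, rfl⟩ := exists_add_of_le h
  calc 2 * (a * (a + c)) ≤ 2 * (a * (a + c)) + c ^ 2 := le_self_add
    _ = _ := by ring

section Plancherel

variable {V : Type*} [NormedAddCommGroup V] [InnerProductSpace ℝ V] [FiniteDimensional ℝ V]
  [MeasurableSpace V] [BorelSpace V]

lemma continuous_fourier_of_integrable {f : V → ℂ} (hf : Integrable f) : Continuous (𝓕 f) :=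
  VectorFourier.fourierIntegral_continuous Real.continuous_fourierChar
    (by exact continuous_inner) hf

lemma lintegral_complexHeatKernel {ε : ℝ} (hε : 0 < ε) :
    ∫⁻ v : V, ‖complexHeatKernel (ε : ℂ) v‖ₑ = 1 := by
  have hpos : 0 < 4 * Real.pi * ε := by positivity
  have hk : ∀ v : V, ‖complexHeatKernel (ε : ℂ) v‖ =
      (4 * Real.pi * ε) ^ (-(Module.finrank ℝ V : ℝ) / 2) *
        Real.exp (-(1 / (4 * ε)) * ‖v‖ ^ 2) := by
    intro v
    rw [complexHeatKernel, norm_mul]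
    congr 1
    · rw [show (-(Module.finrank ℝ V : ℂ) / 2) = ((-(Module.finrank ℝ V : ℝ) / 2 : ℝ) : ℂ) by
        push_cast; ring, show (4 * (Real.pi : ℂ) * ε) = ((4 * Real.pi * ε : ℝ) : ℂ) by
          push_cast; ring,
        Complex.norm_cpow_eq_rpow_re_of_pos hpos, Complex.ofReal_re]
    · rw [show -(‖v‖ : ℂ) ^ 2 / (4 * (ε : ℂ)) = ((-(1 / (4 * ε)) * ‖v‖ ^ 2 : ℝ) : ℂ) by
        push_cast; ring, Complex.norm_exp, Complex.ofReal_re]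
  have hint : Integrable (fun v : V ↦ Real.exp (-(1 / (4 * ε)) * ‖v‖ ^ 2)) := by
    have := GaussianFourier.integrable_cexp_neg_mul_sq_norm_add (V := V)
      (b := ((1 / (4 * ε) : ℝ) : ℂ))
      (by rw [Complex.ofReal_re]; positivity) 0 0
    refine this.norm.congr (Filter.Eventually.of_forall fun v ↦ ?_)
    simp only [zero_mul, add_zero]
    rw [show -((1 / (4 * ε) : ℝ) : ℂ) * (‖v‖ : ℂ) ^ 2 = ((-(1 / (4 * ε)) * ‖v‖ ^ 2 : ℝ) : ℂ) by
        push_cast; ring, Complex.norm_exp, Complex.ofReal_re]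
  calc ∫⁻ v : V, ‖complexHeatKernel (ε : ℂ) v‖ₑ
      = ∫⁻ v : V, ENNReal.ofReal ((4 * Real.pi * ε) ^ (-(Module.finrank ℝ V : ℝ) / 2) *
        Real.exp (-(1 / (4 * ε)) * ‖v‖ ^ 2)) := by
        simp only [← hk, ofReal_norm]
    _ = 1 := by
        rw [← ofReal_integral_eq_lintegral_ofReal (hint.const_mul _)
          (Filter.Eventually.of_forall fun v ↦ by positivity), integral_const_mul,
          GaussianFourier.integral_rexp_neg_mul_sq_norm (by positivity),
          show Real.pi / (1 / (4 * ε)) = 4 * Real.pi * ε by field_simp, ← Real.rpow_add hpos]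
        simp [neg_div]

lemma lintegral_gaussian_mul_fourier_sq_le {f : V → ℂ} (hf : Integrable f) {ε : ℝ} (hε : 0 < ε) :
    ∫⁻ ξ, ENNReal.ofReal (Real.exp (-(4 * Real.pi ^ 2 * ε) * ‖ξ‖ ^ 2)) * ‖𝓕 f ξ‖ₑ ^ 2 ≤
      ∫⁻ x, ‖f x‖ₑ ^ 2 := by
  have hε' : 0 < (ε : ℂ).re := by simpa
  have hpair := integral_gaussian_mul_fourier_mul_conj_fourier hε' hf hf
  have hexp : ∀ ξ : V, Complex.exp (-(4 * Real.pi ^ 2 * ε) * ‖ξ‖ ^ 2) * (𝓕 f ξ * conj (𝓕 f ξ)) =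
      ((Real.exp (-(4 * Real.pi ^ 2 * ε) * ‖ξ‖ ^ 2) * ‖𝓕 f ξ‖ ^ 2 : ℝ) : ℂ) := by
    intro ξ
    rw [Complex.mul_conj, Complex.normSq_eq_norm_sq]
    push_cast; ring
  have hbound : ∀ ξ, ‖𝓕 f ξ‖ ≤ ∫ x, ‖f x‖ := fun ξ ↦
    VectorFourier.norm_fourierIntegral_le_integral_norm _ _ _ _ _
  have hint : Integrable
      (fun ξ : V ↦ Real.exp (-(4 * Real.pi ^ 2 * ε) * ‖ξ‖ ^ 2) * ‖𝓕 f ξ‖ ^ 2) := by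
    have := (integrable_gaussian_fourier (V := V) hε').norm
    refine (this.mul_bdd (c := (∫ x, ‖f x‖) ^ 2) (g := fun ξ ↦ ‖𝓕 f ξ‖ ^ 2)
      ((continuous_fourier_of_integrable hf).norm.pow 2).aestronglyMeasurable
      (Filter.Eventually.of_forall fun ξ ↦ ?_)).congr (Filter.Eventually.of_forall fun ξ ↦ ?_)
    · rw [Real.norm_of_nonneg (by positivity)]
      gcongr; exact hbound ξ
    · simp only
      rw [show -(4 * (Real.pi : ℂ) ^ 2 * ε) * (‖ξ‖ : ℂ) ^ 2 =
        ((-(4 * Real.pi ^ 2 * ε) * ‖ξ‖ ^ 2 : ℝ) : ℂ) by push_cast; ring, Complex.norm_exp,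
        Complex.ofReal_re]
  have hfm : AEMeasurable (fun x ↦ ‖f x‖ₑ) := hf.1.enorm
  have hkm : Measurable fun p : V × V ↦ ‖complexHeatKernel (ε : ℂ) (p.1 - p.2)‖ₑ :=
    ((continuous_complexHeatKernel _).comp (continuous_fst.sub continuous_snd)).measurable.enorm
  have m1 : AEMeasurable (fun p : V × V ↦ ‖complexHeatKernel (ε : ℂ) (p.1 - p.2)‖ₑ * ‖f p.1‖ₑ ^ 2)
      (volume.prod volume) := hkm.aemeasurable.mul (hfm.comp_fst.pow_const 2)
  have m2 : AEMeasurable (fun p : V × V ↦ ‖complexHeatKernel (ε : ℂ) (p.1 - p.2)‖ₑ * ‖f p.2‖ₑ ^ 2)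
      (volume.prod volume) := hkm.aemeasurable.mul (hfm.comp_snd.pow_const 2)
  have e1 : ∫⁻ p : V × V, ‖complexHeatKernel (ε : ℂ) (p.1 - p.2)‖ₑ * ‖f p.2‖ₑ ^ 2 =
      ∫⁻ x, ‖f x‖ₑ ^ 2 := by
    rw [Measure.volume_eq_prod, lintegral_prod_symm _ m2]
    simp only
    refine lintegral_congr fun y ↦ ?_
    rw [lintegral_mul_const _ (by fun_prop),
      lintegral_sub_right_eq_self (fun x : V ↦ ‖complexHeatKernel (ε : ℂ) x‖ₑ) y,
      lintegral_complexHeatKernel hε, one_mul]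
  have e2 : ∫⁻ p : V × V, ‖complexHeatKernel (ε : ℂ) (p.1 - p.2)‖ₑ * ‖f p.1‖ₑ ^ 2 =
      ∫⁻ x, ‖f x‖ₑ ^ 2 := by
    rw [Measure.volume_eq_prod, lintegral_prod _ m1]
    simp only
    refine lintegral_congr fun y ↦ ?_
    rw [lintegral_mul_const _ (by fun_prop),
      lintegral_sub_left_eq_self (fun x : V ↦ ‖complexHeatKernel (ε : ℂ) x‖ₑ) y,
      lintegral_complexHeatKernel hε, one_mul]
  calc ∫⁻ ξ, ENNReal.ofReal (Real.exp (-(4 * Real.pi ^ 2 * ε) * ‖ξ‖ ^ 2)) * ‖𝓕 f ξ‖ₑ ^ 2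
      = ∫⁻ ξ, ENNReal.ofReal (Real.exp (-(4 * Real.pi ^ 2 * ε) * ‖ξ‖ ^ 2) * ‖𝓕 f ξ‖ ^ 2) := by
        refine lintegral_congr fun ξ ↦ ?_
        rw [ENNReal.ofReal_mul (by positivity), ENNReal.ofReal_pow (by positivity), ofReal_norm]
    _ = ENNReal.ofReal (∫ ξ, Real.exp (-(4 * Real.pi ^ 2 * ε) * ‖ξ‖ ^ 2) * ‖𝓕 f ξ‖ ^ 2) := by
        rw [ofReal_integral_eq_lintegral_ofReal hint
          (Filter.Eventually.of_forall fun v ↦ by positivity)]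
    _ ≤ ‖∫ ξ, Complex.exp (-(4 * Real.pi ^ 2 * ε) * ‖ξ‖ ^ 2) * (𝓕 f ξ * conj (𝓕 f ξ))‖ₑ := by
        simp only [hexp]
        rw [integral_complex_ofReal, ← ofReal_norm, Complex.norm_real]
        exact ENNReal.ofReal_le_ofReal (Real.le_norm_self _)
    _ ≤ ∫⁻ p : V × V, ‖complexHeatKernel (ε : ℂ) (p.1 - p.2) * (f p.2 * conj (f p.1))‖ₑ := by
        rw [hpair]; exact enorm_integral_le_lintegral_enorm _
    _ = ∫⁻ p : V × V, ‖complexHeatKernel (ε : ℂ) (p.1 - p.2)‖ₑ * (‖f p.2‖ₑ * ‖f p.1‖ₑ) := by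
        refine lintegral_congr fun p ↦ ?_
        have : ‖conj (f p.1)‖ₑ = ‖f p.1‖ₑ := by rw [← ofReal_norm, RCLike.norm_conj, ofReal_norm]
        rw [enorm_mul, enorm_mul, this]
    _ ≤ ∫⁻ x, ‖f x‖ₑ ^ 2 := by
        rw [← ENNReal.mul_le_mul_iff_right two_ne_zero ENNReal.ofNat_ne_top,
          ← lintegral_const_mul' _ _ ENNReal.ofNat_ne_top, two_mul (∫⁻ x, ‖f x‖ₑ ^ 2)]
        nth_rewrite 1 [← e2]
        rw [← e1, Measure.volume_eq_prod, ← lintegral_add_left' m1]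
        refine lintegral_mono fun p ↦ ?_
        rw [mul_left_comm, ← mul_add, add_comm]
        gcongr
        exact ENNReal.two_mul_mul_le_sq_add_sq _ _

/-- The `L²` bound for the Fourier transform of an integrable function. -/
theorem lintegral_fourier_sq_le {f : V → ℂ} (hf : Integrable f) :
    ∫⁻ ξ, ‖𝓕 f ξ‖ₑ ^ 2 ≤ ∫⁻ x, ‖f x‖ₑ ^ 2 := by
  have hcont := continuous_fourier_of_integrable hf
  have hlim : ∀ ξ : V, Filter.Tendsto (fun k : ℕ ↦
      ENNReal.ofReal (Real.exp (-(4 * Real.pi ^ 2 * (1 / ((k : ℝ) + 1))) * ‖ξ‖ ^ 2)) * ‖𝓕 f ξ‖ₑ ^ 2)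
      Filter.atTop (nhds (‖𝓕 f ξ‖ₑ ^ 2)) := by
    intro ξ
    have h0 : Filter.Tendsto (fun k : ℕ ↦
        Real.exp (-(4 * Real.pi ^ 2 * (1 / ((k : ℝ) + 1))) * ‖ξ‖ ^ 2)) Filter.atTop (nhds 1) := by
      have h2 : Continuous fun e : ℝ ↦ Real.exp (-(4 * Real.pi ^ 2 * e) * ‖ξ‖ ^ 2) := by fun_prop
      have := (h2.tendsto 0).comp tendsto_one_div_add_atTop_nhds_zero_nat
      simpa [Function.comp_def] using this
    have h1 := ENNReal.tendsto_ofReal h0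
    rw [ENNReal.ofReal_one] at h1
    have := ENNReal.Tendsto.mul_const (b := ‖𝓕 f ξ‖ₑ ^ 2) h1 (Or.inl one_ne_zero)
    simpa using this
  calc ∫⁻ ξ, ‖𝓕 f ξ‖ₑ ^ 2 = ∫⁻ ξ, Filter.liminf (fun k : ℕ ↦
        ENNReal.ofReal (Real.exp (-(4 * Real.pi ^ 2 * (1 / ((k : ℝ) + 1))) * ‖ξ‖ ^ 2)) *
          ‖𝓕 f ξ‖ₑ ^ 2)
        Filter.atTop := lintegral_congr fun ξ ↦ (hlim ξ).liminf_eq.symm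
    _ ≤ Filter.liminf (fun k : ℕ ↦ ∫⁻ ξ,
        ENNReal.ofReal (Real.exp (-(4 * Real.pi ^ 2 * (1 / ((k : ℝ) + 1))) * ‖ξ‖ ^ 2)) *
          ‖𝓕 f ξ‖ₑ ^ 2)
        Filter.atTop := lintegral_liminf_le fun k ↦ by
        have := hcont.measurable
        fun_prop
    _ ≤ ∫⁻ x, ‖f x‖ₑ ^ 2 := by
        refine Filter.liminf_le_of_le (by isBoundedDefault) fun b hb ↦ ?_
        obtain ⟨k, hk⟩ := hb.exists
        refine hk.trans ?_
        have := lintegral_gaussian_mul_fourier_sq_le hf (ε := 1 / ((k : ℝ) + 1)) (by positivity)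
        exact this

end Plancherel

lemma eLpNorm_two_sq {α F : Type*} [MeasurableSpace α] [NormedAddCommGroup F] (f : α → F)
    (μ : Measure α) : eLpNorm f 2 μ ^ 2 = ∫⁻ x, ‖f x‖ₑ ^ 2 ∂μ := by
  have := eLpNorm_nnreal_pow_eq_lintegral (f := f) (μ := μ) (p := 2) two_ne_zero
  simpa using this

lemma memLp_two_of_lintegral_sq_lt_top {α F : Type*} [MeasurableSpace α] [NormedAddCommGroup F]
    {f : α → F} {μ : Measure α} (hm : AEStronglyMeasurable f μ)
    (hf : ∫⁻ x, ‖f x‖ₑ ^ 2 ∂μ < ⊤) : MemLp f 2 μ := by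
  refine ⟨hm, ?_⟩
  rw [← eLpNorm_two_sq] at hf
  exact (ENNReal.pow_lt_top_iff.1 hf).resolve_right two_ne_zero

section Pairing

variable {V : Type*} [NormedAddCommGroup V] [InnerProductSpace ℝ V] [FiniteDimensional ℝ V]
  [MeasurableSpace V] [BorelSpace V]

lemma memLp_two_fourier {f : V → ℂ} (hf : Integrable f) (hf2 : MemLp f 2) : MemLp (𝓕 f) 2 := by
  refine memLp_two_of_lintegral_sq_lt_top
    (continuous_fourier_of_integrable hf).aestronglyMeasurable
    ((lintegral_fourier_sq_le hf).trans_lt ?_)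
  rw [← eLpNorm_two_sq]
  exact ENNReal.pow_lt_top hf2.2

lemma eLpNorm_fourier_le {f : V → ℂ} (hf : Integrable f) : eLpNorm (𝓕 f) 2 ≤ eLpNorm f 2 := by
  have := lintegral_fourier_sq_le hf
  rw [← eLpNorm_two_sq, ← eLpNorm_two_sq] at this
  exact (ENNReal.pow_le_pow_left_iff two_ne_zero).1 this

theorem integral_complexHeatKernel_imaginary_mul {t : ℝ} (ht : t ≠ 0) {f h : V → ℂ}
    (hf : Integrable f) (hf2 : MemLp f 2) (hh : Integrable h) (hh2 : MemLp h 2) :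
    ∫ p : V × V, complexHeatKernel (Complex.I * t) (p.1 - p.2) * (f p.2 * conj (h p.1)) =
      ∫ ξ, Complex.exp (-(4 * Real.pi ^ 2 * (Complex.I * t)) * ‖ξ‖ ^ 2) *
        (𝓕 f ξ * conj (𝓕 h ξ)) := by
  set z : ℕ → ℂ := fun k ↦ ((1 / ((k : ℝ) + 1) : ℝ) : ℂ) + Complex.I * t with hzdef
  have hzre : ∀ k, (z k).re = 1 / ((k : ℝ) + 1) := fun k ↦ by
    simp only [hzdef, Complex.add_re, Complex.ofReal_re]; simp
  have hzim : ∀ k, (z k).im = t := fun k ↦ by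
    simp only [hzdef, Complex.add_im, Complex.ofReal_im]; simp
  have hzpos : ∀ k, 0 < (z k).re := fun k ↦ by rw [hzre]; positivity
  have hzlim : Filter.Tendsto z Filter.atTop (nhds (Complex.I * t)) := by
    have h1 : Filter.Tendsto (fun k : ℕ ↦ ((1 / ((k : ℝ) + 1) : ℝ) : ℂ)) Filter.atTop (nhds 0) := by
      have := (Complex.continuous_ofReal.tendsto 0).comp
        (tendsto_one_div_add_atTop_nhds_zero_nat (𝕜 := ℝ))
      simpa [Function.comp_def] using this
    have := h1.add_const (Complex.I * t)
    rwa [zero_add] at this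
  have hhc : Integrable (fun x ↦ conj (h x)) :=
    (RCLike.conjCLE (K := ℂ)).toContinuousLinearMap.integrable_comp hh
  have hprod : Integrable (fun p : V × V ↦ f p.2 * conj (h p.1)) :=
    (hhc.mul_prod hf).congr (Filter.Eventually.of_forall fun p ↦ mul_comm _ _)
  have hfour : Integrable (fun ξ ↦ 𝓕 f ξ * conj (𝓕 h ξ)) := by
    refine MemLp.integrable_mul (p := 2) (q := 2) (memLp_two_fourier hf hf2) ?_
    exact (memLp_two_fourier hh hh2).star
  have hL : Filter.Tendsto (fun k ↦ ∫ p : V × V, complexHeatKernel (z k) (p.1 - p.2) *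
      (f p.2 * conj (h p.1))) Filter.atTop (nhds (∫ p : V × V,
        complexHeatKernel (Complex.I * t) (p.1 - p.2) * (f p.2 * conj (h p.1)))) := by
    refine tendsto_integral_of_dominated_convergence
      (fun p ↦ (4 * Real.pi * |t|) ^ (-(Module.finrank ℝ V : ℝ) / 2) * ‖f p.2 * conj (h p.1)‖)
      (fun k ↦ ?_) (hprod.norm.const_mul _) (fun k ↦ Filter.Eventually.of_forall fun p ↦ ?_)
      (Filter.Eventually.of_forall fun p ↦ ?_)
    · exact (Continuous.aestronglyMeasurable (by fun_prop)).mul hprod.1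
    · rw [norm_mul]
      gcongr
      refine (norm_complexHeatKernel_le (hzpos k) _).trans ?_
      refine Real.rpow_le_rpow_of_nonpos (by positivity) ?_ ?_
      · have := Complex.abs_im_le_norm (z k)
        rw [hzim] at this
        gcongr
      · have : (0 : ℝ) ≤ Module.finrank ℝ V := by positivity
        linarith
    · refine Filter.Tendsto.mul_const _ ?_
      have hne : Complex.I * (t : ℂ) ≠ 0 := by simp [ht]
      unfold complexHeatKernel
      refine Filter.Tendsto.mul ?_ ?_
      · refine Filter.Tendsto.cpow (hzlim.const_mul _) tendsto_const_nhds ?_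
        right
        simp [ht, Real.pi_ne_zero]
      · refine (Complex.continuous_exp.tendsto _).comp ?_
        refine tendsto_const_nhds.div (hzlim.const_mul 4) (by simpa using ht)
  have hR : Filter.Tendsto (fun k ↦ ∫ ξ : V, Complex.exp (-(4 * Real.pi ^ 2 * z k) * ‖ξ‖ ^ 2) *
        (𝓕 f ξ * conj (𝓕 h ξ))) Filter.atTop (nhds (∫ ξ : V,
        Complex.exp (-(4 * Real.pi ^ 2 * (Complex.I * t)) * ‖ξ‖ ^ 2) *
        (𝓕 f ξ * conj (𝓕 h ξ)))) := by
    refine tendsto_integral_of_dominated_convergence (fun ξ ↦ ‖𝓕 f ξ * conj (𝓕 h ξ)‖)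
      (fun k ↦ ?_) hfour.norm (fun k ↦ Filter.Eventually.of_forall fun p ↦ ?_)
      (Filter.Eventually.of_forall fun p ↦ ?_)
    · exact (Continuous.aestronglyMeasurable (by fun_prop)).mul hfour.1
    · rw [norm_mul]
      refine mul_le_of_le_one_left (norm_nonneg _) ?_
      rw [Complex.norm_exp, Real.exp_le_one_iff]
      rw [show -(4 * (Real.pi : ℂ) ^ 2 * z k) * (‖p‖ : ℂ) ^ 2 =
        ((-(4 * Real.pi ^ 2 * ‖p‖ ^ 2) : ℝ) : ℂ) * z k by push_cast; ring, Complex.re_ofReal_mul]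
      have : 0 ≤ 4 * Real.pi ^ 2 * ‖p‖ ^ 2 := by positivity
      nlinarith [hzpos k, mul_nonneg this (hzpos k).le]
    · refine Filter.Tendsto.mul_const _ ((Complex.continuous_exp.tendsto _).comp ?_)
      exact ((hzlim.const_mul _).neg).mul_const _
  refine tendsto_nhds_unique hL (hR.congr fun k ↦ ?_)
  exact integral_gaussian_mul_fourier_mul_conj_fourier (hzpos k) hf hh

end Pairing

section Schrodinger

variable {n : ℕ}

lemma schrod_eq_integral_complexHeatKernel {t : ℝ} (ht : t ≠ 0)
    (f : EuclideanSpace ℝ (Fin n) → ℂ) (x : EuclideanSpace ℝ (Fin n)) :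
    schrod n t f x = ∫ y, complexHeatKernel (Complex.I * t) (x - y) * f y := by
  rw [schrod, if_neg ht, ← integral_const_mul]
  refine integral_congr_ae (Filter.Eventually.of_forall fun y ↦ ?_)
  have htc : (t : ℂ) ≠ 0 := by exact_mod_cast ht
  simp only [complexHeatKernel, finrank_euclideanSpace, Fintype.card_fin]
  rw [show -(‖x - y‖ : ℂ) ^ 2 / (4 * (Complex.I * t)) =
    Complex.I * (‖x - y‖ : ℂ) ^ 2 / (4 * (t : ℂ)) by
      field_simp; rw [Complex.I_sq]; ring]
  simp only [mul_assoc]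

lemma norm_complexHeatKernel_imaginary {t : ℝ} (ht : t ≠ 0) (v : EuclideanSpace ℝ (Fin n)) :
    ‖complexHeatKernel (Complex.I * t) v‖ = (4 * Real.pi * |t|) ^ (-(n : ℝ) / 2) := by
  have htc : (t : ℂ) ≠ 0 := by exact_mod_cast ht
  have hπ : (Real.pi : ℂ) ≠ 0 := by exact_mod_cast Real.pi_ne_zero
  rw [complexHeatKernel, norm_mul, finrank_euclideanSpace, Fintype.card_fin,
    show (-(n : ℂ) / 2) = ((-(n : ℝ) / 2 : ℝ) : ℂ) by push_cast; ring,
    Complex.norm_cpow_of_ne_zero (by simp [ht, hπ]),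
    show -(‖v‖ : ℂ) ^ 2 / (4 * (Complex.I * t)) = ((‖v‖ ^ 2 / (4 * t) : ℝ) : ℂ) * Complex.I by
      push_cast; field_simp; rw [Complex.I_sq]; ring, Complex.norm_exp_ofReal_mul_I]
  simp [abs_of_pos Real.pi_pos]

theorem integral_schrod_mul_conj {t : ℝ} (ht : t ≠ 0) {f h : EuclideanSpace ℝ (Fin n) → ℂ}
    (hf : Integrable f) (hf2 : MemLp f 2) (hh : Integrable h) (hh2 : MemLp h 2) :
    ∫ x, schrod n t f x * conj (h x) =
      ∫ ξ, Complex.exp (-(4 * Real.pi ^ 2 * (Complex.I * t)) * ‖ξ‖ ^ 2) *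
        (𝓕 f ξ * conj (𝓕 h ξ)) := by
  have hhc : Integrable (fun x ↦ conj (h x)) :=
    (RCLike.conjCLE (K := ℂ)).toContinuousLinearMap.integrable_comp hh
  rw [← integral_complexHeatKernel_imaginary_mul ht hf hf2 hh hh2]
  have hprod : Integrable (fun p : EuclideanSpace ℝ (Fin n) × EuclideanSpace ℝ (Fin n) ↦
      complexHeatKernel (Complex.I * t) (p.1 - p.2) * (f p.2 * conj (h p.1)))
      (volume.prod volume) := by
    refine ((hhc.mul_prod hf).congr
      (Filter.Eventually.of_forall fun p ↦ mul_comm _ _)).bdd_mul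
      (c := (4 * Real.pi * |t|) ^ (-(n : ℝ) / 2))
      (Continuous.aestronglyMeasurable (by fun_prop)) (Filter.Eventually.of_forall fun p ↦ ?_)
    exact (norm_complexHeatKernel_imaginary ht _).le
  rw [Measure.volume_eq_prod, integral_prod _ hprod]
  refine integral_congr_ae (Filter.Eventually.of_forall fun x ↦ ?_)
  simp only
  rw [schrod_eq_integral_complexHeatKernel ht, ← integral_mul_const]
  simp only [mul_assoc]

lemma enorm_schrod_le {t : ℝ} (ht : t ≠ 0) (f : EuclideanSpace ℝ (Fin n) → ℂ)
    (x : EuclideanSpace ℝ (Fin n)) :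
    ‖schrod n t f x‖ₑ ≤
      ENNReal.ofReal ((4 * Real.pi * |t|) ^ (-(n : ℝ) / 2)) * ∫⁻ y, ‖f y‖ₑ := by
  rw [schrod_eq_integral_complexHeatKernel ht]
  refine (enorm_integral_le_lintegral_enorm _).trans ?_
  rw [← lintegral_const_mul' _ _ ENNReal.ofReal_ne_top]
  refine lintegral_mono fun y ↦ ?_
  rw [enorm_mul, ← ofReal_norm, norm_complexHeatKernel_imaginary ht]

end Schrodinger

/-- Bounded measurable functions with bounded support. -/
def IsTest {V : Type*} [NormedAddCommGroup V] [MeasurableSpace V] (h : V → ℂ) : Prop :=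
  Measurable h ∧ ∃ R : ℝ, ∀ x, ‖h x‖ ≤ R ∧ (R < ‖x‖ → h x = 0)

section Test

variable {V : Type*} [NormedAddCommGroup V] [MeasurableSpace V] {μ : Measure V}

lemma IsTest.memLp [ProperSpace V] [IsFiniteMeasureOnCompacts μ] [OpensMeasurableSpace V]
    {h : V → ℂ} (hh : IsTest h) (p : ℝ≥0∞) : MemLp h p μ := by
  obtain ⟨hm, R, hR⟩ := hh
  have hball : MeasurableSet (Metric.closedBall (0 : V) R) :=
    Metric.isClosed_closedBall.measurableSet
  have hind : (Metric.closedBall (0 : V) R).indicator h = h := by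
    ext x
    by_cases hx : x ∈ Metric.closedBall (0 : V) R
    · simp [hx]
    · rw [Set.indicator_of_notMem hx, (hR x).2]
      simpa using hx
  rw [← hind, memLp_indicator_iff_restrict hball]
  have : IsFiniteMeasure (μ.restrict (Metric.closedBall (0 : V) R)) :=
    isFiniteMeasure_restrict.2 (isCompact_closedBall 0 R).measure_lt_top.ne
  exact MemLp.of_bound hm.aestronglyMeasurable R (Filter.Eventually.of_forall fun x ↦ (hR x).1)

lemma IsTest.integrable [ProperSpace V] [IsFiniteMeasureOnCompacts μ] [OpensMeasurableSpace V]
    {h : V → ℂ} (hh : IsTest h) : Integrable h μ :=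
  memLp_one_iff_integrable.1 (hh.memLp 1)

/-- The `L²` norm is controlled by pairing with bounded functions of bounded support. -/
lemma eLpNorm_two_le_of_pairing [ProperSpace V] [IsFiniteMeasureOnCompacts μ]
    [OpensMeasurableSpace V] {u : V → ℂ} (hu : Measurable u) {M : ℝ≥0∞}
    (H : ∀ h, IsTest h → ‖∫ x, u x * conj (h x) ∂μ‖ₑ ≤ M * eLpNorm h 2 μ) :
    eLpNorm u 2 μ ≤ M := by
  set S : ℕ → Set V := fun R ↦ {x | ‖x‖ ≤ R ∧ ‖u x‖ ≤ R} with hS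
  have hSm : ∀ R, MeasurableSet (S R) := fun R ↦
    (measurableSet_le measurable_norm measurable_const).inter
      (measurableSet_le hu.norm measurable_const)
  have htest : ∀ R, IsTest ((S R).indicator u) := fun R ↦ by
    refine ⟨hu.indicator (hSm R), R, fun x ↦ ⟨?_, fun hx ↦ ?_⟩⟩
    · by_cases hx : x ∈ S R
      · rw [Set.indicator_of_mem hx]; exact hx.2
      · rw [Set.indicator_of_notMem hx]; simp
    · exact Set.indicator_of_notMem (fun h ↦ absurd h.1 (not_le.2 hx)) _
  have hbound : ∀ R, ∫⁻ x in S R, ‖u x‖ₑ ^ 2 ∂μ ≤ M ^ 2 := by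
    intro R
    have hX : ∫⁻ x in S R, ‖u x‖ₑ ^ 2 ∂μ = eLpNorm ((S R).indicator u) 2 μ ^ 2 := by
      rw [eLpNorm_two_sq, ← lintegral_indicator (hSm R)]
      refine lintegral_congr fun x ↦ ?_
      by_cases hx : x ∈ S R <;> simp [hx]
    have h1 := H _ (htest R)
    have hint : Integrable (fun x ↦ ‖(S R).indicator u x‖ ^ 2) μ :=
      ((htest R).memLp 2).integrable_norm_pow two_ne_zero
    have h2 : ∫ x, u x * conj ((S R).indicator u x) ∂μ =
        ((∫ x, ‖(S R).indicator u x‖ ^ 2 ∂μ : ℝ) : ℂ) := by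
      rw [← integral_complex_ofReal]
      refine integral_congr_ae (Filter.Eventually.of_forall fun x ↦ ?_)
      by_cases hx : x ∈ S R
      · simp only [Set.indicator_of_mem hx, Complex.mul_conj, Complex.normSq_eq_norm_sq]
      · simp [Set.indicator_of_notMem hx]
    have h3 : ‖((∫ x, ‖(S R).indicator u x‖ ^ 2 ∂μ : ℝ) : ℂ)‖ₑ =
        eLpNorm ((S R).indicator u) 2 μ ^ 2 := by
      rw [eLpNorm_two_sq, ← ofReal_norm, Complex.norm_real, Real.norm_of_nonneg (by positivity),
        ofReal_integral_eq_lintegral_ofReal hint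
          (Filter.Eventually.of_forall fun _ ↦ by positivity)]
      refine lintegral_congr fun x ↦ ?_
      rw [ENNReal.ofReal_pow (by positivity), ofReal_norm]
    rw [h2, h3, sq] at h1
    rw [hX]
    by_cases h0 : eLpNorm ((S R).indicator u) 2 μ = 0
    · simp [h0]
    · gcongr
      exact (ENNReal.mul_le_mul_iff_left h0 ((htest R).memLp 2).2.ne).1 h1
  have hmono : Monotone S := fun a b hab x hx ↦
    ⟨hx.1.trans (by exact_mod_cast hab), hx.2.trans (by exact_mod_cast hab)⟩
  have hunion : ⋃ R, S R = Set.univ := by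
    refine Set.eq_univ_of_forall fun x ↦ Set.mem_iUnion.2 ?_
    obtain ⟨R, hR⟩ := exists_nat_ge (max ‖x‖ ‖u x‖)
    exact ⟨R, (le_max_left _ _).trans hR, (le_max_right _ _).trans hR⟩
  have : ∫⁻ x, ‖u x‖ₑ ^ 2 ∂μ ≤ M ^ 2 := by
    rw [← setLIntegral_univ, ← hunion, setLIntegral_iUnion_of_directed _ hmono.directed_le]
    exact iSup_le hbound
  rw [← eLpNorm_two_sq] at this
  exact (ENNReal.pow_le_pow_left_iff two_ne_zero).1 this

end Test

lemma lintegral_enorm_mul_conj_le {α : Type*} [MeasurableSpace α] {μ : Measure α} {f g : α → ℂ}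
    (hf : AEStronglyMeasurable f μ) (hg : AEStronglyMeasurable g μ) {p q : ℝ}
    (hpq : p.HolderConjugate q) :
    ∫⁻ x, ‖f x * conj (g x)‖ₑ ∂μ ≤ eLpNorm' f p μ * eLpNorm' g q μ := by
  refine (lintegral_congr fun x ↦ ?_).trans_le
    (ENNReal.lintegral_mul_le_Lp_mul_Lq μ hpq hf.enorm hg.enorm)
  rw [enorm_mul, ← ofReal_norm (conj (g x)), RCLike.norm_conj, ofReal_norm, Pi.mul_apply]

lemma lintegral_enorm_mul_conj_le_two {α : Type*} [MeasurableSpace α] {μ : Measure α} {f g : α → ℂ}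
    (hf : AEStronglyMeasurable f μ) (hg : AEStronglyMeasurable g μ) :
    ∫⁻ x, ‖f x * conj (g x)‖ₑ ∂μ ≤ eLpNorm f 2 μ * eLpNorm g 2 μ := by
  rw [eLpNorm_eq_eLpNorm' two_ne_zero ofNat_ne_top, eLpNorm_eq_eLpNorm' two_ne_zero ofNat_ne_top]
  exact lintegral_enorm_mul_conj_le hf hg Real.HolderConjugate.two_two

lemma enorm_integral_mul_conj_le {α : Type*} [MeasurableSpace α] {μ : Measure α} {f g : α → ℂ}
    (hf : AEStronglyMeasurable f μ) (hg : AEStronglyMeasurable g μ) :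
    ‖∫ x, f x * conj (g x) ∂μ‖ₑ ≤ eLpNorm f 2 μ * eLpNorm g 2 μ :=
  (enorm_integral_le_lintegral_enorm _).trans (lintegral_enorm_mul_conj_le_two hf hg)

section Schrodinger

variable {n : ℕ}

lemma measurable_schrod {φ : ℝ × EuclideanSpace ℝ (Fin n) → ℂ} (hφ : Measurable φ) :
    Measurable fun q : ℝ × ℝ × EuclideanSpace ℝ (Fin n) ↦
      schrod n q.1 (fun y ↦ φ (q.2.1, y)) q.2.2 := by
  unfold schrod
  refine Measurable.ite (measurableSet_eq_fun (by fun_prop) (by fun_prop)) (by fun_prop) ?_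
  refine Measurable.mul (by fun_prop) ?_
  have : StronglyMeasurable (Function.uncurry fun (q : ℝ × ℝ × EuclideanSpace ℝ (Fin n))
      (y : EuclideanSpace ℝ (Fin n)) ↦ Complex.exp (Complex.I * (‖q.2.2 - y‖ : ℂ) ^ 2 /
        (4 * (q.1 : ℂ)))
        * φ (q.2.1, y)) := by
    refine Measurable.stronglyMeasurable ?_
    unfold Function.uncurry
    fun_prop
  exact this.integral_prod_right.measurable

lemma measurable_schrod_apply {f : EuclideanSpace ℝ (Fin n) → ℂ} (hf : Measurable f) (t : ℝ) :
    Measurable (schrod n t f) :=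
  (measurable_schrod (n := n) (φ := fun p ↦ f p.2) (by fun_prop)).comp
    (show Measurable fun x : EuclideanSpace ℝ (Fin n) ↦ (t, (0 : ℝ), x) by fun_prop)

/-- The Schrödinger evolution does not increase the `L²` norm. -/
theorem eLpNorm_schrod_le {f : EuclideanSpace ℝ (Fin n) → ℂ} (hm : Measurable f)
    (hf : Integrable f) (hf2 : MemLp f 2) (t : ℝ) :
    eLpNorm (schrod n t f) 2 ≤ eLpNorm f 2 := by
  by_cases ht : t = 0
  · have : schrod n t f = f := by ext x; simp [schrod, ht]
    rw [this]
  refine eLpNorm_two_le_of_pairing (measurable_schrod_apply hm t) fun h hh ↦ ?_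
  rw [integral_schrod_mul_conj ht hf hf2 hh.integrable (hh.memLp 2)]
  have hphase : ∀ ξ : EuclideanSpace ℝ (Fin n),
      ‖Complex.exp (-(4 * Real.pi ^ 2 * (Complex.I * t)) * ‖ξ‖ ^ 2)‖ₑ = 1 := by
    intro ξ
    rw [← ofReal_norm, show -(4 * (Real.pi : ℂ) ^ 2 * (Complex.I * t)) * (‖ξ‖ : ℂ) ^ 2 =
      ((-(4 * Real.pi ^ 2 * t) * ‖ξ‖ ^ 2 : ℝ) : ℂ) * Complex.I by push_cast; ring,
      Complex.norm_exp_ofReal_mul_I, ENNReal.ofReal_one]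
  simp only [fun ξ ↦ (mul_assoc (Complex.exp (-(4 * (Real.pi : ℂ) ^ 2 * (Complex.I * t)) *
    (‖ξ‖ : ℂ) ^ 2)) (𝓕 f ξ) (conj (𝓕 h ξ))).symm]
  refine (enorm_integral_mul_conj_le ?_ ?_).trans (mul_le_mul' ?_ ?_)
  · exact ((Continuous.aestronglyMeasurable (by fun_prop)).mul
      (continuous_fourier_of_integrable hf).aestronglyMeasurable)
  · exact (continuous_fourier_of_integrable hh.integrable).aestronglyMeasurable
  · refine le_trans (le_of_eq ?_) (eLpNorm_fourier_le hf)
    refine eLpNorm_congr_enorm_ae (Filter.Eventually.of_forall fun ξ ↦ ?_)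
    rw [enorm_mul, hphase, one_mul]
  · exact eLpNorm_fourier_le hh.integrable

end Schrodinger

section Interpolation

variable {α β : Type*} [MeasurableSpace α] [MeasurableSpace β] {μ : Measure α} {ν : Measure β}

lemma lintegral_norm_gt_le {f : α → ℂ} (hf : Measurable f) {s r : ℝ} (hs : 0 < s) (hr : 1 ≤ r) :
    ∫⁻ x in {x | s < ‖f x‖}, ‖f x‖ₑ ∂μ ≤ ENNReal.ofReal (s ^ (1 - r)) * ∫⁻ x, ‖f x‖ₑ ^ r ∂μ := by
  have hm : MeasurableSet {x | s < ‖f x‖} := measurableSet_lt measurable_const hf.norm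
  rw [← lintegral_const_mul _ (by fun_prop)]
  refine (setLIntegral_mono' hm fun x hx ↦ ?_).trans (setLIntegral_le_lintegral _ _)
  have hx : s < ‖f x‖ := hx
  have h0 : 0 < ‖f x‖ := hs.trans hx
  rw [← ofReal_norm, ENNReal.ofReal_rpow_of_pos h0, ← ENNReal.ofReal_mul (by positivity)]
  refine ENNReal.ofReal_le_ofReal ?_
  calc ‖f x‖ = ‖f x‖ ^ (1 - r) * ‖f x‖ ^ r := by
        rw [← Real.rpow_add h0]; simp
    _ ≤ s ^ (1 - r) * ‖f x‖ ^ r := by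
        gcongr ?_ * _
        exact Real.rpow_le_rpow_of_nonpos hs hx.le (by linarith)

lemma measure_lt_norm_le_of_decomposition {u F : β → ℂ} (hu : Measurable u) {l : ℝ} (hl : 0 < l)
    (H : ∀ y, ‖F y‖ₑ ≤ ‖u y‖ₑ + ENNReal.ofReal (l / 2)) :
    ν {y | l < ‖F y‖} ≤ ENNReal.ofReal (4 * l ^ (-2 : ℝ)) * ∫⁻ y, ‖u y‖ₑ ^ 2 ∂ν := by
  have hsub : {y | l < ‖F y‖} ⊆ {y | ENNReal.ofReal (l ^ 2 / 4) ≤ ‖u y‖ₑ ^ 2} := by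
    intro y hy
    have hy : l < ‖F y‖ := hy
    have h1 := H y
    rw [← ofReal_norm, ← ofReal_norm, ← ENNReal.ofReal_add (by positivity) (by positivity),
      ENNReal.ofReal_le_ofReal_iff (by positivity)] at h1
    rw [Set.mem_ofPred_eq, ← ofReal_norm, ← ENNReal.ofReal_pow (by positivity)]
    refine ENNReal.ofReal_le_ofReal ?_
    nlinarith
  have h := mul_meas_ge_le_lintegral (μ := ν) (f := fun y ↦ ‖u y‖ₑ ^ 2) (by fun_prop)
    (ENNReal.ofReal (l ^ 2 / 4))
  calc ν {y | l < ‖F y‖} ≤ ν {y | ENNReal.ofReal (l ^ 2 / 4) ≤ ‖u y‖ₑ ^ 2} := measure_mono hsub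
    _ = ENNReal.ofReal (4 * l ^ (-2 : ℝ)) * (ENNReal.ofReal (l ^ 2 / 4) *
          ν {y | ENNReal.ofReal (l ^ 2 / 4) ≤ ‖u y‖ₑ ^ 2}) := by
        rw [← mul_assoc, ← ENNReal.ofReal_mul (by positivity)]
        rw [show 4 * l ^ (-2 : ℝ) * (l ^ 2 / 4) = 1 by
          rw [Real.rpow_neg hl.le, Real.rpow_two]; field_simp]
        simp
    _ ≤ _ := by gcongr

lemma lintegral_rpow_Ioc {b r : ℝ} (hb : 0 ≤ b) (hr : -1 < r) :
    ∫⁻ l in Set.Ioc 0 b, ENNReal.ofReal (l ^ r) = ENNReal.ofReal (b ^ (r + 1) / (r + 1)) := by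
  have hi := (intervalIntegral.intervalIntegrable_rpow' (a := 0) (b := b) hr)
  rw [intervalIntegrable_iff_integrableOn_Ioc_of_le hb] at hi
  rw [← ofReal_integral_eq_lintegral_ofReal hi, ← intervalIntegral.integral_of_le hb,
    integral_rpow (Or.inl hr), Real.zero_rpow (by linarith), sub_zero]
  filter_upwards [ae_restrict_mem measurableSet_Ioc] with l hl
  exact Real.rpow_nonneg hl.1.le _

/-- Marcinkiewicz interpolation between `L² → L²` and `L¹ → L^∞`, for a single function. -/
theorem lintegral_rpow_le_of_truncation [SFinite μ] {f : α → ℂ} {F : β → ℂ} (hf : Measurable f)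
    (hF : Measurable F) {A q : ℝ} (hA : 0 < A) (hq : 2 < q)
    (hD0 : ∫⁻ x, ‖f x‖ₑ ^ (q / (q - 1)) ∂μ ≠ 0) (hD : ∫⁻ x, ‖f x‖ₑ ^ (q / (q - 1)) ∂μ ≠ ⊤)
    (H : ∀ s : ℝ, 0 < s → ∃ u : β → ℂ, Measurable u ∧
      ∫⁻ y, ‖u y‖ₑ ^ 2 ∂ν ≤ ∫⁻ x in {x | ‖f x‖ ≤ s}, ‖f x‖ₑ ^ 2 ∂μ ∧
      ∀ y, ‖F y‖ₑ ≤ ‖u y‖ₑ + ENNReal.ofReal A * ∫⁻ x in {x | s < ‖f x‖}, ‖f x‖ₑ ∂μ) :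
    ∫⁻ y, ‖F y‖ₑ ^ q ∂ν ≤ ENNReal.ofReal (q * 4 * 2 ^ (q - 2) / (q - 2) * A ^ (q - 2)) *
      (∫⁻ x, ‖f x‖ₑ ^ (q / (q - 1)) ∂μ) ^ (q - 1) := by
  set D := (∫⁻ x, ‖f x‖ₑ ^ (q / (q - 1)) ∂μ).toReal with hDdef
  have hDeq : ∫⁻ x, ‖f x‖ₑ ^ (q / (q - 1)) ∂μ = ENNReal.ofReal D := (ENNReal.ofReal_toReal hD).symm
  have hDpos : 0 < D := ENNReal.toReal_pos hD0 hD
  have hq1 : 0 < q - 1 := by linarith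
  have hq2 : 0 < q - 2 := by linarith
  set B := 2 * A * D with hB
  have hBpos : 0 < B := by positivity
  have hlevel : ∀ l : ℝ, 0 < l → ν {y | l < ‖F y‖} ≤ ENNReal.ofReal (4 * l ^ (-2 : ℝ)) *
      ∫⁻ x in {x | ‖f x‖ ≤ (B / l) ^ (q - 1)}, ‖f x‖ₑ ^ 2 ∂μ := by
    intro l hl
    obtain ⟨u, hu, hu2, huF⟩ := H ((B / l) ^ (q - 1)) (by positivity)
    refine (measure_lt_norm_le_of_decomposition hu hl fun y ↦ (huF y).trans ?_).trans
      (by gcongr)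
    refine add_le_add_right ?_ _
    refine (mul_le_mul_right (lintegral_norm_gt_le (r := q / (q - 1)) hf
      (by positivity) ?_) _).trans (le_of_eq ?_)
    · rw [le_div_iff₀ hq1]; linarith
    · rw [hDeq, ← ENNReal.ofReal_mul (by positivity), ← ENNReal.ofReal_mul (by positivity)]
      congr 1
      rw [← Real.rpow_mul (by positivity), show (q - 1) * (1 - q / (q - 1)) = -1 by
        field_simp; ring, Real.rpow_neg_one, hB]
      field_simp
  have hset : ∀ x, ∀ l : ℝ, 0 < l → f x ≠ 0 →
      (‖f x‖ ≤ (B / l) ^ (q - 1) ↔ l ≤ B * ‖f x‖ ^ (-(1 / (q - 1)))) := by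
    intro x l hl hx
    have h0 : 0 < ‖f x‖ := norm_pos_iff.2 hx
    rw [Real.rpow_neg h0.le, ← div_eq_mul_inv, le_div_comm₀ hl (by positivity), one_div,
      Real.rpow_inv_le_iff_of_pos h0.le (by positivity) hq1]
  calc ∫⁻ y, ‖F y‖ₑ ^ q ∂ν = ∫⁻ y, ENNReal.ofReal (‖F y‖ ^ q) ∂ν := by
        refine lintegral_congr fun y ↦ ?_
        rw [← ofReal_norm, ENNReal.ofReal_rpow_of_nonneg (by positivity) (by linarith)]
    _ = ENNReal.ofReal q * ∫⁻ l in Set.Ioi 0, ν {y | l < ‖F y‖} * ENNReal.ofReal (l ^ (q - 1)) :=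
        lintegral_rpow_eq_lintegral_meas_lt_mul _
          (Filter.Eventually.of_forall fun _ ↦ norm_nonneg _)
          hF.norm.aemeasurable (by linarith)
    _ ≤ ENNReal.ofReal q * ∫⁻ l in Set.Ioi 0, ∫⁻ x, ENNReal.ofReal (4 * l ^ (q - 3)) *
          ({x | ‖f x‖ ≤ (B / l) ^ (q - 1)}.indicator (fun x ↦ ‖f x‖ₑ ^ 2) x) ∂μ := by
        gcongr _ * ?_
        refine setLIntegral_mono' measurableSet_Ioi fun l hl ↦ ?_
        have hl : 0 < l := hl
        have hms : MeasurableSet {x | ‖f x‖ ≤ (B / l) ^ (q - 1)} :=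
          measurableSet_le hf.norm measurable_const
        rw [lintegral_const_mul _ ((by fun_prop : Measurable fun x ↦ ‖f x‖ₑ ^ 2).indicator hms),
          lintegral_indicator hms]
        refine (mul_le_mul_left (hlevel l hl) _).trans (le_of_eq ?_)
        rw [mul_right_comm, ← ENNReal.ofReal_mul (by positivity), mul_assoc 4,
          ← Real.rpow_add hl, show -2 + (q - 1) = q - 3 by ring]
    _ = ENNReal.ofReal q * ∫⁻ x, (∫⁻ l in Set.Ioi 0, ENNReal.ofReal (4 * l ^ (q - 3)) *
          ({x | ‖f x‖ ≤ (B / l) ^ (q - 1)}.indicator (fun x ↦ ‖f x‖ₑ ^ 2) x)) ∂μ := by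
        rw [lintegral_lintegral_swap]
        have : MeasurableSet {z : ℝ × α | ‖f z.2‖ ≤ (B / z.1) ^ (q - 1)} :=
          measurableSet_le (by fun_prop) (by fun_prop)
        have h2 := ((by fun_prop : Measurable fun z : ℝ × α ↦ ‖f z.2‖ₑ ^ 2).indicator this)
        exact Measurable.aemeasurable (Measurable.mul (by fun_prop) h2)
    _ ≤ ENNReal.ofReal q * ∫⁻ x, ENNReal.ofReal (4 * (B ^ (q - 2) / (q - 2))) *
          ‖f x‖ₑ ^ (q / (q - 1)) ∂μ := by
        gcongr _ * ?_
        refine lintegral_mono fun x ↦ ?_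
        by_cases hx : f x = 0
        · simp [Set.indicator, hx]
        have h0 : 0 < ‖f x‖ := norm_pos_iff.2 hx
        set b := B * ‖f x‖ ^ (-(1 / (q - 1))) with hb
        have hbpos : 0 < b := by positivity
        calc ∫⁻ l in Set.Ioi 0, ENNReal.ofReal (4 * l ^ (q - 3)) *
              ({x | ‖f x‖ ≤ (B / l) ^ (q - 1)}.indicator (fun x ↦ ‖f x‖ₑ ^ 2) x)
            = ∫⁻ l in Set.Ioi 0, (Set.Ioc 0 b).indicator
                (fun l ↦ ENNReal.ofReal (l ^ (q - 3))) l * (4 * ‖f x‖ₑ ^ 2) := by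
              refine setLIntegral_congr_fun measurableSet_Ioi fun l hl ↦ ?_
              have hl : 0 < l := hl
              by_cases hlb : l ≤ b
              · have := (hset x l hl hx).2 hlb
                simp only [Set.indicator, Set.mem_ofPred_eq, this, if_true, Set.mem_Ioc, hl, hlb,
                  and_self]
                rw [ENNReal.ofReal_mul (by norm_num)]
                simp only [ofReal_ofNat]
                ring
              · have := mt (hset x l hl hx).1 hlb
                simp [Set.indicator, this, hlb]
          _ = ENNReal.ofReal (b ^ (q - 2) / (q - 2)) * (4 * ‖f x‖ₑ ^ 2) := by
              rw [lintegral_mul_const _ ((by fun_prop : Measurable fun l : ℝ ↦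
                ENNReal.ofReal (l ^ (q - 3))).indicator measurableSet_Ioc),
                lintegral_indicator measurableSet_Ioc, Measure.restrict_restrict measurableSet_Ioc,
                Set.inter_eq_left.2 (fun l hl ↦ hl.1), lintegral_rpow_Ioc hbpos.le (by linarith),
                show q - 3 + 1 = q - 2 by ring]
          _ ≤ _ := by
              rw [← ofReal_norm, ENNReal.ofReal_rpow_of_pos h0, ← ENNReal.ofReal_pow h0.le,
                ← ENNReal.ofReal_ofNat, ← ENNReal.ofReal_mul (by norm_num),
                ← ENNReal.ofReal_mul (by positivity), ← ENNReal.ofReal_mul (by positivity)]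
              refine ENNReal.ofReal_le_ofReal (le_of_eq ?_)
              rw [hb, Real.mul_rpow hBpos.le (by positivity), ← Real.rpow_mul h0.le,
                ← Real.rpow_natCast]
              have : ‖f x‖ ^ (q / (q - 1)) = ‖f x‖ ^ (-(1 / (q - 1)) * (q - 2)) *
                  ‖f x‖ ^ ((2 : ℕ) : ℝ) := by
                rw [← Real.rpow_add h0]
                congr 1
                push_cast
                field_simp
                ring
              rw [this]
              ring
    _ = _ := by
        rw [lintegral_const_mul _ (by fun_prop), hDeq, ENNReal.ofReal_rpow_of_pos hDpos,
          ← ENNReal.ofReal_mul (by positivity), ← ENNReal.ofReal_mul (by positivity),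
          ← ENNReal.ofReal_mul (by positivity)]
        congr 1
        rw [hB, Real.mul_rpow (by positivity) hDpos.le, Real.mul_rpow (by positivity) hA.le,
          show q - 1 = (q - 2) + 1 by ring, Real.rpow_add_one hDpos.ne']
        ring

end Interpolation

section Dispersive

variable {n : ℕ}

lemma schrod_add {f g : EuclideanSpace ℝ (Fin n) → ℂ} (hf : Integrable f) (hg : Integrable g)
    (t : ℝ) (x : EuclideanSpace ℝ (Fin n)) :
    schrod n t (f + g) x = schrod n t f x + schrod n t g x := by
  have hint : ∀ {f : EuclideanSpace ℝ (Fin n) → ℂ}, Integrable f → Integrable fun y ↦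
      Complex.exp (Complex.I * (‖x - y‖ : ℂ) ^ 2 / (4 * (t : ℂ))) * f y := fun hf ↦ by
    refine hf.bdd_mul (c := 1) (Continuous.aestronglyMeasurable (by fun_prop))
      (Filter.Eventually.of_forall fun y ↦ le_of_eq ?_)
    rw [show Complex.I * (‖x - y‖ : ℂ) ^ 2 / (4 * (t : ℂ)) =
      ((‖x - y‖ ^ 2 / (4 * t) : ℝ) : ℂ) * Complex.I by push_cast; ring,
      Complex.norm_exp_ofReal_mul_I]
  unfold schrod
  split_ifs with ht
  · rfl
  · simp only [Pi.add_apply, mul_add]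
    rw [integral_add (hint hf) (hint hg), mul_add]

/-- The fixed-time dispersive estimate from `L^{q'}` to `L^q`. -/
theorem exists_eLpNorm'_schrod_le (n : ℕ) {q : ℝ} (hq : 2 < q) :
    ∃ C : ℝ≥0∞, C ≠ ⊤ ∧ ∀ (t : ℝ) (f : EuclideanSpace ℝ (Fin n) → ℂ), t ≠ 0 → Measurable f →
      Integrable f → MemLp f 2 →
      eLpNorm' (schrod n t f) q volume ≤
        C * ENNReal.ofReal (|t| ^ (-(n * (1 / 2 - 1 / q)))) * eLpNorm' f (q / (q - 1)) volume := by
  have hq1 : 0 < q - 1 := by linarith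
  have hq2 : 0 < q - 2 := by linarith
  have hq0 : 0 < q := by linarith
  set K := q * 4 * 2 ^ (q - 2) / (q - 2) with hK
  have hKpos : 0 < K := by positivity
  refine ⟨ENNReal.ofReal (K ^ (1 / q) * (4 * Real.pi) ^ (-(n * (1 / 2 - 1 / q)))),
    ENNReal.ofReal_ne_top, fun t f ht hm hf hf2 ↦ ?_⟩
  have htpos : 0 < |t| := abs_pos.2 ht
  by_cases hD0 : ∫⁻ x, ‖f x‖ₑ ^ (q / (q - 1)) = 0
  · have hae : f =ᵐ[volume] 0 := by
      rw [lintegral_eq_zero_iff (by fun_prop)] at hD0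
      filter_upwards [hD0] with x hx
      have hx : ‖f x‖ₑ ^ (q / (q - 1)) = 0 := hx
      rwa [ENNReal.rpow_eq_zero_iff_of_pos (by positivity), enorm_eq_zero] at hx
    have hzero : schrod n t f = 0 := by
      ext x
      have h := enorm_schrod_le ht f x
      have h2 : ∫⁻ y, ‖f y‖ₑ = 0 := by
        rw [lintegral_eq_zero_iff (by fun_prop)]
        filter_upwards [hae] with x hx
        simp [hx]
      rw [h2, mul_zero, nonpos_iff_eq_zero, enorm_eq_zero] at h
      exact h
    rw [hzero, eLpNorm'_zero hq0]
    exact zero_le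
  by_cases hD : ∫⁻ x, ‖f x‖ₑ ^ (q / (q - 1)) = ⊤
  · have : eLpNorm' f (q / (q - 1)) volume = ⊤ := by
      rw [eLpNorm', hD, ENNReal.top_rpow_of_pos (by positivity)]
    rw [this, ENNReal.mul_top]
    · exact le_top
    · exact (mul_pos (ENNReal.ofReal_pos.2 (by positivity)).ne'
        (ENNReal.ofReal_pos.2 (by positivity)).ne').ne'
  set A := (4 * Real.pi * |t|) ^ (-(n : ℝ) / 2) with hA
  have hApos : 0 < A := by positivity
  have key := lintegral_rpow_le_of_truncation (ν := volume) hm (measurable_schrod_apply hm t)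
    hApos hq
    hD0 hD fun s hs ↦ by
      have hms : MeasurableSet {x | ‖f x‖ ≤ s} := measurableSet_le hm.norm measurable_const
      have hms' : {x | s < ‖f x‖} = {x | ‖f x‖ ≤ s}ᶜ := by ext x; simp
      refine ⟨schrod n t ({x | ‖f x‖ ≤ s}.indicator f),
        measurable_schrod_apply (hm.indicator hms) t, ?_, fun x ↦ ?_⟩
      · have := eLpNorm_schrod_le (hm.indicator hms) (hf.indicator hms) (hf2.indicator hms) t
        rw [← ENNReal.pow_le_pow_left_iff two_ne_zero, eLpNorm_two_sq, eLpNorm_two_sq] at this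
        refine this.trans (le_of_eq ?_)
        rw [← lintegral_indicator hms]
        refine lintegral_congr fun x ↦ ?_
        by_cases hx : x ∈ {x | ‖f x‖ ≤ s} <;> simp [Set.indicator, hx]
      · conv_lhs => rw [← Set.indicator_self_add_compl {x | ‖f x‖ ≤ s} f,
          schrod_add (hf.indicator hms) (hf.indicator hms.compl)]
        refine (enorm_add_le _ _).trans (add_le_add_right ?_ _)
        refine (enorm_schrod_le ht _ x).trans (le_of_eq ?_)
        rw [hms', ← lintegral_indicator hms.compl]
        congr 1
        refine lintegral_congr fun x ↦ ?_
        by_cases hx : x ∈ {x | ‖f x‖ ≤ s}ᶜ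
        · rw [Set.indicator_of_mem hx, Set.indicator_of_mem hx]
        · rw [Set.indicator_of_notMem hx, Set.indicator_of_notMem hx, enorm_zero]
  rw [eLpNorm', eLpNorm']
  refine (ENNReal.rpow_le_rpow key (by positivity)).trans (le_of_eq ?_)
  rw [ENNReal.mul_rpow_of_nonneg _ _ (by positivity), ENNReal.ofReal_rpow_of_pos (by positivity),
    ← ENNReal.ofReal_mul (by positivity), ← ENNReal.rpow_mul]
  congr 2
  · rw [Real.mul_rpow hKpos.le (by positivity), ← Real.rpow_mul hApos.le, hA,
      ← Real.rpow_mul (by positivity), mul_assoc (K ^ (1 / q)),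
      ← Real.mul_rpow (by positivity) (by positivity)]
    congr 2
    field_simp
  · field_simp

end Dispersive

section FractionalIntegration

lemma lintegral_comp_abs (G : ℝ → ℝ≥0∞) :
    ∫⁻ u, G |u| = 2 * ∫⁻ u in Set.Ioi 0, G u := by
  have h1 : ∫⁻ u in Set.Ioi (0 : ℝ), G |u| = ∫⁻ u in Set.Ioi 0, G u :=
    setLIntegral_congr_fun measurableSet_Ioi fun u hu ↦ by
      rw [abs_of_pos hu]
  have h2 : ∫⁻ u in Set.Iio (0 : ℝ), G |u| = ∫⁻ u in Set.Ioi 0, G u := by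
    rw [← h1, ← (Measure.measurePreserving_neg (volume : Measure ℝ)).setLIntegral_comp_preimage_emb
      (MeasurableEquiv.neg ℝ).measurableEmbedding _ (Set.Ioi 0)]
    simp
  rw [← lintegral_add_compl _ (measurableSet_Ioi (a := (0 : ℝ))), h1, Set.compl_Ioi,
    setLIntegral_congr Iio_ae_eq_Iic.symm, h2, two_mul]

lemma lintegral_abs_rpow_near {a ρ : ℝ} (ha : a < 1) (hρ : 0 < ρ) (t : ℝ) :
    ∫⁻ s in {s | |t - s| ≤ ρ}, ENNReal.ofReal (|t - s| ^ (-a)) =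
      ENNReal.ofReal (2 * ρ ^ (1 - a) / (1 - a)) := by
  have hm : MeasurableSet {s : ℝ | |t - s| ≤ ρ} := measurableSet_le (by fun_prop) (by fun_prop)
  rw [← lintegral_indicator hm]
  have : ∀ s, {s | |t - s| ≤ ρ}.indicator (fun s ↦ ENNReal.ofReal (|t - s| ^ (-a))) s =
      (fun v ↦ (Set.Iic ρ).indicator (fun u : ℝ ↦ ENNReal.ofReal (u ^ (-a))) |v|) (t - s) := by
    intro s
    by_cases hs : |t - s| ≤ ρ <;> simp [Set.indicator, hs]
  simp_rw [this]
  rw [lintegral_sub_left_eq_self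
    (fun v ↦ (Set.Iic ρ).indicator (fun u : ℝ ↦ ENNReal.ofReal (u ^ (-a))) |v|) t,
    lintegral_comp_abs, lintegral_indicator measurableSet_Iic,
    Measure.restrict_restrict measurableSet_Iic, Set.inter_comm, Set.Ioi_inter_Iic,
    lintegral_rpow_Ioc hρ.le (by linarith), ← ENNReal.ofReal_ofNat,
    ← ENNReal.ofReal_mul (by norm_num)]
  congr 1
  rw [show -a + 1 = 1 - a by ring]
  ring

lemma lintegral_abs_rpow_far {ρ : ℝ} (hρ : 0 < ρ) (t : ℝ) :
    ∫⁻ s in {s | |t - s| ≤ ρ}ᶜ, ENNReal.ofReal (|t - s| ^ (-2 : ℝ)) =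
      ENNReal.ofReal (2 / ρ) := by
  have hm : MeasurableSet {s : ℝ | |t - s| ≤ ρ}ᶜ :=
    (measurableSet_le (by fun_prop) (by fun_prop)).compl
  rw [← lintegral_indicator hm]
  have : ∀ s, ({s | |t - s| ≤ ρ}ᶜ).indicator (fun s ↦ ENNReal.ofReal (|t - s| ^ (-2 : ℝ))) s =
      (fun v ↦ (Set.Ioi ρ).indicator (fun u : ℝ ↦ ENNReal.ofReal (u ^ (-2 : ℝ))) |v|) (t - s) := by
    intro s
    by_cases hs : |t - s| ≤ ρ
    · simp [Set.indicator, hs]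
    · simp [Set.indicator, hs, not_le.1 hs]
  simp_rw [this]
  rw [lintegral_sub_left_eq_self
    (fun v ↦ (Set.Ioi ρ).indicator (fun u : ℝ ↦ ENNReal.ofReal (u ^ (-2 : ℝ))) |v|) t,
    lintegral_comp_abs, lintegral_indicator measurableSet_Ioi,
    Measure.restrict_restrict measurableSet_Ioi, Set.Ioi_inter_Ioi, max_eq_left hρ.le,
    ← ofReal_integral_eq_lintegral_ofReal
      (integrableOn_Ioi_rpow_of_lt (by norm_num) hρ), integral_Ioi_rpow_of_lt (by norm_num) hρ,
    ← ENNReal.ofReal_ofNat, ← ENNReal.ofReal_mul (by norm_num)]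
  · congr 1
    norm_num
    rw [Real.rpow_neg_one]
    ring
  · filter_upwards [ae_restrict_mem measurableSet_Ioi] with u hu
    exact Real.rpow_nonneg (hρ.trans hu).le _

/-- The Hardy–Littlewood–Sobolev inequality on the line, in its diagonal form. -/
theorem lintegral_abs_rpow_mul_mul_le {a : ℝ} (ha : 0 < a) (ha1 : a < 1) {H : ℝ → ℝ≥0∞}
    (hH : Measurable H) (hfin : ∀ t, H t ≠ ⊤) :
    ∫⁻ t, ∫⁻ s, ENNReal.ofReal (|t - s| ^ (-a)) * H s * H t ≤
      ENNReal.ofReal (2 * (2 / (1 - a) + 2 ^ (a / 2))) * (∫⁻ t, H t ^ (2 / (2 - a))) ^ (2 - a) := by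
  have ha2 : 0 < 2 - a := by linarith
  have ha3 : 0 < 1 - a := by linarith
  set C := 2 / (1 - a) + 2 ^ (a / 2) with hC
  have hCpos : 0 < C := by positivity
  by_cases hD0 : ∫⁻ t, H t ^ (2 / (2 - a)) = 0
  · have hz : H =ᵐ[volume] 0 := by
      rw [lintegral_eq_zero_iff (by fun_prop)] at hD0
      filter_upwards [hD0] with x hx
      have hx : H x ^ (2 / (2 - a)) = 0 := hx
      rwa [ENNReal.rpow_eq_zero_iff_of_pos (by positivity)] at hx
    have : ∫⁻ t, ∫⁻ s, ENNReal.ofReal (|t - s| ^ (-a)) * H s * H t = ∫⁻ t, 0 :=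
      lintegral_congr_ae (hz.mono fun t ht ↦ by simp [ht])
    rw [this, lintegral_zero]
    exact zero_le
  by_cases hD : ∫⁻ t, H t ^ (2 / (2 - a)) = ⊤
  · rw [hD, ENNReal.top_rpow_of_pos ha2, ENNReal.mul_top (ENNReal.ofReal_pos.2 (by positivity)).ne']
    exact le_top
  set D := (∫⁻ t, H t ^ (2 / (2 - a))).toReal with hDdef
  have hDeq : ∫⁻ t, H t ^ (2 / (2 - a)) = ENNReal.ofReal D := (ENNReal.ofReal_toReal hD).symm
  have hDpos : 0 < D := ENNReal.toReal_pos hD0 hD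
  set k : ℝ → ℝ → ℝ≥0∞ := fun t s ↦ ENNReal.ofReal (|t - s| ^ (-a)) with hk
  have hkm : Measurable fun z : ℝ × ℝ ↦ k z.1 z.2 := by simp only [hk]; fun_prop
  have hksymm : ∀ t s, k t s = k s t := fun t s ↦ by simp only [hk]; rw [abs_sub_comm]
  have hset : MeasurableSet {z : ℝ × ℝ | H z.2 ≤ H z.1} :=
    measurableSet_le (by fun_prop) (by fun_prop)
  have hlow : ∀ t, MeasurableSet {s | H s ≤ H t} := fun t ↦ measurableSet_le hH measurable_const
  set J : ℝ → ℝ → ℝ≥0∞ := fun t s ↦ {s | H s ≤ H t}.indicator (fun s ↦ k t s * H s * H t) s with hJ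
  have hJm : Measurable fun z : ℝ × ℝ ↦ J z.1 z.2 :=
    Measurable.indicator (f := fun z : ℝ × ℝ ↦ k z.1 z.2 * H z.2 * H z.1) (by fun_prop) hset
  have hsum : ∀ t s, k t s * H s * H t ≤ J t s + J s t := by
    intro t s
    rcases le_total (H s) (H t) with h | h
    · exact le_add_right (by simp [hJ, h])
    · refine le_add_left ?_
      simp only [hJ, Set.indicator, Set.mem_ofPred_eq, h, if_true, hksymm s t, mul_right_comm,
        le_refl]
  have hinner : ∀ t, H t ≠ 0 → ∫⁻ s in {s | H s ≤ H t}, k t s * H s ≤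
      ENNReal.ofReal (C * D ^ (1 - a)) * H t ^ (2 / (2 - a) - 1) := by
    intro t ht
    set l := (H t).toReal with hl
    have hHl : H t = ENNReal.ofReal l := (ENNReal.ofReal_toReal (hfin t)).symm
    have hlpos : 0 < l := ENNReal.toReal_pos ht (hfin t)
    set ρ := D * l ^ (-(2 / (2 - a))) with hρ
    have hρpos : 0 < ρ := by positivity
    have hn : MeasurableSet {s : ℝ | |t - s| ≤ ρ} := measurableSet_le (by fun_prop) (by fun_prop)
    have hnear : ∫⁻ s in {s | |t - s| ≤ ρ}, {s | H s ≤ H t}.indicator (fun s ↦ k t s * H s) s ≤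
        ENNReal.ofReal (2 * ρ ^ (1 - a) / (1 - a) * l) := by
      rw [ENNReal.ofReal_mul (by positivity), ← lintegral_abs_rpow_near ha1 hρpos t,
        ← lintegral_mul_const _ (by fun_prop)]
      refine lintegral_mono fun s ↦ ?_
      by_cases hs : H s ≤ H t
      · simp only [Set.indicator, Set.mem_ofPred_eq, hs, if_true]
        rw [← hHl]
        gcongr
      · simp [Set.indicator, hs]
    have hfar : ∫⁻ s in {s | |t - s| ≤ ρ}ᶜ, {s | H s ≤ H t}.indicator (fun s ↦ k t s * H s) s ≤
        ENNReal.ofReal ((2 / ρ) ^ (a / 2) * D ^ (1 - a / 2)) := by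
      have hconj : (2 / a).HolderConjugate (2 / (2 - a)) := by
        rw [Real.holderConjugate_iff]
        refine ⟨by rw [lt_div_iff₀ ha]; linarith, by field_simp; ring⟩
      calc _ ≤ ∫⁻ s in {s | |t - s| ≤ ρ}ᶜ, (k t * H) s :=
            lintegral_mono fun s ↦ Set.indicator_le_self _ _ _
        _ ≤ _ := ENNReal.lintegral_mul_le_Lp_mul_Lq _ hconj (by simp only [hk]; fun_prop)
            hH.aemeasurable
        _ ≤ ENNReal.ofReal (2 / ρ) ^ (1 / (2 / a)) * ENNReal.ofReal D ^ (1 / (2 / (2 - a))) := by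
            gcongr
            · rw [← lintegral_abs_rpow_far hρpos t]
              refine setLIntegral_mono' hn.compl fun s hs ↦ ?_
              simp only [hk]
              rw [ENNReal.ofReal_rpow_of_nonneg (by positivity) (by positivity),
                ← Real.rpow_mul (abs_nonneg _)]
              refine le_of_eq ?_
              congr 2
              field_simp
            · rw [← hDeq]
              exact setLIntegral_le_lintegral _ _
        _ = _ := by
            rw [ENNReal.ofReal_rpow_of_pos (by positivity), ENNReal.ofReal_rpow_of_pos hDpos,
              ← ENNReal.ofReal_mul (by positivity)]
            congr 3
            · field_simp
            · field_simp
    rw [← lintegral_indicator (hlow t), ← lintegral_add_compl _ hn]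
    refine (add_le_add hnear hfar).trans (le_of_eq ?_)
    rw [← ENNReal.ofReal_add (by positivity) (by positivity), hHl,
      ENNReal.ofReal_rpow_of_pos hlpos, ← ENNReal.ofReal_mul (by positivity)]
    congr 1
    have e1 : ρ ^ (1 - a) * l = D ^ (1 - a) * l ^ (2 / (2 - a) - 1) := by
      rw [hρ, Real.mul_rpow hDpos.le (by positivity), ← Real.rpow_mul hlpos.le, mul_assoc,
        ← Real.rpow_add_one hlpos.ne']
      congr 2
      field_simp
      ring
    have e2 : (2 / ρ) ^ (a / 2) * D ^ (1 - a / 2) =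
        2 ^ (a / 2) * (D ^ (1 - a) * l ^ (2 / (2 - a) - 1)) := by
      rw [Real.div_rpow (by norm_num) hρpos.le, hρ, Real.mul_rpow hDpos.le (by positivity),
        ← Real.rpow_mul hlpos.le, div_eq_mul_inv, mul_inv, ← Real.rpow_neg hDpos.le,
        ← Real.rpow_neg hlpos.le, show 1 - a = -(a / 2) + (1 - a / 2) by ring,
        Real.rpow_add hDpos, show -(-(2 / (2 - a)) * (a / 2)) = 2 / (2 - a) - 1 by field_simp; ring]
      ring
    rw [e2, show 2 * ρ ^ (1 - a) / (1 - a) * l = 2 / (1 - a) * (ρ ^ (1 - a) * l) by ring, e1, hC]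
    ring
  have hmain : ∫⁻ t, ∫⁻ s, J t s ≤ ENNReal.ofReal (C * D ^ (2 - a)) := by
    calc ∫⁻ t, ∫⁻ s, J t s
        ≤ ∫⁻ t, ENNReal.ofReal (C * D ^ (1 - a)) * H t ^ (2 / (2 - a)) := by
          refine lintegral_mono fun t ↦ ?_
          by_cases ht : H t = 0
          · simp [hJ, Set.indicator, ht]
          · simp only [hJ]
            rw [lintegral_indicator (hlow t), lintegral_mul_const _ (by simp only [hk]; fun_prop)]
            refine (mul_le_mul_left (hinner t ht) _).trans (le_of_eq ?_)
            rw [mul_assoc]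
            congr 1
            conv_lhs => enter [2]; rw [← ENNReal.rpow_one (H t)]
            rw [← ENNReal.rpow_add _ _ ht (hfin t)]
            congr 1
            ring
      _ = _ := by
          rw [lintegral_const_mul _ (by fun_prop), hDeq, ← ENNReal.ofReal_mul (by positivity),
            mul_assoc, ← Real.rpow_add_one hDpos.ne', show 1 - a + 1 = 2 - a by ring]
  calc ∫⁻ t, ∫⁻ s, k t s * H s * H t ≤ ∫⁻ t, ∫⁻ s, (J t s + J s t) :=
        lintegral_mono fun t ↦ lintegral_mono fun s ↦ hsum t s
    _ = (∫⁻ t, ∫⁻ s, J t s) + ∫⁻ t, ∫⁻ s, J s t := by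
        rw [← lintegral_add_left hJm.lintegral_prod_right']
        exact lintegral_congr fun t ↦ lintegral_add_left (hJm.comp measurable_prodMk_left) _
    _ = 2 * ∫⁻ t, ∫⁻ s, J t s := by
        rw [lintegral_lintegral_swap (f := fun t s ↦ J s t)
          (hJm.comp measurable_swap).aemeasurable, two_mul]
    _ ≤ 2 * ENNReal.ofReal (C * D ^ (2 - a)) := by gcongr
    _ = _ := by
        rw [hDeq, ENNReal.ofReal_rpow_of_pos hDpos, ← ENNReal.ofReal_mul (by positivity),
          ← ENNReal.ofReal_ofNat, ← ENNReal.ofReal_mul (by norm_num)]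
        congr 1
        ring

end FractionalIntegration

/-- The polynomial weight `(1 + ‖x‖) ^ (-r)`. -/
noncomputable def decayWeight {V : Type*} [NormedAddCommGroup V] (r : ℝ) (x : V) : ℝ≥0∞ :=
  ENNReal.ofReal ((1 + ‖x‖) ^ (-r))

section DecayWeight

variable {V : Type*} [NormedAddCommGroup V]

@[fun_prop]
lemma measurable_decayWeight [MeasurableSpace V] [OpensMeasurableSpace V] (r : ℝ) :
    Measurable (decayWeight r : V → ℝ≥0∞) := by
  unfold decayWeight
  fun_prop

lemma decayWeight_le_one {r : ℝ} (hr : 0 ≤ r) (x : V) : decayWeight r x ≤ 1 := by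
  rw [decayWeight, ← ENNReal.ofReal_one]
  exact ENNReal.ofReal_le_ofReal (Real.rpow_le_one_of_one_le_of_nonpos
    (le_add_of_nonneg_right (norm_nonneg x)) (by linarith))

lemma decayWeight_rpow_le_self {r p : ℝ} (hr : 0 ≤ r) (hp : 1 ≤ p) (x : V) :
    decayWeight r x ^ p ≤ decayWeight r x :=
  ENNReal.rpow_le_self_of_le_one (decayWeight_le_one hr x) hp

lemma lintegral_decayWeight_lt_top [NormedSpace ℝ V] [FiniteDimensional ℝ V] [MeasurableSpace V]
    [BorelSpace V] (μ : Measure V) [μ.IsAddHaarMeasure] {r : ℝ}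
    (hr : (Module.finrank ℝ V : ℝ) < r) : ∫⁻ x, decayWeight r x ∂μ < ⊤ := by
  have h := (integrable_one_add_norm (μ := μ) hr).2
  rw [hasFiniteIntegral_iff_ofReal (Filter.Eventually.of_forall fun x ↦ by positivity)] at h
  exact h

lemma enorm_mul_decayWeight_le (r : ℝ) (x : V) :
    ‖x‖ₑ * decayWeight (r + 1) x ≤ decayWeight r x := by
  rw [decayWeight, decayWeight, ← ofReal_norm, ← ENNReal.ofReal_mul (norm_nonneg x)]
  refine ENNReal.ofReal_le_ofReal ?_
  have h : 0 < 1 + ‖x‖ := by positivity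
  rw [show -r = -(r + 1) + 1 by ring, Real.rpow_add_one h.ne', mul_comm]
  gcongr
  linarith

end DecayWeight

/-- Measurable functions of time and space with polynomial decay. -/
def IsSource {n : ℕ} (r : ℝ) (φ : ℝ × EuclideanSpace ℝ (Fin n) → ℂ) : Prop :=
  Measurable φ ∧ ∃ C : ℝ≥0∞, C ≠ ⊤ ∧ ∀ s x, ‖φ (s, x)‖ₑ ≤ C * (decayWeight 2 s * decayWeight r x)

namespace IsSource

variable {n : ℕ} {r : ℝ} {φ : ℝ × EuclideanSpace ℝ (Fin n) → ℂ}

lemma indicator (hφ : IsSource r φ) {S : Set (ℝ × EuclideanSpace ℝ (Fin n))}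
    (hS : MeasurableSet S) : IsSource r (S.indicator φ) := by
  obtain ⟨hm, C, hC, hb⟩ := hφ
  refine ⟨hm.indicator hS, C, hC, fun s x ↦ le_trans ?_ (hb s x)⟩
  exact enorm_indicator_le_enorm_self _ _

lemma norm_smul_left (hφ : IsSource (r + 1) φ) {f : EuclideanSpace ℝ (Fin n) → ℂ}
    (hf : Measurable f) (hfx : ∀ x, ‖f x‖ₑ ≤ ‖x‖ₑ) : IsSource r fun z ↦ f z.2 * φ z := by
  obtain ⟨hm, C, hC, hb⟩ := hφ
  refine ⟨by fun_prop, C, hC, fun s x ↦ ?_⟩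
  rw [enorm_mul]
  calc ‖f x‖ₑ * ‖φ (s, x)‖ₑ ≤ ‖x‖ₑ * (C * (decayWeight 2 s * decayWeight (r + 1) x)) :=
        mul_le_mul' (hfx x) (hb s x)
    _ = C * (decayWeight 2 s * (‖x‖ₑ * decayWeight (r + 1) x)) := by ring
    _ ≤ _ := by gcongr; exact enorm_mul_decayWeight_le r x

lemma measurable_slice (hφ : IsSource r φ) (s : ℝ) : Measurable fun x ↦ φ (s, x) :=
  hφ.1.comp measurable_prodMk_left

lemma exists_eLpNorm'_slice_le (hφ : IsSource r φ) (hr : n < r) {p : ℝ} (hp : 1 ≤ p) :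
    ∃ C : ℝ≥0∞, C ≠ ⊤ ∧ ∀ s, eLpNorm' (fun x ↦ φ (s, x)) p volume ≤ C * decayWeight 2 s := by
  obtain ⟨hm, C, hC, hb⟩ := hφ
  have hp0 : 0 < p := by linarith
  have hr0 : 0 ≤ r := le_trans (Nat.cast_nonneg n) hr.le
  have hfin := lintegral_decayWeight_lt_top (volume : Measure (EuclideanSpace ℝ (Fin n)))
    (r := r) (by simpa using hr)
  refine ⟨C * (∫⁻ x : EuclideanSpace ℝ (Fin n), decayWeight r x) ^ (1 / p),
    ENNReal.mul_ne_top hC (ENNReal.rpow_ne_top_of_nonneg (by positivity) hfin.ne), fun s ↦ ?_⟩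
  rw [eLpNorm']
  calc (∫⁻ x, ‖φ (s, x)‖ₑ ^ p) ^ (1 / p)
      ≤ (∫⁻ x : EuclideanSpace ℝ (Fin n), (C * decayWeight 2 s) ^ p * decayWeight r x) ^
        (1 / p) := by
        gcongr with x
        refine (ENNReal.rpow_le_rpow (hb s x) hp0.le).trans ?_
        rw [← mul_assoc, ENNReal.mul_rpow_of_nonneg _ _ hp0.le]
        gcongr
        exact decayWeight_rpow_le_self hr0 hp x
    _ = _ := by
        rw [lintegral_const_mul _ (by fun_prop), ENNReal.mul_rpow_of_nonneg _ _ (by positivity),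
          ← ENNReal.rpow_mul, mul_one_div_cancel hp0.ne', ENNReal.rpow_one]
        ring

lemma decayWeight_ne_top (s : ℝ) : decayWeight 2 s ≠ ⊤ := ENNReal.ofReal_ne_top

lemma integrable_slice (hφ : IsSource r φ) (hr : n < r) (s : ℝ) :
    Integrable fun x ↦ φ (s, x) := by
  obtain ⟨C, hC, h⟩ := hφ.exists_eLpNorm'_slice_le hr le_rfl
  refine ⟨(hφ.measurable_slice s).aestronglyMeasurable, ?_⟩
  have := (h s).trans_lt (ENNReal.mul_lt_top hC.lt_top (decayWeight_ne_top s).lt_top)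
  simpa [eLpNorm', HasFiniteIntegral] using this

lemma exists_eLpNorm_two_slice_le (hφ : IsSource r φ) (hr : n < r) :
    ∃ C : ℝ≥0∞, C ≠ ⊤ ∧ ∀ s, eLpNorm (fun x ↦ φ (s, x)) 2 ≤ C * decayWeight 2 s := by
  obtain ⟨C, hC, h⟩ := hφ.exists_eLpNorm'_slice_le hr one_le_two
  exact ⟨C, hC, fun s ↦ by
    rw [eLpNorm_eq_eLpNorm' two_ne_zero ofNat_ne_top, ENNReal.toReal_ofNat]; exact h s⟩

lemma memLp_two_slice (hφ : IsSource r φ) (hr : n < r) (s : ℝ) :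
    MemLp (fun x ↦ φ (s, x)) 2 := by
  obtain ⟨C, hC, h⟩ := hφ.exists_eLpNorm_two_slice_le hr
  exact ⟨(hφ.measurable_slice s).aestronglyMeasurable,
    (h s).trans_lt (ENNReal.mul_lt_top hC.lt_top (decayWeight_ne_top s).lt_top)⟩

lemma lintegral_decayWeight_time_lt_top : ∫⁻ s : ℝ, decayWeight 2 s < ⊤ :=
  lintegral_decayWeight_lt_top volume (by simp)

lemma integrable (hφ : IsSource r φ) (hr : n < r) : Integrable φ := by
  refine ⟨hφ.1.aestronglyMeasurable, ?_⟩
  obtain ⟨C, hC, hb⟩ := hφ.2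
  have hfin := lintegral_decayWeight_lt_top (volume : Measure (EuclideanSpace ℝ (Fin n)))
    (r := r) (by simpa using hr)
  calc ∫⁻ z, ‖φ z‖ₑ ≤
      ∫⁻ z : ℝ × EuclideanSpace ℝ (Fin n), C * (decayWeight 2 z.1 * decayWeight r z.2) :=
        lintegral_mono fun z ↦ hb z.1 z.2
    _ = C * ((∫⁻ s : ℝ, decayWeight 2 s) * ∫⁻ x : EuclideanSpace ℝ (Fin n), decayWeight r x) := by
        rw [lintegral_const_mul _ (by fun_prop), Measure.volume_eq_prod,
          lintegral_prod_mul (by fun_prop) (by fun_prop)]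
    _ < ⊤ := ENNReal.mul_lt_top hC.lt_top
        (ENNReal.mul_lt_top lintegral_decayWeight_time_lt_top hfin)

lemma integrable_time_slice (hφ : IsSource r φ) (x : EuclideanSpace ℝ (Fin n)) :
    Integrable fun s ↦ φ (s, x) := by
  refine ⟨(hφ.1.comp measurable_prodMk_right).aestronglyMeasurable, ?_⟩
  obtain ⟨C, hC, hb⟩ := hφ.2
  calc ∫⁻ s, ‖φ (s, x)‖ₑ ≤ ∫⁻ s : ℝ, (C * decayWeight r x) * decayWeight 2 s :=
        lintegral_mono fun s ↦ (hb s x).trans_eq (by ring)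
    _ = (C * decayWeight r x) * ∫⁻ s : ℝ, decayWeight 2 s := lintegral_const_mul _ (by fun_prop)
    _ < ⊤ := ENNReal.mul_lt_top (ENNReal.mul_lt_top hC.lt_top ENNReal.ofReal_lt_top)
        lintegral_decayWeight_time_lt_top

end IsSource

section Pairing

variable {n : ℕ}

/-- The unimodular symbol `exp (4 π² i s |ξ|²)`. -/
noncomputable def phase {n : ℕ} (s : ℝ) (ξ : EuclideanSpace ℝ (Fin n)) : ℂ :=
  Complex.exp ((4 * Real.pi ^ 2 * s * ‖ξ‖ ^ 2 : ℝ) * Complex.I)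

/-- The spatial Fourier transform at time `s`, on the phase-modulated side. -/
noncomputable def modulatedFourier (φ : ℝ × EuclideanSpace ℝ (Fin n) → ℂ)
    (z : ℝ × EuclideanSpace ℝ (Fin n)) : ℂ :=
  phase z.1 z.2 * 𝓕 (fun x ↦ φ (z.1, x)) z.2

/-- The Fourier transform of `∫ e^{-isΔ} φ(s) ds`. -/
noncomputable def profile (φ : ℝ × EuclideanSpace ℝ (Fin n) → ℂ)
    (ξ : EuclideanSpace ℝ (Fin n)) : ℂ :=
  ∫ s, modulatedFourier φ (s, ξ)

/-- The pairing `⟨e^{i(t-s)Δ} φ(s), h(t)⟩` as a function of `(s, t)`. -/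
noncomputable def schrodPairing (φ h : ℝ × EuclideanSpace ℝ (Fin n) → ℂ) (z : ℝ × ℝ) : ℂ :=
  ∫ x, schrod n (z.2 - z.1) (fun y ↦ φ (z.1, y)) x * conj (h (z.2, x))

lemma enorm_phase (s : ℝ) (ξ : EuclideanSpace ℝ (Fin n)) : ‖phase s ξ‖ₑ = 1 := by
  rw [← ofReal_norm, phase, Complex.norm_exp_ofReal_mul_I, ENNReal.ofReal_one]

lemma measurable_phase : Measurable fun z : ℝ × EuclideanSpace ℝ (Fin n) ↦ phase z.1 z.2 := by
  unfold phase
  fun_prop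

lemma measurable_fourier_slice {φ : ℝ × EuclideanSpace ℝ (Fin n) → ℂ} (hφ : Measurable φ) :
    Measurable fun z : ℝ × EuclideanSpace ℝ (Fin n) ↦ 𝓕 (fun x ↦ φ (z.1, x)) z.2 := by
  simp only [Real.fourier_eq']
  have : StronglyMeasurable (Function.uncurry fun (z : ℝ × EuclideanSpace ℝ (Fin n))
      (y : EuclideanSpace ℝ (Fin n)) ↦
        Complex.exp (↑(-2 * Real.pi * inner ℝ y z.2) * Complex.I) • φ (z.1, y)) := by
    refine Measurable.stronglyMeasurable ?_
    unfold Function.uncurry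
    fun_prop
  exact this.integral_prod_right.measurable

lemma measurable_modulatedFourier {φ : ℝ × EuclideanSpace ℝ (Fin n) → ℂ} (hφ : Measurable φ) :
    Measurable (modulatedFourier φ) :=
  measurable_phase.mul (measurable_fourier_slice hφ)

lemma measurable_profile {φ : ℝ × EuclideanSpace ℝ (Fin n) → ℂ} (hφ : Measurable φ) :
    Measurable (profile φ) :=
  (measurable_modulatedFourier hφ).stronglyMeasurable.integral_prod_left'.measurable

lemma measurable_schrodPairing {φ h : ℝ × EuclideanSpace ℝ (Fin n) → ℂ} (hφ : Measurable φ)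
    (hh : Measurable h) : Measurable (schrodPairing φ h) := by
  have h1 : Measurable fun q : (ℝ × ℝ) × EuclideanSpace ℝ (Fin n) ↦
      schrod n (q.1.2 - q.1.1) (fun y ↦ φ (q.1.1, y)) q.2 :=
    (measurable_schrod hφ).comp (show Measurable fun q : (ℝ × ℝ) × EuclideanSpace ℝ (Fin n) ↦
      (q.1.2 - q.1.1, q.1.1, q.2) by fun_prop)
  have h2 : Measurable fun q : (ℝ × ℝ) × EuclideanSpace ℝ (Fin n) ↦
      schrod n (q.1.2 - q.1.1) (fun y ↦ φ (q.1.1, y)) q.2 * conj (h (q.1.2, q.2)) :=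
    h1.mul (by fun_prop)
  exact h2.stronglyMeasurable.integral_prod_right'.measurable

variable {r : ℝ} {φ h : ℝ × EuclideanSpace ℝ (Fin n) → ℂ}

lemma eLpNorm_modulatedFourier_le (hφ : IsSource r φ) (hr : n < r) (s : ℝ) :
    eLpNorm (fun ξ ↦ modulatedFourier φ (s, ξ)) 2 ≤ eLpNorm (fun x ↦ φ (s, x)) 2 := by
  refine le_trans (le_of_eq ?_) (eLpNorm_fourier_le (hφ.integrable_slice hr s))
  refine eLpNorm_congr_enorm_ae (Filter.Eventually.of_forall fun ξ ↦ ?_)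
  simp only [modulatedFourier]
  rw [enorm_mul, enorm_phase, one_mul]

lemma enorm_schrodPairing_le (hφ : IsSource r φ) (hr : n < r) (hh : IsSource r h) (z : ℝ × ℝ) :
    ‖schrodPairing φ h z‖ₑ ≤
      eLpNorm (fun x ↦ φ (z.1, x)) 2 * eLpNorm (fun x ↦ h (z.2, x)) 2 :=
  (enorm_integral_mul_conj_le
    (measurable_schrod_apply (hφ.measurable_slice _) _).aestronglyMeasurable
    (hh.measurable_slice _).aestronglyMeasurable).trans
    (mul_le_mul_left (eLpNorm_schrod_le (hφ.measurable_slice _) (hφ.integrable_slice hr _)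
      (hφ.memLp_two_slice hr _) _) _)

lemma lintegral_eLpNorm_mul_eLpNorm_lt_top (hφ : IsSource r φ) (hr : n < r) (hh : IsSource r h) :
    ∫⁻ z : ℝ × ℝ, eLpNorm (fun x ↦ φ (z.1, x)) 2 * eLpNorm (fun x ↦ h (z.2, x)) 2 < ⊤ := by
  obtain ⟨C, hC, hCb⟩ := hφ.exists_eLpNorm_two_slice_le hr
  obtain ⟨D, hD, hDb⟩ := hh.exists_eLpNorm_two_slice_le hr
  calc _ ≤ ∫⁻ z : ℝ × ℝ, (C * decayWeight 2 z.1) * (D * decayWeight 2 z.2) :=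
        lintegral_mono fun z ↦ mul_le_mul' (hCb _) (hDb _)
    _ = (C * ∫⁻ s : ℝ, decayWeight 2 s) * (D * ∫⁻ s : ℝ, decayWeight 2 s) := by
        rw [Measure.volume_eq_prod, lintegral_prod_mul (f := fun s ↦ C * decayWeight 2 s)
          (g := fun s ↦ D * decayWeight 2 s) (by fun_prop) (by fun_prop),
          lintegral_const_mul _ (by fun_prop), lintegral_const_mul _ (by fun_prop)]
    _ < ⊤ := ENNReal.mul_lt_top
        (ENNReal.mul_lt_top hC.lt_top IsSource.lintegral_decayWeight_time_lt_top)
        (ENNReal.mul_lt_top hD.lt_top IsSource.lintegral_decayWeight_time_lt_top)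

lemma integrable_schrodPairing (hφ : IsSource r φ) (hr : n < r) (hh : IsSource r h) :
    Integrable (schrodPairing φ h) :=
  ⟨(measurable_schrodPairing hφ.1 hh.1).aestronglyMeasurable,
    (lintegral_mono fun z ↦ enorm_schrodPairing_le hφ hr hh z).trans_lt
      (lintegral_eLpNorm_mul_eLpNorm_lt_top hφ hr hh)⟩

lemma schrodPairing_eq_integral_fourier (hφ : IsSource r φ) (hr : n < r) (hh : IsSource r h)
    {z : ℝ × ℝ} (hz : z.1 ≠ z.2) :
    schrodPairing φ h z =
      ∫ ξ, modulatedFourier φ (z.1, ξ) * conj (modulatedFourier h (z.2, ξ)) := by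
  rw [schrodPairing, integral_schrod_mul_conj (sub_ne_zero.2 hz.symm)
    (hφ.integrable_slice hr _) (hφ.memLp_two_slice hr _)
    (hh.integrable_slice hr _) (hh.memLp_two_slice hr _)]
  refine integral_congr_ae (Filter.Eventually.of_forall fun ξ ↦ ?_)
  simp only [modulatedFourier, phase, map_mul, ← Complex.exp_conj, Complex.conj_ofReal,
    Complex.conj_I]
  conv_rhs => rw [mul_mul_mul_comm, ← Complex.exp_add]
  congr 2
  push_cast
  ring

lemma integrable_modulatedFourier_mul_conj (hφ : IsSource r φ) (hr : n < r) (hh : IsSource r h) :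
    Integrable (Function.uncurry fun (z : ℝ × ℝ) (ξ : EuclideanSpace ℝ (Fin n)) ↦
      modulatedFourier φ (z.1, ξ) * conj (modulatedFourier h (z.2, ξ))) := by
  have hmφ := measurable_modulatedFourier hφ.1
  have hmh := measurable_modulatedFourier hh.1
  have hK : Measurable (Function.uncurry fun (z : ℝ × ℝ) (ξ : EuclideanSpace ℝ (Fin n)) ↦
      modulatedFourier φ (z.1, ξ) * conj (modulatedFourier h (z.2, ξ))) := by
    unfold Function.uncurry
    fun_prop
  have hHold : ∀ z : ℝ × ℝ,
      ∫⁻ ξ, ‖modulatedFourier φ (z.1, ξ) * conj (modulatedFourier h (z.2, ξ))‖ₑ ≤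
        eLpNorm (fun ξ ↦ modulatedFourier φ (z.1, ξ)) 2 *
          eLpNorm (fun ξ ↦ modulatedFourier h (z.2, ξ)) 2 := fun z ↦
    lintegral_enorm_mul_conj_le_two (hmφ.comp measurable_prodMk_left).aestronglyMeasurable
      (hmh.comp measurable_prodMk_left).aestronglyMeasurable
  refine ⟨hK.aestronglyMeasurable, ?_⟩
  rw [hasFiniteIntegral_iff_enorm, Measure.volume_eq_prod,
    lintegral_prod _ hK.enorm.aemeasurable]
  exact (lintegral_mono fun z ↦ (hHold z).trans
    (mul_le_mul' (eLpNorm_modulatedFourier_le hφ hr z.1)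
      (eLpNorm_modulatedFourier_le hh hr z.2))).trans_lt
    (lintegral_eLpNorm_mul_eLpNorm_lt_top hφ hr hh)

lemma integral_modulatedFourier_mul_conj (φ h : ℝ × EuclideanSpace ℝ (Fin n) → ℂ)
    (ξ : EuclideanSpace ℝ (Fin n)) :
    ∫ z : ℝ × ℝ, modulatedFourier φ (z.1, ξ) * conj (modulatedFourier h (z.2, ξ)) =
      profile φ ξ * conj (profile h ξ) := by
  simp only [profile]
  rw [← integral_conj, ← integral_prod_mul]
  rfl

lemma integrable_profile_mul_conj (hφ : IsSource r φ) (hr : n < r) (hh : IsSource r h) :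
    Integrable fun ξ ↦ profile φ ξ * conj (profile h ξ) := by
  simp only [← integral_modulatedFourier_mul_conj]
  exact (integrable_modulatedFourier_mul_conj hφ hr hh).integral_prod_right

lemma integral_schrodPairing (hφ : IsSource r φ) (hr : n < r) (hh : IsSource r h) :
    ∫ z, schrodPairing φ h z = ∫ ξ, profile φ ξ * conj (profile h ξ) := by
  have hm : MeasurableSet {z : ℝ × ℝ | z.1 ≠ z.2} :=
    (measurableSet_eq_fun measurable_fst measurable_snd).compl
  have hdiag : ∀ᵐ z : ℝ × ℝ, z.1 ≠ z.2 := by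
    rw [Measure.volume_eq_prod, Measure.ae_prod_iff_ae_ae hm]
    exact Filter.Eventually.of_forall fun s ↦ by
      filter_upwards [Measure.ae_ne volume s] with t ht using ht.symm
  calc ∫ z, schrodPairing φ h z
      = ∫ z : ℝ × ℝ, ∫ ξ, modulatedFourier φ (z.1, ξ) * conj (modulatedFourier h (z.2, ξ)) :=
        integral_congr_ae (hdiag.mono fun z hz ↦ schrodPairing_eq_integral_fourier hφ hr hh hz)
    _ = ∫ ξ, ∫ z : ℝ × ℝ, modulatedFourier φ (z.1, ξ) * conj (modulatedFourier h (z.2, ξ)) :=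
        integral_integral_swap (integrable_modulatedFourier_mul_conj hφ hr hh)
    _ = _ := by simp only [integral_modulatedFourier_mul_conj]

end Pairing

section DualStrichartz

variable {n : ℕ} {r : ℝ} {h : ℝ × EuclideanSpace ℝ (Fin n) → ℂ}

lemma measurable_eLpNorm'_slice {h : ℝ × EuclideanSpace ℝ (Fin n) → ℂ} (hh : Measurable h)
    (p : ℝ) : Measurable fun t ↦ eLpNorm' (fun x ↦ h (t, x)) p volume := by
  unfold eLpNorm'
  exact (Measurable.lintegral_prod_right' (f := fun z ↦ ‖h z‖ₑ ^ p) (by fun_prop)).pow_const _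

lemma eLpNorm_two_profile_sq (hh : IsSource r h) (hr : n < r) :
    eLpNorm (profile h) 2 ^ 2 = ‖∫ z, schrodPairing h h z‖ₑ := by
  have heq : ∀ ξ, profile h ξ * conj (profile h ξ) = ((‖profile h ξ‖ ^ 2 : ℝ) : ℂ) := fun ξ ↦ by
    rw [Complex.mul_conj, Complex.normSq_eq_norm_sq]
  have hint : Integrable fun ξ ↦ ‖profile h ξ‖ ^ 2 := by
    have := (integrable_profile_mul_conj hh hr hh).norm
    simpa [sq] using this
  rw [integral_schrodPairing hh hr hh, eLpNorm_two_sq]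
  simp only [heq]
  rw [integral_complex_ofReal, ← ofReal_norm, Complex.norm_real, Real.norm_of_nonneg
    (integral_nonneg fun _ ↦ by positivity), ofReal_integral_eq_lintegral_ofReal hint
    (Filter.Eventually.of_forall fun _ ↦ by positivity)]
  refine lintegral_congr fun ξ ↦ ?_
  rw [ENNReal.ofReal_pow (norm_nonneg _), ofReal_norm]

/-- The dual homogeneous Strichartz estimate. -/
theorem exists_eLpNorm_profile_le (n : ℕ) {q a : ℝ} (hq : 2 < q) (haq : n * (1 / 2 - 1 / q) = a)
    (ha : 0 < a) (ha1 : a < 1) :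
    ∃ C : ℝ≥0∞, C ≠ ⊤ ∧ ∀ (r : ℝ) (h : ℝ × EuclideanSpace ℝ (Fin n) → ℂ), n < r → IsSource r h →
      eLpNorm (profile h) 2 ≤
        C * eLpNorm' (fun t ↦ eLpNorm' (fun x ↦ h (t, x)) (q / (q - 1)) volume)
          (2 / (2 - a)) volume := by
  obtain ⟨C, hC, hbound⟩ := exists_eLpNorm'_schrod_le n hq
  have ha2 : 0 < 2 - a := by linarith
  have hq1 : 0 < q - 1 := by linarith
  set K := ENNReal.ofReal (2 * (2 / (1 - a) + 2 ^ (a / 2))) with hK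
  refine ⟨(C * K) ^ (1 / 2 : ℝ), ENNReal.rpow_ne_top_of_nonneg (by norm_num)
    (ENNReal.mul_ne_top hC ENNReal.ofReal_ne_top), fun r h hr hh ↦ ?_⟩
  set H : ℝ → ℝ≥0∞ := fun t ↦ eLpNorm' (fun x ↦ h (t, x)) (q / (q - 1)) volume with hH
  have hHm : Measurable H := measurable_eLpNorm'_slice hh.1 _
  have hconj : q.HolderConjugate (q / (q - 1)) := Real.HolderConjugate.conjExponent (by linarith)
  have hHfin : ∀ t, H t ≠ ⊤ := by
    obtain ⟨D, hD, hDb⟩ := hh.exists_eLpNorm'_slice_le hr (p := q / (q - 1))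
      (by rw [le_div_iff₀ hq1]; linarith)
    exact fun t ↦ ne_top_of_le_ne_top
      (ENNReal.mul_ne_top hD (IsSource.decayWeight_ne_top t)) (hDb t)
  have hpair : ∀ t s : ℝ, s ≠ t → ‖schrodPairing h h (s, t)‖ₑ ≤
      C * (ENNReal.ofReal (|t - s| ^ (-a)) * H s * H t) := by
    intro t s hst
    calc ‖schrodPairing h h (s, t)‖ₑ
        ≤ eLpNorm' (schrod n (t - s) (fun x ↦ h (s, x))) q volume * H t :=
          (enorm_integral_le_lintegral_enorm _).trans (lintegral_enorm_mul_conj_le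
            (measurable_schrod_apply (hh.measurable_slice _) _).aestronglyMeasurable
            (hh.measurable_slice _).aestronglyMeasurable hconj)
      _ ≤ (C * ENNReal.ofReal (|t - s| ^ (-(n * (1 / 2 - 1 / q)))) * H s) * H t := by
          gcongr
          exact hbound _ _ (sub_ne_zero.2 hst.symm) (hh.measurable_slice s)
            (hh.integrable_slice hr s) (hh.memLp_two_slice hr s)
      _ = _ := by rw [haq]; ring
  have h1 : eLpNorm (profile h) 2 ^ 2 ≤ ∫⁻ t, ∫⁻ s, ‖schrodPairing h h (s, t)‖ₑ := by
    rw [eLpNorm_two_profile_sq hh hr]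
    refine (enorm_integral_le_lintegral_enorm _).trans (le_of_eq ?_)
    rw [Measure.volume_eq_prod, lintegral_prod_symm _
      (measurable_schrodPairing hh.1 hh.1).enorm.aemeasurable]
  have h2 : ∫⁻ t, ∫⁻ s, ‖schrodPairing h h (s, t)‖ₑ ≤
      ∫⁻ t, ∫⁻ s, C * (ENNReal.ofReal (|t - s| ^ (-a)) * H s * H t) := by
    refine lintegral_mono fun t ↦ lintegral_mono_ae ?_
    filter_upwards [Measure.ae_ne volume t] with s hs using hpair t s hs
  have h3 : ∫⁻ t, ∫⁻ s, C * (ENNReal.ofReal (|t - s| ^ (-a)) * H s * H t) =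
      C * ∫⁻ t, ∫⁻ s, ENNReal.ofReal (|t - s| ^ (-a)) * H s * H t := by
    rw [← lintegral_const_mul' _ _ hC]
    exact lintegral_congr fun t ↦ lintegral_const_mul' _ _ hC
  have hsq : eLpNorm (profile h) 2 ^ 2 ≤ C * (K * (∫⁻ t, H t ^ (2 / (2 - a))) ^ (2 - a)) :=
    (h1.trans (h2.trans_eq h3)).trans
      (mul_le_mul_right (lintegral_abs_rpow_mul_mul_le ha ha1 hHm hHfin) C)
  have hroot : eLpNorm (profile h) 2 = (eLpNorm (profile h) 2 ^ 2) ^ (1 / 2 : ℝ) := by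
    rw [← ENNReal.rpow_natCast, ← ENNReal.rpow_mul]
    norm_num
  rw [hroot]
  refine (ENNReal.rpow_le_rpow hsq (by norm_num)).trans (le_of_eq ?_)
  rw [← mul_assoc, ENNReal.mul_rpow_of_nonneg _ _ (by norm_num), ← ENNReal.rpow_mul, eLpNorm']
  congr 2
  field_simp

end DualStrichartz

section RadialTrace

lemma enorm_le_lintegral_Ioi_of_hasDerivAt {u u' : ℝ → ℂ} (a : ℝ)
    (hu : ∀ x, HasDerivAt u (u' x) x) (hu' : Measurable u')
    (hlim : Filter.Tendsto u Filter.atTop (nhds 0)) :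
    ‖u a‖ₑ ≤ ∫⁻ x in Set.Ioi a, ‖u' x‖ₑ := by
  by_cases hfin : ∫⁻ x in Set.Ioi a, ‖u' x‖ₑ = ⊤
  · rw [hfin]; exact le_top
  have hint : IntegrableOn u' (Set.Ioi a) := ⟨hu'.aestronglyMeasurable, lt_top_iff_ne_top.2 hfin⟩
  have h := integral_Ioi_of_hasDerivAt_of_tendsto' (fun x _ ↦ hu x) hint hlim
  rw [zero_sub] at h
  rw [← enorm_neg, ← h]
  exact enorm_integral_le_lintegral_enorm _

lemma lintegral_Ioi_sq_le {n : ℕ} (hn : 3 ≤ n) {A : ℝ → ℝ≥0∞} (hA : Measurable A) :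
    (∫⁻ l in Set.Ioi (1 : ℝ), A l) ^ 2 ≤
      ENNReal.ofReal (1 / (n - 2)) *
        ∫⁻ l in Set.Ioi (1 : ℝ), ENNReal.ofReal (l ^ (n - 1 : ℝ)) * A l ^ 2 := by
  have hn' : (3 : ℝ) ≤ n := by exact_mod_cast hn
  set m : ℝ := n - 1 with hm
  have hsplit : ∫⁻ l in Set.Ioi (1 : ℝ), A l = ∫⁻ l in Set.Ioi (1 : ℝ),
      ((fun l ↦ ENNReal.ofReal (l ^ (-m / 2))) * fun l ↦ ENNReal.ofReal (l ^ (m / 2)) * A l) l := by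
    refine setLIntegral_congr_fun measurableSet_Ioi fun l hl ↦ ?_
    have hl0 : (0 : ℝ) < l := lt_trans zero_lt_one hl
    simp only [Pi.mul_apply]
    rw [← mul_assoc, ← ENNReal.ofReal_mul (by positivity), ← Real.rpow_add hl0,
      show -m / 2 + m / 2 = 0 by ring, Real.rpow_zero, ENNReal.ofReal_one, one_mul]
  have hsq : ∀ (e l : ℝ), 0 < l → ENNReal.ofReal (l ^ (e / 2)) ^ (2 : ℝ) =
      ENNReal.ofReal (l ^ e) := fun e l hl ↦ by
    rw [ENNReal.ofReal_rpow_of_nonneg (by positivity) (by norm_num), ← Real.rpow_mul hl.le]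
    congr 2
    ring
  have h1 : ∫⁻ l in Set.Ioi (1 : ℝ), ENNReal.ofReal (l ^ (-m / 2)) ^ (2 : ℝ) =
      ENNReal.ofReal (1 / (n - 2)) := by
    rw [setLIntegral_congr_fun measurableSet_Ioi
      fun l hl ↦ hsq (-m) l (lt_trans zero_lt_one hl), ← ofReal_integral_eq_lintegral_ofReal
        (integrableOn_Ioi_rpow_of_lt (by linarith) zero_lt_one)
        ((ae_restrict_mem measurableSet_Ioi).mono fun l hl ↦ ?_),
      integral_Ioi_rpow_of_lt (by linarith) zero_lt_one, Real.one_rpow, hm]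
    · rw [neg_div, ← div_neg]
      congr 2
      ring
    · exact Real.rpow_nonneg (zero_lt_one.trans hl).le _
  have h2 : ∫⁻ l in Set.Ioi (1 : ℝ), (ENNReal.ofReal (l ^ (m / 2)) * A l) ^ (2 : ℝ) =
      ∫⁻ l in Set.Ioi (1 : ℝ), ENNReal.ofReal (l ^ m) * A l ^ 2 := by
    refine setLIntegral_congr_fun measurableSet_Ioi fun l hl ↦ ?_
    rw [ENNReal.mul_rpow_of_nonneg _ _ (by norm_num), hsq m l (lt_trans zero_lt_one hl)]
    norm_num
  have hholder := ENNReal.lintegral_mul_le_Lp_mul_Lq (volume.restrict (Set.Ioi (1 : ℝ)))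
    Real.HolderConjugate.two_two
    (f := fun l ↦ ENNReal.ofReal (l ^ (-m / 2))) (g := fun l ↦ ENNReal.ofReal (l ^ (m / 2)) * A l)
    (by fun_prop) (by fun_prop)
  rw [← hsplit, h1, h2] at hholder
  have h3 := pow_le_pow_left' hholder 2
  rw [mul_pow, ← ENNReal.rpow_natCast, ← ENNReal.rpow_natCast, ← ENNReal.rpow_natCast,
    ← ENNReal.rpow_mul, ← ENNReal.rpow_mul] at h3
  norm_num at h3 ⊢
  exact h3

variable {n : ℕ} {ψ : EuclideanSpace ℝ (Fin n) → ℂ}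

lemma norm_coord_mul_le (j : Fin n) (x : EuclideanSpace ℝ (Fin n)) :
    ‖((x j : ℝ) : ℂ)‖ ≤ ‖x‖ := by
  rw [Complex.norm_real]
  exact PiLp.norm_apply_le x j

lemma integrable_coord_mul (hm : Measurable ψ) (hψ' : Integrable fun x ↦ ‖x‖ * ‖ψ x‖) (j : Fin n) :
    Integrable fun x ↦ ((x j : ℝ) : ℂ) * ψ x := by
  refine hψ'.mono' (by fun_prop) (Filter.Eventually.of_forall fun x ↦ ?_)
  rw [norm_mul]
  gcongr
  exact norm_coord_mul_le j x

lemma hasDerivAt_fourier_ray (hm : Measurable ψ) (hψ : Integrable ψ)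
    (hψ' : Integrable fun x ↦ ‖x‖ * ‖ψ x‖) (ξ : EuclideanSpace ℝ (Fin n)) (l : ℝ) :
    HasDerivAt (fun l : ℝ ↦ 𝓕 ψ (l • ξ))
      (-(2 * Real.pi * Complex.I) *
        ∑ j, ((ξ j : ℝ) : ℂ) *
          𝓕 (fun x : EuclideanSpace ℝ (Fin n) ↦ ((x j : ℝ) : ℂ) * ψ x) (l • ξ)) l := by
  have h := (Real.hasFDerivAt_fourier hψ hψ' (l • ξ)).comp_hasDerivAt l
    ((hasDerivAt_id l).smul_const ξ)
  simp only [one_smul, Function.comp_def, id] at h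
  refine h.congr_deriv (Eq.symm ?_)
  have hint : Integrable fun x ↦ 𝐞 (-inner ℝ x (l • ξ)) •
      VectorFourier.fourierSMulRight (innerSL ℝ) ψ x := by
    refine (Real.fourierIntegral_convergent_iff _).2 ?_
    refine (hψ'.const_mul (2 * Real.pi)).mono' hψ.1.fourierSMulRight
      (Filter.Eventually.of_forall fun x ↦ ?_)
    rw [VectorFourier.norm_fourierSMulRight, innerSL_apply_norm, mul_assoc]
  have hj : ∀ j, Integrable fun x : EuclideanSpace ℝ (Fin n) ↦
      𝐞 (-inner ℝ x (l • ξ)) • (((x j : ℝ) : ℂ) * ψ x) := fun j ↦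
    (Real.fourierIntegral_convergent_iff _).2 (integrable_coord_mul hm hψ' j)
  simp only [Real.fourier_eq]
  rw [ContinuousLinearMap.integral_apply hint]
  simp only [← integral_const_mul]
  rw [← integral_finsetSum _ fun j _ ↦ (hj j).const_mul _, ← integral_const_mul]
  refine integral_congr_ae (Filter.Eventually.of_forall fun x ↦ ?_)
  have hin : (innerSL ℝ x) ξ = ∑ j, x j * ξ j := by
    simp [innerSL_apply_apply, PiLp.inner_apply, mul_comm]
  have happ : (𝐞 (-inner ℝ x (l • ξ)) • VectorFourier.fourierSMulRight (innerSL ℝ) ψ x) ξ =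
      𝐞 (-inner ℝ x (l • ξ)) • VectorFourier.fourierSMulRight (innerSL ℝ) ψ x ξ := rfl
  beta_reduce
  rw [happ, VectorFourier.fourierSMulRight_apply, hin]
  simp only [Circle.smul_def, smul_eq_mul, Complex.real_smul]
  push_cast
  simp only [Finset.sum_mul, Finset.mul_sum]
  exact Finset.sum_congr rfl fun j _ ↦ by ring

lemma enorm_sum_coord_mul_sq_le (ξ : EuclideanSpace ℝ (Fin n)) (a : Fin n → ℂ) :
    ‖∑ j, ((ξ j : ℝ) : ℂ) * a j‖ₑ ^ 2 ≤ ‖ξ‖ₑ ^ 2 * ∑ j, ‖a j‖ₑ ^ 2 := by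
  have h : ‖∑ j, ((ξ j : ℝ) : ℂ) * a j‖ ^ 2 ≤ ‖ξ‖ ^ 2 * ∑ j, ‖a j‖ ^ 2 := by
    rw [EuclideanSpace.norm_sq_eq]
    refine le_trans ?_ (Finset.sum_mul_sq_le_sq_mul_sq _ _ _)
    refine pow_le_pow_left₀ (norm_nonneg _) ((norm_sum_le _ _).trans_eq ?_) 2
    simp
  have h2 := ENNReal.ofReal_le_ofReal h
  rw [ENNReal.ofReal_mul (by positivity),
    ENNReal.ofReal_sum_of_nonneg fun _ _ ↦ by positivity] at h2
  simpa only [ENNReal.ofReal_pow (norm_nonneg _), ofReal_norm] using h2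

/-- Integrating along rays controls the values of a Fourier transform by those of its gradient. -/
lemma enorm_fourier_sq_le (hn : 3 ≤ n) (hm : Measurable ψ) (hψ : Integrable ψ)
    (hψ' : Integrable fun x ↦ ‖x‖ * ‖ψ x‖) {ξ : EuclideanSpace ℝ (Fin n)} (hξ : ξ ≠ 0) :
    ‖𝓕 ψ ξ‖ₑ ^ 2 ≤ ENNReal.ofReal (1 / (n - 2)) * (ENNReal.ofReal (4 * Real.pi ^ 2) *
      ∫⁻ l in Set.Ioi (1 : ℝ), ENNReal.ofReal (l ^ (n - 1 : ℝ)) * (‖ξ‖ₑ ^ 2 *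
        ∑ j, ‖𝓕 (fun x : EuclideanSpace ℝ (Fin n) ↦ ((x j : ℝ) : ℂ) * ψ x) (l • ξ)‖ₑ ^ 2)) := by
  set u' : ℝ → ℂ := fun l ↦ -(2 * Real.pi * Complex.I) *
    ∑ j, ((ξ j : ℝ) : ℂ) *
      𝓕 (fun x : EuclideanSpace ℝ (Fin n) ↦ ((x j : ℝ) : ℂ) * ψ x) (l • ξ) with hu'
  have hcont : ∀ j, Continuous
      (𝓕 (fun x : EuclideanSpace ℝ (Fin n) ↦ ((x j : ℝ) : ℂ) * ψ x)) := fun j ↦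
    continuous_fourier_of_integrable (integrable_coord_mul hm hψ' j)
  have hmeas : Measurable u' := Continuous.measurable (by fun_prop)
  have hlim : Filter.Tendsto (fun l : ℝ ↦ 𝓕 ψ (l • ξ)) Filter.atTop (nhds 0) := by
    have h := tendsto_integral_exp_inner_smul_cocompact ψ
    simp only [← Real.fourier_eq] at h
    refine h.comp ?_
    rw [← Metric.cobounded_eq_cocompact, ← tendsto_norm_atTop_iff_cobounded]
    simp only [norm_smul]
    exact Filter.Tendsto.atTop_mul_const (norm_pos_iff.2 hξ) Filter.tendsto_abs_atTop_atTop
  have h1 : ‖𝓕 ψ ξ‖ₑ ≤ ∫⁻ l in Set.Ioi (1 : ℝ), ‖u' l‖ₑ := by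
    have h := enorm_le_lintegral_Ioi_of_hasDerivAt 1
      (hasDerivAt_fourier_ray hm hψ hψ' ξ) hmeas hlim
    rwa [one_smul] at h
  refine (pow_le_pow_left' h1 2).trans ((lintegral_Ioi_sq_le hn hmeas.enorm).trans ?_)
  rw [← lintegral_const_mul' (ENNReal.ofReal (4 * Real.pi ^ 2)) _ ENNReal.ofReal_ne_top]
  refine mul_le_mul_right (lintegral_mono fun l ↦ ?_) _
  have hc : ‖-(2 * Real.pi * Complex.I)‖ₑ ^ 2 = ENNReal.ofReal (4 * Real.pi ^ 2) := by
    rw [← ofReal_norm, ← ENNReal.ofReal_pow (norm_nonneg _)]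
    congr 1
    simp [abs_of_pos Real.pi_pos, mul_pow]
    norm_num
  rw [hu', enorm_mul, mul_pow, hc, mul_left_comm]
  gcongr
  exact enorm_sum_coord_mul_sq_le ξ _

end RadialTrace

section ParabolicChangeOfVariables

variable {n : ℕ}

lemma lintegral_comp_smul_of_pos {l : ℝ} (hl : 0 < l) (f : EuclideanSpace ℝ (Fin n) → ℝ≥0∞)
    (hf : Measurable f) :
    ∫⁻ ξ, f (l • ξ) = ENNReal.ofReal (l ^ (-n : ℝ)) * ∫⁻ η, f η := by
  have h := Measure.map_addHaar_smul (volume : Measure (EuclideanSpace ℝ (Fin n))) hl.ne'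
  rw [← lintegral_map hf (measurable_const_smul l), h, lintegral_smul_measure, smul_eq_mul,
    finrank_euclideanSpace_fin, abs_of_pos (by positivity), Real.rpow_neg hl.le,
    Real.rpow_natCast]

lemma lintegral_Ioi_inv_cube_mul_le {c : ℝ} (hc : 0 < c) (g : ℝ → ℝ≥0∞) :
    ∫⁻ l in Set.Ioi (1 : ℝ), ENNReal.ofReal (2 * c * l ^ (-3 : ℝ)) * g (-c * l ^ (-2 : ℝ)) ≤
      ∫⁻ τ, g τ := by
  have hderiv : ∀ l ∈ Set.Ioi (1 : ℝ), HasDerivWithinAt (fun l ↦ -c * l ^ (-2 : ℝ))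
      (2 * c * l ^ (-3 : ℝ)) (Set.Ioi 1) l := fun l hl ↦ by
    have hl0 : l ≠ 0 := (zero_lt_one.trans hl).ne'
    refine (((Real.hasDerivAt_rpow_const (p := -2) (Or.inl hl0)).const_mul (-c)).congr_deriv
      ?_).hasDerivWithinAt
    rw [show (-2 - 1 : ℝ) = -3 by norm_num]
    ring
  have hinj : Set.InjOn (fun l : ℝ ↦ -c * l ^ (-2 : ℝ)) (Set.Ioi 1) := by
    intro x hx y hy hxy
    have h := mul_left_cancel₀ (neg_ne_zero.2 hc.ne') hxy
    exact (Real.rpow_left_inj (zero_lt_one.trans hx).le (zero_lt_one.trans hy).le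
      (by norm_num)).1 h
  rw [show ∫⁻ l in Set.Ioi (1 : ℝ), ENNReal.ofReal (2 * c * l ^ (-3 : ℝ)) * g (-c * l ^ (-2 : ℝ)) =
    ∫⁻ l in Set.Ioi (1 : ℝ), ENNReal.ofReal |2 * c * l ^ (-3 : ℝ)| * g (-c * l ^ (-2 : ℝ)) from
    setLIntegral_congr_fun measurableSet_Ioi fun l hl ↦ by
      have : (0 : ℝ) < l := zero_lt_one.trans hl
      rw [abs_of_nonneg (by positivity)],
    ← lintegral_image_eq_lintegral_abs_deriv_mul measurableSet_Ioi hderiv hinj]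
  exact setLIntegral_le_lintegral _ _

lemma lintegral_lintegral_ray_le (hn : 3 ≤ n) {U : ℝ × EuclideanSpace ℝ (Fin n) → ℝ≥0∞}
    (hU : Measurable U) :
    ∫⁻ ξ, (∫⁻ l in Set.Ioi (1 : ℝ), ENNReal.ofReal (l ^ (n - 1 : ℝ)) *
        (‖ξ‖ₑ ^ 2 * U (-(2 * Real.pi) * ‖ξ‖ ^ 2, l • ξ))) ≤
      ∫⁻ z, U z := by
  have hpi := Real.pi_pos
  have : Nonempty (Fin n) := ⟨⟨0, by omega⟩⟩
  have hdilate : ∀ l ∈ Set.Ioi (1 : ℝ),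
      ∫⁻ ξ, ENNReal.ofReal (l ^ (n - 1 : ℝ)) *
        (‖ξ‖ₑ ^ 2 * U (-(2 * Real.pi) * ‖ξ‖ ^ 2, l • ξ)) =
      ∫⁻ η, ENNReal.ofReal (‖η‖ ^ 2 * l ^ (-3 : ℝ)) *
        U (-(2 * Real.pi * ‖η‖ ^ 2) * l ^ (-2 : ℝ), η) := by
    intro l hl
    have hl0 : 0 < l := zero_lt_one.trans hl
    have h := lintegral_comp_smul_of_pos hl0 (fun η : EuclideanSpace ℝ (Fin n) ↦
      ENNReal.ofReal (l ^ (n - 1 : ℝ)) *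
        (ENNReal.ofReal (l ^ (-2 : ℝ) * ‖η‖ ^ 2) *
          U (-(2 * Real.pi * ‖η‖ ^ 2) * l ^ (-2 : ℝ), η))) (by fun_prop)
    have hnorm : ∀ ξ : EuclideanSpace ℝ (Fin n), l ^ (-2 : ℝ) * ‖l • ξ‖ ^ 2 = ‖ξ‖ ^ 2 := fun ξ ↦ by
      rw [norm_smul, Real.norm_of_nonneg hl0.le, mul_pow, ← mul_assoc, ← Real.rpow_natCast l 2,
        ← Real.rpow_add hl0]
      norm_num
    rw [← lintegral_const_mul' _ _ ENNReal.ofReal_ne_top] at h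
    convert h using 3 with ξ η
    · rw [hnorm, ENNReal.ofReal_pow (norm_nonneg _), ofReal_norm,
        show -(2 * Real.pi * ‖l • ξ‖ ^ 2) * l ^ (-2 : ℝ) =
          -(2 * Real.pi) * (l ^ (-2 : ℝ) * ‖l • ξ‖ ^ 2) by ring, hnorm]
    · rw [← mul_assoc, ← mul_assoc, ← ENNReal.ofReal_mul (by positivity),
        ← ENNReal.ofReal_mul (by positivity), ← mul_assoc, ← Real.rpow_add hl0,
        ← Real.rpow_add hl0, mul_comm (‖η‖ ^ 2)]
      congr 4
      ring
  have hslice : ∀ η : EuclideanSpace ℝ (Fin n), η ≠ 0 →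
      ∫⁻ l in Set.Ioi (1 : ℝ), ENNReal.ofReal (‖η‖ ^ 2 * l ^ (-3 : ℝ)) *
        U (-(2 * Real.pi * ‖η‖ ^ 2) * l ^ (-2 : ℝ), η) ≤ ∫⁻ τ, U (τ, η) := by
    intro η hη
    have hη' : 0 < ‖η‖ := norm_pos_iff.2 hη
    refine le_trans (setLIntegral_mono' measurableSet_Ioi fun l hl ↦ ?_)
      (lintegral_Ioi_inv_cube_mul_le (c := 2 * Real.pi * ‖η‖ ^ 2) (by positivity)
        fun τ ↦ U (τ, η))
    have hl0 : 0 < l := zero_lt_one.trans hl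
    have hl3 : 0 ≤ ‖η‖ ^ 2 * l ^ (-3 : ℝ) := by positivity
    gcongr
    nlinarith [Real.pi_gt_three]
  rw [lintegral_lintegral_swap (by fun_prop),
    setLIntegral_congr_fun measurableSet_Ioi hdilate, lintegral_lintegral_swap (by fun_prop),
    Measure.volume_eq_prod, lintegral_prod_symm _ hU.aemeasurable]
  refine lintegral_mono_ae ?_
  filter_upwards [Measure.ae_ne volume 0] with η hη using hslice η hη

end ParabolicChangeOfVariables

section DualSmoothing

variable {n : ℕ} {r : ℝ} {φ : ℝ × EuclideanSpace ℝ (Fin n) → ℂ}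

/-- The Fourier transform in time only. -/
noncomputable def timeFourier (φ : ℝ × EuclideanSpace ℝ (Fin n) → ℂ)
    (z : ℝ × EuclideanSpace ℝ (Fin n)) : ℂ :=
  𝓕 (fun s ↦ φ (s, z.2)) z.1

/-- Multiplication by the `j`-th space coordinate. -/
noncomputable def coordMul (j : Fin n) (φ : ℝ × EuclideanSpace ℝ (Fin n) → ℂ)
    (z : ℝ × EuclideanSpace ℝ (Fin n)) : ℂ :=
  ((z.2 j : ℝ) : ℂ) * φ z

lemma measurable_timeFourier (hφ : Measurable φ) : Measurable (timeFourier φ) := by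
  unfold timeFourier
  simp only [Real.fourier_eq']
  have : StronglyMeasurable (Function.uncurry fun (z : ℝ × EuclideanSpace ℝ (Fin n)) (s : ℝ) ↦
      Complex.exp (↑(-2 * Real.pi * inner ℝ s z.1) * Complex.I) • φ (s, z.2)) := by
    refine Measurable.stronglyMeasurable ?_
    unfold Function.uncurry
    fun_prop
  exact this.integral_prod_right.measurable

lemma measurable_coordMul (hφ : Measurable φ) (j : Fin n) : Measurable (coordMul j φ) := by
  unfold coordMul
  fun_prop

lemma timeFourier_coordMul (j : Fin n) (φ : ℝ × EuclideanSpace ℝ (Fin n) → ℂ)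
    (z : ℝ × EuclideanSpace ℝ (Fin n)) :
    timeFourier (coordMul j φ) z = ((z.2 j : ℝ) : ℂ) * timeFourier φ z := by
  simp only [timeFourier, coordMul, Real.fourier_eq', smul_eq_mul, ← integral_const_mul]
  exact integral_congr_ae (Filter.Eventually.of_forall fun s ↦ by ring)

namespace IsSource

lemma coordMul (hφ : IsSource (r + 1) φ) (j : Fin n) : IsSource r (coordMul j φ) :=
  hφ.norm_smul_left (f := fun x ↦ ((x j : ℝ) : ℂ)) (by fun_prop) fun x ↦ by
    rw [← ofReal_norm, ← ofReal_norm]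
    exact ENNReal.ofReal_le_ofReal (norm_coord_mul_le j x)

lemma exists_enorm_timeFourier_le (hφ : IsSource r φ) :
    ∃ C : ℝ≥0∞, C ≠ ⊤ ∧ ∀ τ x, ‖timeFourier φ (τ, x)‖ₑ ≤ C * decayWeight r x := by
  obtain ⟨hm, C, hC, hb⟩ := hφ
  refine ⟨C * ∫⁻ s : ℝ, decayWeight 2 s,
    ENNReal.mul_ne_top hC lintegral_decayWeight_time_lt_top.ne, fun τ x ↦ ?_⟩
  have h1 : ‖timeFourier φ (τ, x)‖ₑ ≤ ∫⁻ s, ‖φ (s, x)‖ₑ := by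
    rw [timeFourier, Real.fourier_eq]
    refine (enorm_integral_le_lintegral_enorm _).trans_eq (lintegral_congr fun s ↦ ?_)
    rw [← ofReal_norm, Circle.norm_smul, ofReal_norm]
  refine (h1.trans (lintegral_mono fun s ↦ hb s x)).trans_eq ?_
  rw [lintegral_const_mul' _ _ hC, lintegral_mul_const _ (by fun_prop), mul_assoc]

lemma integrable_timeFourier (hφ : IsSource r φ) (hr : n < r) (τ : ℝ) :
    Integrable fun x ↦ timeFourier φ (τ, x) := by
  obtain ⟨C, hC, hb⟩ := hφ.exists_enorm_timeFourier_le
  refine ⟨((measurable_timeFourier hφ.1).comp measurable_prodMk_left).aestronglyMeasurable,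
    (lintegral_mono fun x ↦ hb τ x).trans_lt ?_⟩
  rw [lintegral_const_mul' _ _ hC]
  exact ENNReal.mul_lt_top hC.lt_top (lintegral_decayWeight_lt_top _ (by simpa using hr))

lemma integrable_norm_mul_timeFourier (hφ : IsSource (r + 1) φ) (hr : n < r) (τ : ℝ) :
    Integrable fun x ↦ ‖x‖ * ‖timeFourier φ (τ, x)‖ := by
  obtain ⟨C, hC, hb⟩ := hφ.exists_enorm_timeFourier_le
  have hm : Measurable fun x ↦ timeFourier φ (τ, x) :=
    (measurable_timeFourier hφ.1).comp measurable_prodMk_left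
  refine ⟨Measurable.aestronglyMeasurable (by fun_prop),
    (lintegral_mono fun x ↦ (?_ : _ ≤ C * decayWeight r x)).trans_lt ?_⟩
  · rw [enorm_mul, enorm_norm, enorm_norm]
    refine (mul_le_mul_right (hb τ x) _).trans ?_
    rw [mul_left_comm]
    exact mul_le_mul_right (enorm_mul_decayWeight_le r x) _
  · rw [lintegral_const_mul' _ _ hC]
    exact ENNReal.mul_lt_top hC.lt_top (lintegral_decayWeight_lt_top _ (by simpa using hr))

end IsSource

lemma profile_eq_fourier_timeFourier (hφ : IsSource r φ) (hr : n < r)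
    (ξ : EuclideanSpace ℝ (Fin n)) :
    profile φ ξ = 𝓕 (fun x ↦ timeFourier φ (-(2 * Real.pi) * ‖ξ‖ ^ 2, x)) ξ := by
  simp only [profile, modulatedFourier, timeFourier, Real.fourier_eq', smul_eq_mul,
    ← integral_const_mul]
  rw [integral_integral_swap]
  · refine integral_congr_ae (Filter.Eventually.of_forall fun x ↦
      integral_congr_ae (Filter.Eventually.of_forall fun s ↦ ?_))
    simp only [phase]
    rw [mul_left_comm]
    congr 3
    simp
    ring
  · refine (hφ.integrable hr).congr' (Measurable.aestronglyMeasurable ?_)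
      (Filter.Eventually.of_forall fun z ↦ ?_)
    · have h1 := measurable_phase (n := n)
      have h2 := hφ.1
      unfold Function.uncurry
      simp only [phase]
      fun_prop
    · simp only [Function.uncurry, norm_mul, phase, Complex.norm_exp_ofReal_mul_I, one_mul]

lemma lintegral_timeFourier_sq_le (hφ : IsSource r φ) (hr : n < r) :
    ∫⁻ z : ℝ × EuclideanSpace ℝ (Fin n), ‖𝓕 (fun x ↦ timeFourier φ (z.1, x)) z.2‖ₑ ^ 2 ≤
      ∫⁻ z, ‖φ z‖ₑ ^ 2 := by
  have hm := measurable_timeFourier hφ.1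
  have h1 := lintegral_prod (μ := (volume : Measure ℝ))
    (ν := (volume : Measure (EuclideanSpace ℝ (Fin n)))) _
    ((measurable_fourier_slice hm).enorm.pow_const 2).aemeasurable
  have h2 := lintegral_mono (μ := (volume : Measure ℝ)) fun τ ↦
    lintegral_fourier_sq_le (hφ.integrable_timeFourier hr τ)
  have h3 := lintegral_lintegral_swap (μ := (volume : Measure ℝ))
    (ν := (volume : Measure (EuclideanSpace ℝ (Fin n))))
    (f := fun τ x ↦ ‖timeFourier φ (τ, x)‖ₑ ^ 2) (hm.enorm.pow_const 2).aemeasurable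
  have h4 := lintegral_mono (μ := (volume : Measure (EuclideanSpace ℝ (Fin n)))) fun x ↦
    lintegral_fourier_sq_le (hφ.integrable_time_slice x)
  have h5 := lintegral_prod_symm (μ := (volume : Measure ℝ))
    (ν := (volume : Measure (EuclideanSpace ℝ (Fin n)))) _
    (hφ.1.enorm.pow_const 2).aemeasurable
  rw [Measure.volume_eq_prod, h1, h5]
  exact h2.trans (h3.trans_le h4)

/-- The dual Kato smoothing estimate. -/
theorem lintegral_profile_sq_le (hn : 3 ≤ n) (hr : n < r) (hφ : IsSource (r + 1) φ) :
    ∫⁻ ξ, ‖profile φ ξ‖ₑ ^ 2 ≤ ENNReal.ofReal (1 / (n - 2)) * (ENNReal.ofReal (4 * Real.pi ^ 2) *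
      ∫⁻ z : ℝ × EuclideanSpace ℝ (Fin n), ‖z.2‖ₑ ^ 2 * ‖φ z‖ₑ ^ 2) := by
  have hr1 : n < r + 1 := by linarith
  have : Nonempty (Fin n) := ⟨⟨0, by omega⟩⟩
  have hmφ := hφ.1
  set U : ℝ × EuclideanSpace ℝ (Fin n) → ℝ≥0∞ := fun z ↦
    ∑ j, ‖𝓕 (fun x ↦ timeFourier (coordMul j φ) (z.1, x)) z.2‖ₑ ^ 2 with hU
  have hterm : ∀ j, Measurable fun z : ℝ × EuclideanSpace ℝ (Fin n) ↦
      ‖𝓕 (fun x ↦ timeFourier (coordMul j φ) (z.1, x)) z.2‖ₑ ^ 2 := fun j ↦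
    (measurable_fourier_slice
      (measurable_timeFourier (measurable_coordMul hmφ j))).enorm.pow_const 2
  have hUm : Measurable U := by
    rw [hU]
    exact Finset.measurable_sum _ fun j _ ↦ hterm j
  have hpoint : ∀ ξ : EuclideanSpace ℝ (Fin n), ξ ≠ 0 → ‖profile φ ξ‖ₑ ^ 2 ≤
      ENNReal.ofReal (1 / (n - 2)) * (ENNReal.ofReal (4 * Real.pi ^ 2) *
        ∫⁻ l in Set.Ioi (1 : ℝ), ENNReal.ofReal (l ^ (n - 1 : ℝ)) *
          (‖ξ‖ₑ ^ 2 * U (-(2 * Real.pi) * ‖ξ‖ ^ 2, l • ξ))) := fun ξ hξ ↦ by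
    rw [profile_eq_fourier_timeFourier hφ hr1]
    simp only [hU, timeFourier_coordMul]
    exact enorm_fourier_sq_le hn ((measurable_timeFourier hmφ).comp measurable_prodMk_left)
      (hφ.integrable_timeFourier hr1 _) (hφ.integrable_norm_mul_timeFourier hr _) hξ
  have hae : ∫⁻ ξ, ‖profile φ ξ‖ₑ ^ 2 ≤ ∫⁻ ξ : EuclideanSpace ℝ (Fin n),
      ENNReal.ofReal (1 / (n - 2)) * (ENNReal.ofReal (4 * Real.pi ^ 2) *
        ∫⁻ l in Set.Ioi (1 : ℝ), ENNReal.ofReal (l ^ (n - 1 : ℝ)) *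
          (‖ξ‖ₑ ^ 2 * U (-(2 * Real.pi) * ‖ξ‖ ^ 2, l • ξ))) := by
    refine lintegral_mono_ae ?_
    filter_upwards [Measure.ae_ne volume 0] with ξ hξ using hpoint ξ hξ
  rw [lintegral_const_mul' _ _ ENNReal.ofReal_ne_top,
    lintegral_const_mul' _ _ ENNReal.ofReal_ne_top] at hae
  refine hae.trans (mul_le_mul_right (mul_le_mul_right
    ((lintegral_lintegral_ray_le hn hUm).trans ?_) _) _)
  rw [hU, lintegral_finsetSum _ fun j _ ↦ hterm j]
  refine (Finset.sum_le_sum fun j _ ↦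
    lintegral_timeFourier_sq_le (hφ.coordMul j) hr).trans_eq ?_
  rw [← lintegral_finsetSum _ fun j _ ↦
    (measurable_coordMul hmφ j).enorm.pow_const 2]
  refine lintegral_congr fun z ↦ ?_
  have hz : ‖z.2‖ₑ ^ 2 = ∑ j, ‖((z.2 j : ℝ) : ℂ)‖ₑ ^ 2 := by
    simp only [← ofReal_norm, ← ENNReal.ofReal_pow (norm_nonneg _)]
    rw [EuclideanSpace.norm_sq_eq, ENNReal.ofReal_sum_of_nonneg fun _ _ ↦ by positivity]
    simp
  simp only [coordMul, enorm_mul, mul_pow]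
  rw [← Finset.sum_mul, hz]

end DualSmoothing

section ChristKiselev

lemma rpow_add_rpow_le_two_rpow_mul {x y θ : ℝ} (hx : 0 ≤ x) (hy : 0 ≤ y) (hθ : 0 ≤ θ)
    (hθ1 : θ ≤ 1) : x ^ θ + y ^ θ ≤ 2 ^ (1 - θ) * (x + y) ^ θ := by
  have h := (Real.concaveOn_rpow hθ hθ1).2 (Set.mem_Ici.2 hx) (Set.mem_Ici.2 hy)
    (by norm_num : (0 : ℝ) ≤ 1 / 2) (by norm_num : (0 : ℝ) ≤ 1 / 2) (by norm_num)
  simp only [smul_eq_mul] at h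
  rw [← mul_add, ← mul_add, Real.mul_rpow (by norm_num) (by positivity)] at h
  have h2 : (2 : ℝ) ^ (1 - θ) = 2 * (1 / 2) ^ θ := by
    rw [Real.rpow_sub two_pos, Real.rpow_one, one_div, Real.inv_rpow two_pos.le, div_eq_mul_inv]
  rw [h2]
  linarith

/-- The halving scheme behind the Christ–Kiselev lemma, for an interval function `L` whose defect
of additivity is `R`. -/
lemma norm_le_of_additive_defect {L : ℝ → ℝ → ℂ} {R : ℝ → ℝ → ℝ → ℂ} {M H V : ℝ → ℝ}
    {C D θ : ℝ} (hθ : 1 / 2 < θ) (hθ1 : θ ≤ 1) (hC : 0 ≤ C) (hM : Monotone M) (hMc : Continuous M)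
    (hH : Monotone H)
    (hadd : ∀ a b c, a ≤ b → b ≤ c → L a c = L a b + L b c + R a b c)
    (hR : ∀ a b c, a ≤ b → b ≤ c → ‖R a b c‖ ≤ C * ((M b - M a) ^ (1 / 2 : ℝ) * (H c - H b) ^ θ))
    (hL : ∀ a b, a ≤ b → ‖L a b‖ ≤ D * ((M b - M a) * (V b - V a))) {a b : ℝ} (hab : a ≤ b) :
    ‖L a b‖ ≤ C / (1 - 2 ^ (1 / 2 - θ)) * ((M b - M a) ^ (1 / 2 : ℝ) * (H b - H a) ^ θ) := by
  set ρ : ℝ := 2 ^ (1 / 2 - θ) with hρ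
  have hρ0 : 0 < ρ := by positivity
  have hρ1 : ρ < 1 := Real.rpow_lt_one_of_one_lt_of_neg one_lt_two (by linarith)
  set S : ℝ := C / (1 - ρ) with hS
  have hS0 : 0 ≤ S := div_nonneg hC (by linarith)
  have hSρ : ρ * S + C = S := by
    rw [hS]
    field_simp [(sub_pos.2 hρ1).ne']
    ring
  have key : ∀ N : ℕ, ∀ a b, a ≤ b → ‖L a b‖ ≤
      S * ((M b - M a) ^ (1 / 2 : ℝ) * (H b - H a) ^ θ) +
        (1 / 2) ^ N * (D * ((M b - M a) * (V b - V a))) := by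
    intro N
    induction N with
    | zero =>
      intro a b hab
      have h1 : 0 ≤ M b - M a := sub_nonneg.2 (hM hab)
      have h2 : 0 ≤ H b - H a := sub_nonneg.2 (hH hab)
      have h3 : 0 ≤ S * ((M b - M a) ^ (1 / 2 : ℝ) * (H b - H a) ^ θ) := by positivity
      rw [pow_zero, one_mul]
      linarith [hL a b hab]
    | succ N ih =>
      intro a b hab
      obtain ⟨c, ⟨hac, hcb⟩, hc⟩ := intermediate_value_Icc hab hMc.continuousOn
        (show (M a + M b) / 2 ∈ Set.Icc (M a) (M b) by
          constructor <;> linarith [hM hab])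
      have hm0 : 0 ≤ M b - M a := sub_nonneg.2 (hM hab)
      have hm1 : M c - M a = (1 / 2) * (M b - M a) := by linarith
      have hm2 : M b - M c = (1 / 2) * (M b - M a) := by linarith
      have hx : 0 ≤ H c - H a := sub_nonneg.2 (hH hac)
      have hy : 0 ≤ H b - H c := sub_nonneg.2 (hH hcb)
      have hhalf : (1 / 2 : ℝ) ^ (1 / 2 : ℝ) * 2 ^ (1 - θ) = ρ := by
        rw [one_div (2 : ℝ), Real.inv_rpow two_pos.le, ← Real.rpow_neg two_pos.le,
          ← Real.rpow_add two_pos, hρ]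
        congr 1
        norm_num
        ring
      have hhalf1 : (1 / 2 : ℝ) ^ (1 / 2 : ℝ) ≤ 1 :=
        Real.rpow_le_one (by norm_num) (by norm_num) (by norm_num)
      have h1 := ih a c hac
      have h2 := ih c b hcb
      have h3 := hR a c b hac hcb
      rw [hm1, Real.mul_rpow (by norm_num) hm0] at h1 h3
      rw [hm2, Real.mul_rpow (by norm_num) hm0] at h2
      have hconc := rpow_add_rpow_le_two_rpow_mul hx hy (by linarith) hθ1
      rw [show H c - H a + (H b - H c) = H b - H a by ring] at hconc
      have hmono : (H b - H c) ^ θ ≤ (H b - H a) ^ θ :=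
        Real.rpow_le_rpow hy (by linarith) (by linarith)
      set m := (M b - M a) ^ (1 / 2 : ℝ) with hm
      set k := (1 / 2 : ℝ) ^ (1 / 2 : ℝ) with hk
      have hm' : 0 ≤ m := by positivity
      have hk' : 0 ≤ k := by positivity
      have e1 : S * (k * m) * ((H c - H a) ^ θ + (H b - H c) ^ θ) ≤
          S * (k * m) * (2 ^ (1 - θ) * (H b - H a) ^ θ) := by gcongr
      have e2 : C * (k * m * (H b - H c) ^ θ) ≤ C * (1 * m * (H b - H a) ^ θ) := by gcongr
      have e3 : S * (k * m) * (2 ^ (1 - θ) * (H b - H a) ^ θ) =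
          ρ * S * (m * (H b - H a) ^ θ) := by
        rw [← hhalf]; ring
      have e4 : S * (m * (H b - H a) ^ θ) =
          ρ * S * (m * (H b - H a) ^ θ) + C * (1 * m * (H b - H a) ^ θ) := by
        nth_rewrite 1 [← hSρ]; ring
      have e5 := (norm_add_le (L a c + L c b) (R a c b)).trans
        (add_le_add_left (norm_add_le (L a c) (L c b)) _)
      rw [hadd a c b hac hcb, pow_succ]
      linarith
  have hlim : Filter.Tendsto (fun N : ℕ ↦ S * ((M b - M a) ^ (1 / 2 : ℝ) * (H b - H a) ^ θ) +
      (1 / 2) ^ N * (D * ((M b - M a) * (V b - V a)))) Filter.atTop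
      (nhds (S * ((M b - M a) ^ (1 / 2 : ℝ) * (H b - H a) ^ θ) +
        0 * (D * ((M b - M a) * (V b - V a))))) :=
    ((_root_.tendsto_pow_atTop_nhds_zero_of_lt_one (by norm_num) (by norm_num)).mul_const _
      ).const_add _
  rw [zero_mul, add_zero] at hlim
  exact ge_of_tendsto' hlim fun N ↦ key N a b hab

end ChristKiselev

section BilinearChristKiselev

/-- A primitive of an `ℝ≥0∞`-valued density of finite mass. -/
noncomputable def primitive (G : ℝ → ℝ≥0∞) (t : ℝ) : ℝ := ∫ s in (0 : ℝ)..t, (G s).toReal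

variable {G : ℝ → ℝ≥0∞}

lemma integrable_toReal_of_ne_top (hG : Measurable G) (hfin : ∫⁻ s, G s ≠ ⊤) :
    Integrable fun s ↦ (G s).toReal :=
  integrable_toReal_of_lintegral_ne_top hG.aemeasurable hfin

lemma primitive_sub_primitive (hG : Measurable G) (hfin : ∫⁻ s, G s ≠ ⊤) {a b : ℝ} (hab : a ≤ b) :
    primitive G b - primitive G a = (∫⁻ s in Set.Ioc a b, G s).toReal := by
  have hint := integrable_toReal_of_ne_top hG hfin
  rw [primitive, primitive, intervalIntegral.integral_interval_sub_left hint.intervalIntegrable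
    hint.intervalIntegrable, intervalIntegral.integral_of_le hab]
  exact integral_toReal hG.aemeasurable.restrict (ae_restrict_of_ae (ae_lt_top hG hfin))

lemma monotone_primitive (hG : Measurable G) (hfin : ∫⁻ s, G s ≠ ⊤) : Monotone (primitive G) :=
  fun a b hab ↦ by
    rw [← sub_nonneg, primitive_sub_primitive hG hfin hab]
    exact ENNReal.toReal_nonneg

lemma continuous_primitive_density (hG : Measurable G) (hfin : ∫⁻ s, G s ≠ ⊤) :
    Continuous (primitive G) :=
  intervalIntegral.continuous_primitive
    (fun _ _ ↦ (integrable_toReal_of_ne_top hG hfin).intervalIntegrable) 0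

/-- The part above the diagonal of the square with side `(a, b]`. -/
def upperTriangle (a b : ℝ) : Set (ℝ × ℝ) := {z | a < z.1 ∧ z.1 < z.2 ∧ z.2 ≤ b}

lemma measurableSet_upperTriangle (a b : ℝ) : MeasurableSet (upperTriangle a b) :=
  (measurableSet_lt measurable_const measurable_fst).inter
    ((measurableSet_lt measurable_fst measurable_snd).inter
      (measurableSet_le measurable_snd measurable_const))

lemma setIntegral_upperTriangle {K : ℝ × ℝ → ℂ} (hK : Integrable K) {a b c : ℝ} (hab : a ≤ b)
    (hbc : b ≤ c) :
    ∫ z in upperTriangle a c, K z = (∫ z in upperTriangle a b, K z) +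
      (∫ z in upperTriangle b c, K z) + ∫ z in Set.Ioc a b ×ˢ Set.Ioc b c, K z := by
  have hset : upperTriangle a c =
      (upperTriangle a b ∪ upperTriangle b c) ∪ Set.Ioc a b ×ˢ Set.Ioc b c := by
    ext ⟨s, t⟩
    simp only [upperTriangle, Set.mem_union, Set.mem_ofPred_eq, Set.mem_prod, Set.mem_Ioc]
    grind
  have hd1 : Disjoint (upperTriangle a b) (upperTriangle b c) := by
    rw [Set.disjoint_left]
    rintro ⟨s, t⟩ h1 h2
    simp only [upperTriangle, Set.mem_ofPred_eq] at h1 h2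
    linarith
  have hd2 : Disjoint (upperTriangle a b ∪ upperTriangle b c) (Set.Ioc a b ×ˢ Set.Ioc b c) := by
    rw [Set.disjoint_left]
    rintro ⟨s, t⟩ h1 h2
    simp only [upperTriangle, Set.mem_union, Set.mem_ofPred_eq, Set.mem_prod, Set.mem_Ioc] at h1 h2
    rcases h1 with h1 | h1 <;> linarith
  rw [hset, setIntegral_union hd2 (measurableSet_Ioc.prod measurableSet_Ioc) hK.integrableOn
    hK.integrableOn, setIntegral_union hd1 (measurableSet_upperTriangle b c) hK.integrableOn
    hK.integrableOn]

lemma tendsto_setIntegral_upperTriangle {K : ℝ × ℝ → ℂ} (hK : Integrable K) :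
    Filter.Tendsto (fun N : ℕ ↦ ∫ z in upperTriangle (-N) N, K z) Filter.atTop
      (nhds (∫ z in {z : ℝ × ℝ | z.1 < z.2}, K z)) := by
  have hU : {z : ℝ × ℝ | z.1 < z.2} = ⋃ N : ℕ, upperTriangle (-N) N := by
    ext ⟨s, t⟩
    simp only [upperTriangle, Set.mem_iUnion, Set.mem_ofPred_eq]
    constructor
    · intro h
      obtain ⟨N, hN⟩ := exists_nat_gt (max (-s) t)
      exact ⟨N, by linarith [le_max_left (-s) t], h, by linarith [le_max_right (-s) t]⟩
    · rintro ⟨N, -, h, -⟩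
      exact h
  rw [hU]
  refine tendsto_setIntegral_of_monotone (fun N ↦ measurableSet_upperTriangle _ _) ?_
    hK.integrableOn
  rintro M N hMN ⟨s, t⟩ ⟨h1, h2, h3⟩
  have : (M : ℝ) ≤ N := by exact_mod_cast hMN
  exact ⟨by linarith, h2, h3.trans this⟩

/-- A bilinear Christ–Kiselev lemma: bounds on rectangles off the diagonal give a bound on the
half-plane above the diagonal. -/
theorem enorm_setIntegral_lt_le {K : ℝ × ℝ → ℂ} (hK : Integrable K) {g η ν : ℝ → ℝ≥0∞}
    (hG : Measurable G) (hg : Measurable g) (hη : Measurable η) (hν : Measurable ν)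
    (hGfin : ∫⁻ s, G s ≠ ⊤) (hgfin : ∫⁻ s, g s ≠ ⊤) (hηfin : ∫⁻ s, η s ≠ ⊤)
    (hνfin : ∫⁻ s, ν s ≠ ⊤) {C : ℝ≥0∞} (hC : C ≠ ⊤) {θ : ℝ} (hθ : 1 / 2 < θ) (hθ1 : θ ≤ 1)
    (hrect : ∀ a b c : ℝ, ‖∫ z in Set.Ioc a b ×ˢ Set.Ioc b c, K z‖ₑ ≤
      C * ((∫⁻ s in Set.Ioc a b, G s) ^ (1 / 2 : ℝ) * (∫⁻ t in Set.Ioc b c, η t) ^ θ))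
    (hdiag : ∀ z, ‖K z‖ₑ ≤ g z.1 * ν z.2) :
    ‖∫ z in {z : ℝ × ℝ | z.1 < z.2}, K z‖ₑ ≤ C * ENNReal.ofReal (1 / (1 - 2 ^ (1 / 2 - θ))) *
      ((∫⁻ s, G s) ^ (1 / 2 : ℝ) * (∫⁻ t, η t) ^ θ) := by
  have hθ0 : 0 < θ := by linarith
  have hρ : 0 < 1 - (2 : ℝ) ^ (1 / 2 - θ) :=
    sub_pos.2 (Real.rpow_lt_one_of_one_lt_of_neg one_lt_two (by linarith))
  have hlocfin : ∀ {F : ℝ → ℝ≥0∞} (_ : ∫⁻ s, F s ≠ ⊤) (a b : ℝ), ∫⁻ s in Set.Ioc a b, F s ≠ ⊤ :=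
    fun hF a b ↦ ne_top_of_le_ne_top hF (setLIntegral_le_lintegral _ _)
  have hreg : ∀ ε : ℝ, 0 < ε → ∀ N : ℕ, ‖∫ z in upperTriangle (-N) N, K z‖ ≤
      C.toReal / (1 - 2 ^ (1 / 2 - θ)) *
        (((∫⁻ s, G s).toReal + ε * (∫⁻ s, g s).toReal) ^ (1 / 2 : ℝ) *
          (∫⁻ t, η t).toReal ^ θ) := by
    intro ε hε N
    set Gε : ℝ → ℝ≥0∞ := fun s ↦ G s + ENNReal.ofReal ε * g s with hGε
    have hGεm : Measurable Gε := by fun_prop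
    have hGεint : ∀ S : Set ℝ, ∫⁻ s in S, Gε s =
        (∫⁻ s in S, G s) + ENNReal.ofReal ε * ∫⁻ s in S, g s := fun S ↦ by
      rw [hGε, lintegral_add_left hG, lintegral_const_mul _ hg]
    have hGεtot : ∫⁻ s, Gε s = (∫⁻ s, G s) + ENNReal.ofReal ε * ∫⁻ s, g s := by
      simpa using hGεint Set.univ
    have hGεfin : ∫⁻ s, Gε s ≠ ⊤ := by
      rw [hGεtot]
      exact ENNReal.add_ne_top.2 ⟨hGfin, ENNReal.mul_ne_top ENNReal.ofReal_ne_top hgfin⟩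
    have hNN : (-N : ℝ) ≤ N := by linarith [Nat.cast_nonneg (α := ℝ) N]
    have hmain := norm_le_of_additive_defect (L := fun a b ↦ ∫ z in upperTriangle a b, K z)
      (R := fun a b c ↦ ∫ z in Set.Ioc a b ×ˢ Set.Ioc b c, K z) (M := primitive Gε)
      (H := primitive η) (V := primitive ν) (C := C.toReal) (D := ε⁻¹) hθ hθ1
      ENNReal.toReal_nonneg (monotone_primitive hGεm hGεfin)
      (continuous_primitive_density hGεm hGεfin) (monotone_primitive hη hηfin)
      (fun a b c hab hbc ↦ setIntegral_upperTriangle hK hab hbc) ?_ ?_ hNN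
    · refine hmain.trans ?_
      rw [primitive_sub_primitive hGεm hGεfin hNN, primitive_sub_primitive hη hηfin hNN]
      have h1 : (∫⁻ s in Set.Ioc (-N : ℝ) N, Gε s).toReal ≤
          (∫⁻ s, G s).toReal + ε * (∫⁻ s, g s).toReal := by
        rw [← ENNReal.toReal_ofReal hε.le, ← ENNReal.toReal_mul, ← ENNReal.toReal_add hGfin
          (ENNReal.mul_ne_top ENNReal.ofReal_ne_top hgfin), ← hGεtot]
        exact ENNReal.toReal_mono hGεfin (setLIntegral_le_lintegral _ _)
      have h2 : (∫⁻ s in Set.Ioc (-N : ℝ) N, η s).toReal ≤ (∫⁻ s, η s).toReal :=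
        ENNReal.toReal_mono hηfin (setLIntegral_le_lintegral _ _)
      gcongr
    · intro a b c hab hbc
      rw [primitive_sub_primitive hGεm hGεfin hab, primitive_sub_primitive hη hηfin hbc,
        ENNReal.toReal_rpow, ENNReal.toReal_rpow, ← ENNReal.toReal_mul, ← ENNReal.toReal_mul,
        ← toReal_enorm]
      refine ENNReal.toReal_mono (ENNReal.mul_ne_top hC (ENNReal.mul_ne_top
        (ENNReal.rpow_ne_top_of_nonneg (by norm_num) (hlocfin hGεfin a b))
        (ENNReal.rpow_ne_top_of_nonneg hθ0.le (hlocfin hηfin b c)))) ((hrect a b c).trans ?_)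
      gcongr
      exact le_self_add
    · intro a b hab
      rw [primitive_sub_primitive hGεm hGεfin hab, primitive_sub_primitive hν hνfin hab,
        ← toReal_enorm]
      have h1 : ‖∫ z in upperTriangle a b, K z‖ₑ ≤
          (∫⁻ s in Set.Ioc a b, g s) * ∫⁻ t in Set.Ioc a b, ν t := by
        have hsub : upperTriangle a b ⊆ Set.Ioc a b ×ˢ Set.Ioc a b := fun z hz ↦
          ⟨⟨hz.1, hz.2.1.le.trans hz.2.2⟩, hz.1.trans hz.2.1, hz.2.2⟩
        refine (enorm_integral_le_lintegral_enorm _).trans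
          ((lintegral_mono_set hsub).trans ((lintegral_mono hdiag).trans_eq ?_))
        rw [Measure.volume_eq_prod, ← Measure.prod_restrict,
          lintegral_prod_mul hg.aemeasurable hν.aemeasurable]
      have h2 : ENNReal.ofReal ε * ∫⁻ s in Set.Ioc a b, g s ≤ ∫⁻ s in Set.Ioc a b, Gε s := by
        rw [hGεint]
        exact le_add_self
      have h3 := ENNReal.toReal_mono
        (ENNReal.mul_ne_top (hlocfin hgfin a b) (hlocfin hνfin a b)) h1
      have h4 := ENNReal.toReal_mono (hlocfin hGεfin a b) h2
      rw [ENNReal.toReal_mul] at h3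
      rw [ENNReal.toReal_mul, ENNReal.toReal_ofReal hε.le, ← le_inv_mul_iff₀ hε] at h4
      rw [← mul_assoc]
      exact h3.trans (mul_le_mul_of_nonneg_right (by linarith) ENNReal.toReal_nonneg)
  have hε : ∀ ε : ℝ, 0 < ε → ‖∫ z in {z : ℝ × ℝ | z.1 < z.2}, K z‖ ≤
      C.toReal / (1 - 2 ^ (1 / 2 - θ)) *
        (((∫⁻ s, G s).toReal + ε * (∫⁻ s, g s).toReal) ^ (1 / 2 : ℝ) *
          (∫⁻ t, η t).toReal ^ θ) := fun ε hε ↦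
    le_of_tendsto' (tendsto_setIntegral_upperTriangle hK).norm (hreg ε hε)
  have hcont : Continuous fun ε : ℝ ↦ C.toReal / (1 - 2 ^ (1 / 2 - θ)) *
      (((∫⁻ s, G s).toReal + ε * (∫⁻ s, g s).toReal) ^ (1 / 2 : ℝ) *
        (∫⁻ t, η t).toReal ^ θ) := by
    have := Real.continuous_rpow_const (q := 1 / 2) (by norm_num)
    fun_prop
  have hfinal := ge_of_tendsto ((hcont.tendsto 0).mono_left nhdsWithin_le_nhds)
    (eventually_nhdsWithin_of_forall (s := Set.Ioi (0 : ℝ)) hε)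
  rw [zero_mul, add_zero] at hfinal
  have h := ENNReal.ofReal_le_ofReal hfinal
  rw [ofReal_norm, div_eq_mul_one_div, ENNReal.ofReal_mul (by positivity),
    ENNReal.ofReal_mul (by positivity), ENNReal.ofReal_mul (by positivity),
    ENNReal.ofReal_toReal hC,
    ENNReal.toReal_rpow, ENNReal.toReal_rpow,
    ENNReal.ofReal_toReal (ENNReal.rpow_ne_top_of_nonneg (by norm_num) hGfin),
    ENNReal.ofReal_toReal (ENNReal.rpow_ne_top_of_nonneg hθ0.le hηfin)] at h
  exact h

end BilinearChristKiselev

section RetardedPairing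

variable {n : ℕ} {r : ℝ} {φ h : ℝ × EuclideanSpace ℝ (Fin n) → ℂ}

lemma schrod_zero_fun (t : ℝ) (x : EuclideanSpace ℝ (Fin n)) : schrod n t (fun _ ↦ 0) x = 0 := by
  simp [schrod]

lemma schrodPairing_indicator (φ h : ℝ × EuclideanSpace ℝ (Fin n) → ℂ) (I J : Set ℝ) :
    schrodPairing ((Prod.fst ⁻¹' I).indicator φ) ((Prod.fst ⁻¹' J).indicator h) =
      (I ×ˢ J).indicator (schrodPairing φ h) := by
  classical
  ext ⟨s, t⟩
  by_cases hs : s ∈ I <;> by_cases ht : t ∈ J <;>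
    simp [schrodPairing, Set.indicator, hs, ht, schrod_zero_fun]

/-- The weighted energy density of a source in time. -/
noncomputable def energyDensity (φ : ℝ × EuclideanSpace ℝ (Fin n) → ℂ) (s : ℝ) : ℝ≥0∞ :=
  ∫⁻ x, ‖x‖ₑ ^ 2 * ‖φ (s, x)‖ₑ ^ 2

lemma measurable_energyDensity (hφ : Measurable φ) : Measurable (energyDensity φ) :=
  Measurable.lintegral_prod_right'
    (f := fun z : ℝ × EuclideanSpace ℝ (Fin n) ↦ ‖z.2‖ₑ ^ 2 * ‖φ z‖ₑ ^ 2) (by fun_prop)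

lemma lintegral_energyDensity (hφ : Measurable φ) :
    ∫⁻ s, energyDensity φ s =
      ∫⁻ z : ℝ × EuclideanSpace ℝ (Fin n), ‖z.2‖ₑ ^ 2 * ‖φ z‖ₑ ^ 2 := by
  rw [Measure.volume_eq_prod, lintegral_prod _ (by fun_prop)]
  rfl

lemma energyDensity_indicator (φ : ℝ × EuclideanSpace ℝ (Fin n) → ℂ) (I : Set ℝ) :
    energyDensity ((Prod.fst ⁻¹' I).indicator φ) = I.indicator (energyDensity φ) := by
  classical
  ext s
  by_cases hs : s ∈ I <;> simp [energyDensity, Set.indicator, hs]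

lemma eLpNorm'_slice_indicator {q : ℝ} (hq : 0 < q) (h : ℝ × EuclideanSpace ℝ (Fin n) → ℂ)
    (J : Set ℝ) :
    (fun t ↦ eLpNorm' (fun x ↦ (Prod.fst ⁻¹' J).indicator h (t, x)) q volume) =
      J.indicator fun t ↦ eLpNorm' (fun x ↦ h (t, x)) q volume := by
  classical
  ext t
  by_cases ht : t ∈ J
  · simp [Set.indicator, ht]
  · simp [Set.indicator, ht, eLpNorm', hq]

namespace IsSource

lemma lintegral_energyDensity_ne_top (hφ : IsSource (r + 1) φ) (hr : n < r) :
    ∫⁻ s, energyDensity φ s ≠ ⊤ := by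
  have hsrc : IsSource r fun z ↦ ((‖z.2‖ : ℝ) : ℂ) * φ z :=
    hφ.norm_smul_left (f := fun x ↦ ((‖x‖ : ℝ) : ℂ)) (by fun_prop) fun x ↦ by
      rw [← ofReal_norm, Complex.norm_real, norm_norm, ofReal_norm]
  obtain ⟨C, hC, hb⟩ := hsrc.exists_eLpNorm_two_slice_le hr
  have hle : ∀ s, energyDensity φ s ≤ C ^ 2 * decayWeight 2 s := fun s ↦ by
    have h1 : energyDensity φ s = eLpNorm (fun x ↦ ((‖x‖ : ℝ) : ℂ) * φ (s, x)) 2 ^ 2 := by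
      rw [eLpNorm_two_sq]
      refine lintegral_congr fun x ↦ ?_
      rw [enorm_mul, mul_pow, ← ofReal_norm ((‖x‖ : ℝ) : ℂ), Complex.norm_real, norm_norm,
        ofReal_norm]
    rw [h1]
    refine (pow_le_pow_left' (hb s) 2).trans ?_
    rw [mul_pow]
    gcongr
    exact pow_le_of_le_one zero_le (decayWeight_le_one zero_le_two s) two_ne_zero
  refine ((lintegral_mono hle).trans_lt ?_).ne
  rw [lintegral_const_mul _ (by fun_prop)]
  exact ENNReal.mul_lt_top (ENNReal.pow_lt_top hC.lt_top) lintegral_decayWeight_time_lt_top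

lemma lintegral_eLpNorm_two_slice_ne_top (hφ : IsSource r φ) (hr : n < r) :
    ∫⁻ s, eLpNorm (fun x ↦ φ (s, x)) 2 ≠ ⊤ := by
  obtain ⟨C, hC, hb⟩ := hφ.exists_eLpNorm_two_slice_le hr
  refine ((lintegral_mono hb).trans_lt ?_).ne
  rw [lintegral_const_mul _ (by fun_prop)]
  exact ENNReal.mul_lt_top hC.lt_top lintegral_decayWeight_time_lt_top

lemma lintegral_eLpNorm'_slice_rpow_ne_top (hφ : IsSource r φ) (hr : n < r) {q p : ℝ} (hq : 1 ≤ q)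
    (hp : 1 ≤ p) : ∫⁻ s, eLpNorm' (fun x ↦ φ (s, x)) q volume ^ p ≠ ⊤ := by
  obtain ⟨C, hC, hb⟩ := hφ.exists_eLpNorm'_slice_le hr hq
  have hle : ∀ s, eLpNorm' (fun x ↦ φ (s, x)) q volume ^ p ≤ C ^ p * decayWeight 2 s := fun s ↦ by
    refine (ENNReal.rpow_le_rpow (hb s) (by linarith)).trans ?_
    rw [ENNReal.mul_rpow_of_nonneg _ _ (by linarith)]
    gcongr
    exact decayWeight_rpow_le_self zero_le_two hp s
  refine ((lintegral_mono hle).trans_lt ?_).ne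
  rw [lintegral_const_mul _ (by fun_prop)]
  exact ENNReal.mul_lt_top (ENNReal.rpow_lt_top_of_nonneg (by linarith) hC)
    lintegral_decayWeight_time_lt_top

end IsSource

lemma measurable_eLpNorm_two_slice (hφ : Measurable φ) :
    Measurable fun s ↦ eLpNorm (fun x ↦ φ (s, x)) 2 := by
  simp only [eLpNorm_eq_eLpNorm' two_ne_zero ofNat_ne_top]
  exact measurable_eLpNorm'_slice hφ _

lemma eLpNorm_two_profile_le (hn : 3 ≤ n) (hr : n < r) (hφ : IsSource (r + 1) φ) :
    eLpNorm (profile φ) 2 ≤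
      (ENNReal.ofReal (1 / (n - 2)) * ENNReal.ofReal (4 * Real.pi ^ 2)) ^ (1 / 2 : ℝ) *
        (∫⁻ s, energyDensity φ s) ^ (1 / 2 : ℝ) := by
  have h := lintegral_profile_sq_le hn hr hφ
  rw [← eLpNorm_two_sq, ← lintegral_energyDensity hφ.1, ← mul_assoc] at h
  have hroot : eLpNorm (profile φ) 2 = (eLpNorm (profile φ) 2 ^ 2) ^ (1 / 2 : ℝ) := by
    rw [← ENNReal.rpow_natCast, ← ENNReal.rpow_mul]
    norm_num
  rw [hroot, ← ENNReal.mul_rpow_of_nonneg _ _ (by norm_num)]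
  exact ENNReal.rpow_le_rpow h (by norm_num)

/-- The bilinear form of the retarded estimate. -/
theorem exists_retarded_pairing_le (hn : 3 ≤ n) {q a : ℝ} (hq : 2 < q)
    (haq : n * (1 / 2 - 1 / q) = a) (ha : 0 < a) (ha1 : a < 1) :
    ∃ C : ℝ≥0∞, C ≠ ⊤ ∧ ∀ (r : ℝ) (φ h : ℝ × EuclideanSpace ℝ (Fin n) → ℂ), n < r →
      IsSource (r + 1) φ → IsSource r φ → IsSource r h →
      ‖∫ z in {z : ℝ × ℝ | z.1 < z.2}, schrodPairing φ h z‖ₑ ≤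
        C * ((∫⁻ s, energyDensity φ s) ^ (1 / 2 : ℝ) *
          eLpNorm' (fun t ↦ eLpNorm' (fun x ↦ h (t, x)) (q / (q - 1)) volume)
            (2 / (2 - a)) volume) := by
  obtain ⟨C, hC, hstrich⟩ := exists_eLpNorm_profile_le n hq haq ha ha1
  have hq' : 1 ≤ q / (q - 1) := by
    rw [le_div_iff₀ (by linarith)]
    linarith
  have hp' : 1 ≤ 2 / (2 - a) := by
    rw [le_div_iff₀ (by linarith)]
    linarith
  have hθ : 1 / (2 / (2 - a)) = 1 - a / 2 := by
    field_simp
  set A := (ENNReal.ofReal (1 / (n - 2)) * ENNReal.ofReal (4 * Real.pi ^ 2)) ^ (1 / 2 : ℝ) with hA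
  have hAfin : A ≠ ⊤ := ENNReal.rpow_ne_top_of_nonneg (by norm_num)
    (ENNReal.mul_ne_top ENNReal.ofReal_ne_top ENNReal.ofReal_ne_top)
  refine ⟨A * C * ENNReal.ofReal (1 / (1 - 2 ^ (1 / 2 - (1 - a / 2)))),
    ENNReal.mul_ne_top (ENNReal.mul_ne_top hAfin hC) ENNReal.ofReal_ne_top,
    fun r φ h hr hφ hφr hh ↦ ?_⟩
  have hm := (measurable_eLpNorm'_slice hh.1 (q / (q - 1))).pow_const (2 / (2 - a))
  have hmain := enorm_setIntegral_lt_le (integrable_schrodPairing hφr hr hh)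
    (measurable_energyDensity hφ.1) (measurable_eLpNorm_two_slice hφ.1) hm
    (measurable_eLpNorm_two_slice hh.1) (hφ.lintegral_energyDensity_ne_top hr)
    (hφr.lintegral_eLpNorm_two_slice_ne_top hr)
    (hh.lintegral_eLpNorm'_slice_rpow_ne_top hr hq' hp')
    (hh.lintegral_eLpNorm_two_slice_ne_top hr) (C := A * C) (ENNReal.mul_ne_top hAfin hC)
    (θ := 1 - a / 2) (by linarith) (by linarith) ?_
    (fun z ↦ enorm_schrodPairing_le hφr hr hh z)
  · refine hmain.trans_eq ?_
    rw [eLpNorm', hθ]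
    rfl
  · intro a' b c
    have hI : MeasurableSet (Prod.fst ⁻¹' Set.Ioc a' b : Set (ℝ × EuclideanSpace ℝ (Fin n))) :=
      measurable_fst measurableSet_Ioc
    have hJ : MeasurableSet (Prod.fst ⁻¹' Set.Ioc b c : Set (ℝ × EuclideanSpace ℝ (Fin n))) :=
      measurable_fst measurableSet_Ioc
    rw [← integral_indicator (measurableSet_Ioc.prod measurableSet_Ioc),
      ← schrodPairing_indicator, integral_schrodPairing (hφr.indicator hI) hr (hh.indicator hJ)]
    have h1 := enorm_integral_mul_conj_le (μ := (volume : Measure (EuclideanSpace ℝ (Fin n))))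
      (measurable_profile (hφr.indicator hI).1).aestronglyMeasurable
      (measurable_profile (hh.indicator hJ).1).aestronglyMeasurable
    have h2 := eLpNorm_two_profile_le hn hr (hφ.indicator hI)
    have h3 := hstrich r _ hr (hh.indicator hJ)
    rw [energyDensity_indicator, lintegral_indicator measurableSet_Ioc] at h2
    rw [eLpNorm'_slice_indicator (by linarith), eLpNorm', hθ] at h3
    have h4 : ∀ t, ‖(Set.Ioc b c).indicator
        (fun t ↦ eLpNorm' (fun x ↦ h (t, x)) (q / (q - 1)) volume) t‖ₑ ^ (2 / (2 - a)) =
        (Set.Ioc b c).indicator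
          (fun t ↦ eLpNorm' (fun x ↦ h (t, x)) (q / (q - 1)) volume ^ (2 / (2 - a))) t := fun t ↦ by
      by_cases ht : t ∈ Set.Ioc b c
      · rw [Set.indicator_of_mem ht, Set.indicator_of_mem ht, enorm_eq_self]
      · rw [Set.indicator_of_notMem ht, Set.indicator_of_notMem ht, enorm_eq_self,
          ENNReal.zero_rpow_of_pos (by linarith)]
    rw [lintegral_congr h4, lintegral_indicator measurableSet_Ioc] at h3
    refine (h1.trans (mul_le_mul' h2 h3)).trans_eq ?_
    ring

end RetardedPairing

section MixedDuality

variable {n : ℕ}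

lemma eLpNorm'_rpow_self {α : Type*} [MeasurableSpace α] {μ : Measure α} {F : Type*}
    [ENorm F] (f : α → F) {q : ℝ} (hq : 0 < q) :
    eLpNorm' f q μ ^ q = ∫⁻ x, ‖f x‖ₑ ^ q ∂μ := by
  rw [eLpNorm', ← ENNReal.rpow_mul, one_div_mul_cancel hq.ne', ENNReal.rpow_one]

lemma IsTest.exists_eLpNorm'_slice_le {v : ℝ × EuclideanSpace ℝ (Fin n) → ℂ} (hv : IsTest v)
    {q : ℝ} (hq : 0 < q) :
    ∃ K : ℝ≥0∞, K ≠ ⊤ ∧ ∀ t, eLpNorm' (fun x ↦ v (t, x)) q volume ≤ K := by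
  obtain ⟨hm, R, hR⟩ := hv
  refine ⟨(ENNReal.ofReal R ^ q *
    volume (Metric.closedBall (0 : EuclideanSpace ℝ (Fin n)) R)) ^ (1 / q),
    ENNReal.rpow_ne_top_of_nonneg (by positivity) (ENNReal.mul_ne_top
      (ENNReal.rpow_ne_top_of_nonneg hq.le ENNReal.ofReal_ne_top)
      (isCompact_closedBall 0 R).measure_lt_top.ne), fun t ↦ ?_⟩
  rw [eLpNorm', ← lintegral_indicator_const Metric.isClosed_closedBall.measurableSet]
  gcongr with x
  by_cases hx : x ∈ Metric.closedBall (0 : EuclideanSpace ℝ (Fin n)) R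
  · rw [Set.indicator_of_mem hx, ← ofReal_norm]
    gcongr
    exact (hR (t, x)).1
  · have hlt : R < ‖((t, x) : ℝ × EuclideanSpace ℝ (Fin n))‖ := by
      rw [mem_closedBall_zero_iff, not_le] at hx
      exact hx.trans_le (norm_snd_le (t, x))
    simp [(hR (t, x)).2 hlt, hq]

/-- Testing against the extremizer for the mixed norm, away from times where the norm is small. -/
lemma IsTest.setLIntegral_eLpNorm'_le {v : ℝ × EuclideanSpace ℝ (Fin n) → ℂ} (hv : IsTest v)
    {p q : ℝ} (hp : 1 < p) (hq : 1 < q) {M : ℝ≥0∞}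
    (H : ∀ h, IsTest h → (∀ z, v z = 0 → h z = 0) → ‖∫ z, v z * conj (h z)‖ₑ ≤
      M * eLpNorm' (fun t ↦ eLpNorm' (fun x ↦ h (t, x)) (q / (q - 1)) volume) (p / (p - 1)) volume)
    {δ : ℝ≥0∞} (hδ : δ ≠ 0) (hδ' : δ ≠ ⊤) :
    ∫⁻ t in {t | δ ≤ eLpNorm' (fun x ↦ v (t, x)) q volume},
      eLpNorm' (fun x ↦ v (t, x)) q volume ^ p ≤ M ^ p := by
  set N : ℝ → ℝ≥0∞ := fun t ↦ eLpNorm' (fun x ↦ v (t, x)) q volume with hN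
  have hNm : Measurable N := measurable_eLpNorm'_slice hv.1 q
  obtain ⟨K, hK, hNK⟩ := hv.exists_eLpNorm'_slice_le (q := q) (by linarith)
  have hvm := hv.1
  obtain ⟨R, hR⟩ := hv.2
  have hR0 : 0 ≤ R := (norm_nonneg _).trans (hR 0).1
  set T : Set ℝ := {t | δ ≤ N t} with hT
  have hTm : MeasurableSet T := measurableSet_le measurable_const hNm
  set B : ℝ → ℝ≥0∞ := T.indicator fun t ↦ N t ^ (p - q) with hB
  have hBm : Measurable B := (hNm.pow_const _).indicator hTm
  obtain ⟨L, hL, hBL⟩ : ∃ L : ℝ≥0∞, L ≠ ⊤ ∧ ∀ t, B t ≤ L := by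
    by_cases hpq : 0 ≤ p - q
    · refine ⟨K ^ (p - q), ENNReal.rpow_ne_top_of_nonneg hpq hK, fun t ↦ ?_⟩
      exact (Set.indicator_le_self _ _ t).trans (ENNReal.rpow_le_rpow (hNK t) hpq)
    · refine ⟨δ ^ (p - q), ENNReal.rpow_ne_top_of_ne_zero hδ hδ', fun t ↦ ?_⟩
      by_cases ht : t ∈ T
      · rw [hB, Set.indicator_of_mem ht]
        rw [show p - q = -(q - p) by ring, ENNReal.rpow_neg, ENNReal.rpow_neg]
        exact ENNReal.inv_le_inv.2 (ENNReal.rpow_le_rpow ht (by linarith))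
      · rw [hB, Set.indicator_of_notMem ht]
        exact zero_le
  have hBt : ∀ t, B t ≠ ⊤ := fun t ↦ ((hBL t).trans_lt hL.lt_top).ne
  set h : ℝ × EuclideanSpace ℝ (Fin n) → ℂ :=
    fun z ↦ (((B z.1).toReal * ‖v z‖ ^ (q - 2) : ℝ) : ℂ) * v z with hh
  have hpow : ∀ z, ‖v z‖ ^ (q - 2) * ‖v z‖ = ‖v z‖ ^ (q - 1) := fun z ↦ by
    rw [← Real.rpow_add_one' (norm_nonneg _) (by linarith)]
    ring_nf
  have hnorm : ∀ z, ‖h z‖ = (B z.1).toReal * ‖v z‖ ^ (q - 1) := fun z ↦ by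
    rw [hh, norm_mul, Complex.norm_real, Real.norm_of_nonneg (by positivity), mul_assoc, hpow]
  have henorm : ∀ z, ‖h z‖ₑ = B z.1 * ‖v z‖ₑ ^ (q - 1) := fun z ↦ by
    rw [← ofReal_norm, hnorm, ENNReal.ofReal_mul ENNReal.toReal_nonneg,
      ENNReal.ofReal_toReal (hBt _), ← ENNReal.ofReal_rpow_of_nonneg (norm_nonneg _) (by linarith),
      ofReal_norm]
  have hzero : ∀ z, v z = 0 → h z = 0 := fun z hz ↦ by simp [hh, hz]
  have htest : IsTest h := by
    refine ⟨by fun_prop, max R (L.toReal * R ^ (q - 1)), fun z ↦ ⟨?_, fun hz ↦ ?_⟩⟩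
    · refine le_trans ?_ (le_max_right _ _)
      rw [hnorm]
      exact mul_le_mul (ENNReal.toReal_mono hL (hBL _))
        (Real.rpow_le_rpow (norm_nonneg _) (hR z).1 (by linarith)) (by positivity) (by positivity)
    · exact hzero z ((hR z).2 ((le_max_left _ _).trans_lt hz))
  have hprod : ∀ z, v z * conj (h z) = ((‖v z * conj (h z)‖ : ℝ) : ℂ) := fun z ↦ by
    rw [norm_mul, RCLike.norm_conj, hnorm, hh]
    simp only [map_mul, Complex.conj_ofReal]
    rw [mul_left_comm, Complex.mul_conj, Complex.normSq_eq_norm_sq, ← hpow]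
    push_cast
    ring
  have hvh : Integrable fun z ↦ v z * conj (h z) := by
    refine ⟨by fun_prop, ?_⟩
    rw [hasFiniteIntegral_iff_enorm]
    exact (lintegral_enorm_mul_conj_le_two hvm.aestronglyMeasurable
      htest.1.aestronglyMeasurable).trans_lt (ENNReal.mul_lt_top (hv.memLp 2).2 (htest.memLp 2).2)
  have hTpow : ∀ t ∈ T, N t ≠ 0 ∧ N t ≠ ⊤ := fun t ht ↦
    ⟨fun h0 ↦ hδ (le_zero_iff.1 (h0 ▸ ht)), ((hNK t).trans_lt hK.lt_top).ne⟩
  set S : ℝ≥0∞ := ∫⁻ t in T, N t ^ p with hS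
  have hlin : ∫⁻ z, ‖v z * conj (h z)‖ₑ = S := by
    have h1 : ∀ z, ‖v z * conj (h z)‖ₑ = B z.1 * ‖v z‖ₑ ^ q := fun z ↦ by
      rw [enorm_mul, ← ofReal_norm (conj (h z)), RCLike.norm_conj, ofReal_norm, henorm,
        mul_left_comm]
      congr 1
      nth_rewrite 1 [← ENNReal.rpow_one ‖v z‖ₑ]
      rw [← ENNReal.rpow_add_of_nonneg _ _ zero_le_one (by linarith)]
      ring_nf
    rw [lintegral_congr h1, Measure.volume_eq_prod, lintegral_prod _ (by fun_prop), hS,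
      ← lintegral_indicator hTm]
    refine lintegral_congr fun t ↦ ?_
    simp only
    rw [lintegral_const_mul _ (by fun_prop), ← eLpNorm'_rpow_self _ (by linarith : 0 < q)]
    by_cases ht : t ∈ T
    · rw [hB, Set.indicator_of_mem ht, Set.indicator_of_mem ht,
        ← ENNReal.rpow_add _ _ (hTpow t ht).1 (hTpow t ht).2]
      ring_nf
    · rw [hB, Set.indicator_of_notMem ht, Set.indicator_of_notMem ht, zero_mul]
  have hfin : S ≠ ⊤ := hlin ▸ hvh.2.ne
  have hpair : ‖∫ z, v z * conj (h z)‖ₑ = S := by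
    rw [integral_congr_ae (Filter.Eventually.of_forall hprod), integral_complex_ofReal,
      ← ofReal_norm, Complex.norm_real, Real.norm_of_nonneg (integral_nonneg fun z ↦ norm_nonneg _),
      ofReal_integral_norm_eq_lintegral_enorm hvh, hlin]
  have hq' : (q - 1) * (q / (q - 1)) = q := mul_div_cancel₀ _ (by linarith)
  have hp' : (p - 1) * (p / (p - 1)) = p := mul_div_cancel₀ _ (by linarith)
  have hq'0 : 0 < q / (q - 1) := div_pos (by linarith) (by linarith)
  have hp'0 : 0 < p / (p - 1) := div_pos (by linarith) (by linarith)
  have hslice : ∀ t, eLpNorm' (fun x ↦ h (t, x)) (q / (q - 1)) volume =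
      T.indicator (fun t ↦ N t ^ (p - 1)) t := fun t ↦ by
    have h1 : ∀ x, ‖h (t, x)‖ₑ ^ (q / (q - 1)) = B t ^ (q / (q - 1)) * ‖v (t, x)‖ₑ ^ q := fun x ↦ by
      rw [henorm, ENNReal.mul_rpow_of_nonneg _ _ hq'0.le, ← ENNReal.rpow_mul, hq']
    rw [eLpNorm', lintegral_congr h1, lintegral_const_mul _ (by fun_prop),
      ← eLpNorm'_rpow_self _ (by linarith : 0 < q),
      ENNReal.mul_rpow_of_nonneg _ _ (by positivity), ← ENNReal.rpow_mul,
      mul_one_div_cancel hq'0.ne', ENNReal.rpow_one, ← ENNReal.rpow_mul,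
      show q * (1 / (q / (q - 1))) = q - 1 by field_simp]
    by_cases ht : t ∈ T
    · rw [hB, Set.indicator_of_mem ht, Set.indicator_of_mem ht,
        ← ENNReal.rpow_add _ _ (hTpow t ht).1 (hTpow t ht).2]
      ring_nf
    · rw [hB, Set.indicator_of_notMem ht, Set.indicator_of_notMem ht, zero_mul]
  have hdual : eLpNorm' (fun t ↦ eLpNorm' (fun x ↦ h (t, x)) (q / (q - 1)) volume)
      (p / (p - 1)) volume = S ^ (1 - 1 / p) := by
    rw [eLpNorm', show 1 / (p / (p - 1)) = 1 - 1 / p by field_simp, hS, ← lintegral_indicator hTm]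
    congr 1
    refine lintegral_congr fun t ↦ ?_
    rw [hslice, enorm_eq_self]
    by_cases ht : t ∈ T
    · rw [Set.indicator_of_mem ht, Set.indicator_of_mem ht, ← ENNReal.rpow_mul, hp']
    · rw [Set.indicator_of_notMem ht, Set.indicator_of_notMem ht, ENNReal.zero_rpow_of_pos hp'0]
  have hmain := H h htest hzero
  rw [hpair, hdual] at hmain
  by_cases hS0 : S = 0
  · rw [hS0]
    exact zero_le
  have hsplit : S = S ^ (1 / p) * S ^ (1 - 1 / p) := by
    rw [← ENNReal.rpow_add _ _ hS0 hfin, add_sub_cancel, ENNReal.rpow_one]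
  nth_rewrite 1 [hsplit] at hmain
  rw [ENNReal.mul_le_mul_iff_left (ENNReal.rpow_pos (pos_iff_ne_zero.2 hS0) hfin).ne'
    (ENNReal.rpow_ne_top_of_ne_zero hS0 hfin)] at hmain
  refine (ENNReal.rpow_le_rpow hmain (by linarith : 0 ≤ p)).trans' (le_of_eq ?_)
  rw [← ENNReal.rpow_mul, one_div_mul_cancel (by linarith), ENNReal.rpow_one]

/-- The mixed norm is controlled by pairing with bounded functions of bounded support. -/
theorem eLpNorm'_eLpNorm'_le_of_pairing {u : ℝ × EuclideanSpace ℝ (Fin n) → ℂ} (hu : Measurable u)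
    {p q : ℝ} (hp : 1 < p) (hq : 1 < q) {M : ℝ≥0∞}
    (H : ∀ h, IsTest h → ‖∫ z, u z * conj (h z)‖ₑ ≤
      M * eLpNorm' (fun t ↦ eLpNorm' (fun x ↦ h (t, x)) (q / (q - 1)) volume)
        (p / (p - 1)) volume) :
    eLpNorm' (fun t ↦ eLpNorm' (fun x ↦ u (t, x)) q volume) p volume ≤ M := by
  set S : ℕ → Set (ℝ × EuclideanSpace ℝ (Fin n)) := fun R ↦ {z | ‖z‖ ≤ R ∧ ‖u z‖ ≤ R} with hS
  have hSm : ∀ R, MeasurableSet (S R) := fun R ↦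
    (measurableSet_le measurable_norm measurable_const).inter
      (measurableSet_le hu.norm measurable_const)
  have htest : ∀ R, IsTest ((S R).indicator u) := fun R ↦ by
    refine ⟨hu.indicator (hSm R), R, fun x ↦ ⟨?_, fun hx ↦ ?_⟩⟩
    · by_cases hx : x ∈ S R
      · rw [Set.indicator_of_mem hx]; exact hx.2
      · rw [Set.indicator_of_notMem hx]; simp
    · exact Set.indicator_of_notMem (fun h ↦ absurd h.1 (not_le.2 hx)) _
  set N : ℕ → ℝ → ℝ≥0∞ := fun R t ↦ eLpNorm' (fun x ↦ (S R).indicator u (t, x)) q volume with hN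
  have hNm : ∀ R, Measurable (N R) := fun R ↦ measurable_eLpNorm'_slice (htest R).1 q
  set δ : ℕ → ℝ≥0∞ := fun R ↦ ((R : ℝ≥0∞) + 1)⁻¹ with hδ
  have hbound : ∀ R, ∫⁻ t in {t | δ R ≤ N R t}, N R t ^ p ≤ M ^ p := fun R ↦ by
    refine (htest R).setLIntegral_eLpNorm'_le hp hq (fun h hh hz ↦ ?_) (by simp [hδ]) (by simp [hδ])
    refine le_trans (le_of_eq ?_) (H h hh)
    congr 2
    ext z
    by_cases hzS : z ∈ S R
    · rw [Set.indicator_of_mem hzS]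
    · simp [hz z (Set.indicator_of_notMem hzS u)]
  have hmono : Monotone S := fun a b hab x hx ↦
    ⟨hx.1.trans (by exact_mod_cast hab), hx.2.trans (by exact_mod_cast hab)⟩
  have hev : ∀ z, ∀ᶠ R in Filter.atTop, (S R).indicator u z = u z := fun z ↦ by
    obtain ⟨R, hR⟩ := exists_nat_ge (max ‖z‖ ‖u z‖)
    filter_upwards [Filter.eventually_ge_atTop R] with R' hR'
    exact Set.indicator_of_mem
      (hmono hR' ⟨(le_max_left _ _).trans hR, (le_max_right _ _).trans hR⟩) u
  have hlimN : ∀ t, Filter.Tendsto (fun R ↦ N R t) Filter.atTop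
      (nhds (eLpNorm' (fun x ↦ u (t, x)) q volume)) := fun t ↦ by
    refine (ENNReal.continuous_rpow_const.tendsto _).comp
      (lintegral_tendsto_of_tendsto_of_monotone (fun R ↦ ?_)
        (Filter.Eventually.of_forall fun x a b hab ↦ ?_) (Filter.Eventually.of_forall fun x ↦ ?_))
    · have := (htest R).1
      fun_prop
    · refine ENNReal.rpow_le_rpow ?_ (by linarith)
      simp only [enorm_indicator_eq_indicator_enorm]
      exact Set.indicator_le_indicator_of_subset (hmono hab) (fun _ ↦ zero_le) _
    · exact tendsto_const_nhds.congr' ((hev (t, x)).mono fun R hR ↦ by simp only [hR])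
  have hδlim : Filter.Tendsto δ Filter.atTop (nhds 0) := by
    refine ENNReal.tendsto_inv_nat_nhds_zero.comp (Filter.tendsto_add_atTop_nat 1)
      |>.congr fun R ↦ ?_
    simp [hδ]
  have hlim : ∀ t, Filter.Tendsto (fun R ↦ {t | δ R ≤ N R t}.indicator (fun t ↦ N R t ^ p) t)
      Filter.atTop (nhds (eLpNorm' (fun x ↦ u (t, x)) q volume ^ p)) := fun t ↦ by
    by_cases h0 : eLpNorm' (fun x ↦ u (t, x)) q volume = 0
    · have h1 := (ENNReal.continuous_rpow_const (y := p)).tendsto _ |>.comp (hlimN t)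
      rw [h0, ENNReal.zero_rpow_of_pos (by linarith)] at h1 ⊢
      exact tendsto_of_tendsto_of_tendsto_of_le_of_le tendsto_const_nhds h1 (fun _ ↦ zero_le)
        fun R ↦ Set.indicator_le_self _ _ t
    · refine ((ENNReal.continuous_rpow_const (y := p)).tendsto _ |>.comp (hlimN t)).congr' ?_
      filter_upwards [hδlim.eventually_lt (hlimN t) (pos_iff_ne_zero.2 h0)] with R hR
      exact (Set.indicator_of_mem (s := {t | δ R ≤ N R t}) hR.le fun t ↦ N R t ^ p).symm
  have hfatou : ∫⁻ t, eLpNorm' (fun x ↦ u (t, x)) q volume ^ p ≤ M ^ p := by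
    simp only [← (hlim _).liminf_eq]
    refine (lintegral_liminf_le fun R ↦ ((hNm R).pow_const p).indicator
      (measurableSet_le measurable_const (hNm R))).trans ?_
    refine Filter.liminf_le_of_le (by isBoundedDefault) fun b hb ↦ ?_
    obtain ⟨R, hR⟩ := hb.exists
    refine hR.trans ?_
    rw [lintegral_indicator (measurableSet_le measurable_const (hNm R))]
    exact hbound R
  refine (ENNReal.rpow_le_rpow_iff (by linarith : 0 < p)).1 ?_
  rw [eLpNorm'_rpow_self _ (by linarith)]
  exact hfatou

end MixedDuality

section Duhamel

variable {n : ℕ} {r : ℝ} {φ h : ℝ × EuclideanSpace ℝ (Fin n) → ℂ}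

lemma isSource_of_decay (hφ : Measurable φ) (hr : 0 ≤ r) {C : ℝ}
    (hC : ∀ z, (1 + ‖z‖) ^ (2 + r) * ‖φ z‖ ≤ C) : IsSource r φ := by
  refine ⟨hφ, ENNReal.ofReal C, ENNReal.ofReal_ne_top, fun s x ↦ ?_⟩
  have hs : 0 < 1 + ‖s‖ := by positivity
  have hx : 0 < 1 + ‖x‖ := by positivity
  have hz : 0 < 1 + ‖(s, x)‖ := by positivity
  have hC0 : 0 ≤ C := le_trans (by positivity) (hC 0)
  rw [decayWeight, decayWeight, ← ofReal_norm, ← ENNReal.ofReal_mul (by positivity),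
    ← ENNReal.ofReal_mul hC0]
  refine ENNReal.ofReal_le_ofReal ?_
  rw [Real.rpow_neg hs.le, Real.rpow_neg hx.le, ← mul_inv, ← div_eq_mul_inv,
    le_div_iff₀ (by positivity)]
  refine le_trans ?_ (hC (s, x))
  rw [mul_comm, Real.rpow_add hz]
  gcongr
  · exact norm_fst_le (s, x)
  · exact norm_snd_le (s, x)

lemma IsTest.isSource (hh : IsTest h) (hr : 0 ≤ r) : IsSource r h := by
  obtain ⟨hm, R, hR⟩ := hh
  have hR0 : 0 ≤ R := (norm_nonneg _).trans (hR 0).1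
  refine isSource_of_decay hm hr (C := (1 + R) ^ (2 + r) * R) fun z ↦ ?_
  by_cases hz : R < ‖z‖
  · rw [(hR z).2 hz, norm_zero, mul_zero]
    positivity
  · gcongr
    · exact not_lt.1 hz
    · exact (hR z).1

lemma isSource_mul_schwartz {w : EuclideanSpace ℝ (Fin n) → ℂ} (hw : Measurable w)
    (hw1 : ∀ x, ‖w x‖ ≤ 1) (g : 𝓢(ℝ × EuclideanSpace ℝ (Fin n), ℂ)) (hr : 0 ≤ r) :
    IsSource r fun z ↦ w z.2 * g z := by
  have hg : Measurable g := g.continuous.measurable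
  refine isSource_of_decay (by fun_prop) hr (C := 2 ^ ⌈2 + r⌉₊ *
    ((Finset.Iic (⌈2 + r⌉₊, 0)).sup fun m ↦ SchwartzMap.seminorm ℝ m.1 m.2) g) fun z ↦ ?_
  have h1 := SchwartzMap.one_add_le_sup_seminorm_apply (𝕜 := ℝ) (m := (⌈2 + r⌉₊, 0)) (k := ⌈2 + r⌉₊)
    (n := 0) le_rfl le_rfl g z
  rw [norm_iteratedFDeriv_zero] at h1
  refine le_trans ?_ h1
  rw [norm_mul, ← Real.rpow_natCast]
  have h2 : ‖w z.2‖ * ‖g z‖ ≤ ‖g z‖ := mul_le_of_le_one_left (norm_nonneg _) (hw1 _)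
  have h3 : (1 + ‖z‖) ^ (2 + r) ≤ (1 + ‖z‖) ^ ((⌈2 + r⌉₊ : ℕ) : ℝ) :=
    Real.rpow_le_rpow_of_exponent_le (le_add_of_nonneg_right (norm_nonneg z)) (Nat.le_ceil _)
  gcongr

/-- The retarded Duhamel integral of a source. -/
noncomputable def duhamel (φ : ℝ × EuclideanSpace ℝ (Fin n) → ℂ) (t : ℝ)
    (x : EuclideanSpace ℝ (Fin n)) : ℂ :=
  ∫ s in Set.Iic t, schrod n (t - s) (fun y ↦ φ (s, y)) x

lemma measurable_duhamel (hφ : Measurable φ) :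
    Measurable fun z : ℝ × EuclideanSpace ℝ (Fin n) ↦ duhamel φ z.1 z.2 := by
  have h1 : Measurable fun q : (ℝ × EuclideanSpace ℝ (Fin n)) × ℝ ↦
      schrod n (q.1.1 - q.2) (fun y ↦ φ (q.2, y)) q.1.2 :=
    (measurable_schrod hφ).comp (show Measurable fun q : (ℝ × EuclideanSpace ℝ (Fin n)) × ℝ ↦
      (q.1.1 - q.2, q.2, q.1.2) by fun_prop)
  have h2 : MeasurableSet {q : (ℝ × EuclideanSpace ℝ (Fin n)) × ℝ | q.2 ≤ q.1.1} :=
    measurableSet_le (by fun_prop) (by fun_prop)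
  have h3 := (h1.indicator h2).stronglyMeasurable.integral_prod_right' (ν := volume)
  convert h3.measurable using 2 with z
  rw [duhamel, ← integral_indicator measurableSet_Iic]
  rfl

lemma measurable_duhamel_apply (hφ : Measurable φ) (t : ℝ) : Measurable (duhamel φ t) :=
  (measurable_duhamel hφ).comp measurable_prodMk_left

lemma integral_duhamel_mul_conj_slice (hφ : IsSource r φ) (hr : n < r) (hh : IsSource r h) (t : ℝ) :
    ∫ x, duhamel φ t x * conj (h (t, x)) = ∫ s in Set.Iio t, schrodPairing φ h (s, t) := by
  have hm : Measurable (Function.uncurry fun (x : EuclideanSpace ℝ (Fin n)) (s : ℝ) ↦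
      schrod n (t - s) (fun y ↦ φ (s, y)) x * conj (h (t, x))) := by
    have h1 : Measurable fun q : EuclideanSpace ℝ (Fin n) × ℝ ↦
        schrod n (t - q.2) (fun y ↦ φ (q.2, y)) q.1 :=
      (measurable_schrod hφ.1).comp (show Measurable fun q : EuclideanSpace ℝ (Fin n) × ℝ ↦
        (t - q.2, q.2, q.1) by fun_prop)
    exact h1.mul (RCLike.continuous_conj.measurable.comp
      ((hh.measurable_slice t).comp measurable_fst))
  have hint : Integrable (Function.uncurry fun (x : EuclideanSpace ℝ (Fin n)) (s : ℝ) ↦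
      schrod n (t - s) (fun y ↦ φ (s, y)) x * conj (h (t, x)))
      (volume.prod (volume.restrict (Set.Iio t))) := by
    refine ⟨hm.aestronglyMeasurable, ?_⟩
    rw [hasFiniteIntegral_iff_enorm, lintegral_prod_symm _ hm.enorm.aemeasurable]
    have hle : ∀ s, ∫⁻ x, ‖schrod n (t - s) (fun y ↦ φ (s, y)) x * conj (h (t, x))‖ₑ ≤
        eLpNorm (fun x ↦ φ (s, x)) 2 * eLpNorm (fun x ↦ h (t, x)) 2 := fun s ↦
      (lintegral_enorm_mul_conj_le_two
        (measurable_schrod_apply (hφ.measurable_slice s) _).aestronglyMeasurable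
        (hh.measurable_slice t).aestronglyMeasurable).trans
        (mul_le_mul_left (eLpNorm_schrod_le (hφ.measurable_slice _) (hφ.integrable_slice hr _)
          (hφ.memLp_two_slice hr _) _) _)
    refine (lintegral_mono hle).trans_lt ((setLIntegral_le_lintegral _ _).trans_lt ?_)
    rw [lintegral_mul_const _ (measurable_eLpNorm_two_slice hφ.1)]
    exact ENNReal.mul_lt_top (hφ.lintegral_eLpNorm_two_slice_ne_top hr).lt_top
      (hh.memLp_two_slice hr t).2
  refine Eq.trans ?_ (integral_integral_swap hint)
  refine integral_congr_ae (Filter.Eventually.of_forall fun x ↦ ?_)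
  simp only
  rw [integral_mul_const, duhamel, integral_Iic_eq_integral_Iio]

/-- At each time the Duhamel integral is controlled by the profile of the past of the source. -/
lemma eLpNorm_duhamel_le (hφ : IsSource r φ) (hr : n < r) (t : ℝ) :
    eLpNorm (duhamel φ t) 2 ≤ eLpNorm (profile ((Prod.fst ⁻¹' Set.Iio t).indicator φ)) 2 := by
  have hr0 : 0 ≤ r := (Nat.cast_nonneg n).trans hr.le
  refine eLpNorm_two_le_of_pairing (measurable_duhamel_apply hφ.1 t) fun k hk ↦ ?_
  set h : ℝ × EuclideanSpace ℝ (Fin n) → ℂ :=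
    (Prod.fst ⁻¹' {t}).indicator fun z ↦ k z.2 with hh
  have hht : ∀ x, h (t, x) = k x := fun x ↦ by simp [hh]
  have hsrc : IsSource r h := by
    obtain ⟨hkm, R, hR⟩ := hk
    refine IsTest.isSource ⟨(hkm.comp measurable_snd).indicator
      (measurable_fst (measurableSet_singleton t)), max R |t|, fun z ↦ ⟨?_, fun hz ↦ ?_⟩⟩ hr0
    · exact (norm_indicator_le_norm_self _ _).trans ((hR z.2).1.trans (le_max_left _ _))
    · by_cases hzt : z.1 = t
      · rw [Prod.norm_def, hzt, Real.norm_eq_abs] at hz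
        have hz2 : R < ‖z.2‖ := by
          rcases lt_max_iff.1 hz with h1 | h1
          · exact absurd h1 (not_lt.2 (le_max_right _ _))
          · exact (le_max_left _ _).trans_lt h1
        simp [hh, Set.indicator, (hR z.2).2 hz2]
      · exact Set.indicator_of_notMem (by simpa using hzt) _
  set ψ := (Prod.fst ⁻¹' Set.Iio t).indicator φ with hψ
  have hψs : IsSource r ψ := hφ.indicator (measurable_fst measurableSet_Iio)
  have hmψ := measurable_modulatedFourier hψs.1
  have hmh := (measurable_modulatedFourier hsrc.1).comp (measurable_prodMk_left (x := t))
  have hint : Integrable (Function.uncurry fun (s : ℝ) (ξ : EuclideanSpace ℝ (Fin n)) ↦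
      modulatedFourier ψ (s, ξ) * conj (modulatedFourier h (t, ξ))) := by
    have hm : Measurable (Function.uncurry fun (s : ℝ) (ξ : EuclideanSpace ℝ (Fin n)) ↦
        modulatedFourier ψ (s, ξ) * conj (modulatedFourier h (t, ξ))) :=
      hmψ.mul (RCLike.continuous_conj.measurable.comp (hmh.comp measurable_snd))
    refine ⟨hm.aestronglyMeasurable, ?_⟩
    rw [hasFiniteIntegral_iff_enorm, Measure.volume_eq_prod, lintegral_prod _ hm.enorm.aemeasurable]
    have hle : ∀ s, ∫⁻ ξ, ‖modulatedFourier ψ (s, ξ) * conj (modulatedFourier h (t, ξ))‖ₑ ≤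
        eLpNorm (fun x ↦ ψ (s, x)) 2 * eLpNorm (fun x ↦ h (t, x)) 2 := fun s ↦
      (lintegral_enorm_mul_conj_le_two (hmψ.comp measurable_prodMk_left).aestronglyMeasurable
        hmh.aestronglyMeasurable).trans (mul_le_mul' (eLpNorm_modulatedFourier_le hψs hr s)
          (eLpNorm_modulatedFourier_le hsrc hr t))
    refine (lintegral_mono hle).trans_lt ?_
    rw [lintegral_mul_const _ (measurable_eLpNorm_two_slice hψs.1)]
    exact ENNReal.mul_lt_top (hψs.lintegral_eLpNorm_two_slice_ne_top hr).lt_top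
      (hsrc.memLp_two_slice hr t).2
  have hpair : ∫ x, duhamel φ t x * conj (k x) =
      ∫ ξ, profile ψ ξ * conj (modulatedFourier h (t, ξ)) := by
    calc ∫ x, duhamel φ t x * conj (k x)
        = ∫ s in Set.Iio t, schrodPairing φ h (s, t) := by
          simp only [← hht]
          exact integral_duhamel_mul_conj_slice hφ hr hsrc t
      _ = ∫ s, schrodPairing ψ h (s, t) := by
          rw [← integral_indicator measurableSet_Iio]
          refine integral_congr_ae (Filter.Eventually.of_forall fun s ↦ ?_)
          by_cases hs : s < t <;> simp [schrodPairing, hψ, Set.indicator, hs, schrod_zero_fun]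
      _ = ∫ s, ∫ ξ, modulatedFourier ψ (s, ξ) * conj (modulatedFourier h (t, ξ)) :=
          integral_congr_ae ((Measure.ae_ne volume t).mono fun s hs ↦
            schrodPairing_eq_integral_fourier hψs hr hsrc (z := (s, t)) hs)
      _ = ∫ ξ, ∫ s, modulatedFourier ψ (s, ξ) * conj (modulatedFourier h (t, ξ)) :=
          integral_integral_swap hint
      _ = _ := by simp only [integral_mul_const, profile]
  rw [hpair]
  refine (enorm_integral_mul_conj_le (measurable_profile hψs.1).aestronglyMeasurable
    hmh.aestronglyMeasurable).trans (mul_le_mul_right ?_ _)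
  refine (eLpNorm_modulatedFourier_le hsrc hr t).trans_eq ?_
  simp only [hht]

lemma eLpNorm_duhamel_le_energy (hn : 3 ≤ n) (hr : n < r) (hφ : IsSource (r + 1) φ)
    (hφr : IsSource r φ) (t : ℝ) :
    eLpNorm (duhamel φ t) 2 ≤
      (ENNReal.ofReal (1 / (n - 2)) * ENNReal.ofReal (4 * Real.pi ^ 2)) ^ (1 / 2 : ℝ) *
        (∫⁻ s, energyDensity φ s) ^ (1 / 2 : ℝ) := by
  have hI : MeasurableSet (Prod.fst ⁻¹' Set.Iio t : Set (ℝ × EuclideanSpace ℝ (Fin n))) :=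
    measurable_fst measurableSet_Iio
  refine (eLpNorm_duhamel_le hφr hr t).trans
    ((eLpNorm_two_profile_le hn hr (hφ.indicator hI)).trans ?_)
  rw [energyDensity_indicator]
  gcongr
  exact Set.indicator_le_self _ _ _

lemma integral_duhamel_mul_conj (hn : 3 ≤ n) (hr : n < r) (hφ : IsSource (r + 1) φ)
    (hφr : IsSource r φ) (hh : IsSource r h) :
    ∫ z, duhamel φ z.1 z.2 * conj (h z) = ∫ z in {z : ℝ × ℝ | z.1 < z.2}, schrodPairing φ h z := by
  have hm : Measurable fun z : ℝ × EuclideanSpace ℝ (Fin n) ↦ duhamel φ z.1 z.2 * conj (h z) :=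
    (measurable_duhamel hφ.1).mul (RCLike.continuous_conj.measurable.comp hh.1)
  have hint : Integrable (fun z : ℝ × EuclideanSpace ℝ (Fin n) ↦
      duhamel φ z.1 z.2 * conj (h z)) := by
    refine ⟨hm.aestronglyMeasurable, ?_⟩
    rw [hasFiniteIntegral_iff_enorm, Measure.volume_eq_prod, lintegral_prod _ hm.enorm.aemeasurable]
    have hle : ∀ t, ∫⁻ x, ‖duhamel φ t x * conj (h (t, x))‖ₑ ≤
        (ENNReal.ofReal (1 / (n - 2)) * ENNReal.ofReal (4 * Real.pi ^ 2)) ^ (1 / 2 : ℝ) *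
          (∫⁻ s, energyDensity φ s) ^ (1 / 2 : ℝ) * eLpNorm (fun x ↦ h (t, x)) 2 := fun t ↦
      (lintegral_enorm_mul_conj_le_two (measurable_duhamel_apply hφ.1 t).aestronglyMeasurable
        (hh.measurable_slice t).aestronglyMeasurable).trans
        (mul_le_mul_left (eLpNorm_duhamel_le_energy hn hr hφ hφr t) _)
    refine (lintegral_mono hle).trans_lt ?_
    rw [lintegral_const_mul _ (measurable_eLpNorm_two_slice hh.1)]
    refine ENNReal.mul_lt_top (ENNReal.mul_lt_top ?_ ?_)
      (hh.lintegral_eLpNorm_two_slice_ne_top hr).lt_top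
    · exact ENNReal.rpow_lt_top_of_nonneg (by norm_num)
        (ENNReal.mul_ne_top ENNReal.ofReal_ne_top ENNReal.ofReal_ne_top)
    · exact ENNReal.rpow_lt_top_of_nonneg (by norm_num) (hφ.lintegral_energyDensity_ne_top hr)
  have hlt : MeasurableSet {z : ℝ × ℝ | z.1 < z.2} := measurableSet_lt measurable_fst measurable_snd
  rw [Measure.volume_eq_prod] at hint ⊢
  rw [integral_prod _ hint, ← integral_indicator hlt, Measure.volume_eq_prod,
    integral_prod_symm _ ((integrable_schrodPairing hφr hr hh).indicator hlt)]
  refine integral_congr_ae (Filter.Eventually.of_forall fun t ↦ ?_)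
  simp only
  rw [integral_duhamel_mul_conj_slice hφr hr hh t, ← integral_indicator measurableSet_Iio]
  rfl

end Duhamel

lemma norm_mul_le_one_of_le_inv_bracket {V : Type*} [NormedAddCommGroup V] {w : V → ℂ}
    (hw : ∀ x, ‖w x‖ ≤ (1 + ‖x‖ ^ 2) ^ (-(1 : ℝ) / 2)) (x : V) : ‖x‖ * ‖w x‖ ≤ 1 := by
  have h0 : 0 < 1 + ‖x‖ ^ 2 := by positivity
  refine (mul_le_mul_of_nonneg_left (hw x) (norm_nonneg x)).trans ?_
  rw [neg_div, Real.rpow_neg h0.le, ← Real.sqrt_eq_rpow, ← div_eq_mul_inv,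
    div_le_one (Real.sqrt_pos.2 h0)]
  exact Real.le_sqrt_of_sq_le (by linarith)

lemma lintegral_energyDensity_mul_rpow_le {n : ℕ} {w : EuclideanSpace ℝ (Fin n) → ℂ}
    (hwm : Measurable w) (hw : ∀ x, ‖w x‖ ≤ (1 + ‖x‖ ^ 2) ^ (-(1 : ℝ) / 2))
    {g : ℝ × EuclideanSpace ℝ (Fin n) → ℂ} (hg : Measurable g) :
    (∫⁻ s, energyDensity (fun z ↦ w z.2 * g z) s) ^ (1 / 2 : ℝ) ≤ eLpNorm g 2 volume := by
  have h1 : ∫⁻ s, energyDensity (fun z ↦ w z.2 * g z) s ≤ eLpNorm g 2 volume ^ 2 := by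
    rw [lintegral_energyDensity (by fun_prop), eLpNorm_two_sq]
    refine lintegral_mono fun z ↦ ?_
    rw [← mul_pow, enorm_mul, ← mul_assoc]
    gcongr
    refine mul_le_of_le_one_left' ?_
    rw [← ofReal_norm, ← ofReal_norm, ← ENNReal.ofReal_mul (norm_nonneg _), ← ENNReal.ofReal_one]
    exact ENNReal.ofReal_le_ofReal (norm_mul_le_one_of_le_inv_bracket hw z.2)
  refine (ENNReal.rpow_le_rpow h1 (by norm_num)).trans_eq ?_
  rw [← ENNReal.rpow_natCast, ← ENNReal.rpow_mul]
  norm_num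

lemma mixedNorm_eq_eLpNorm' {n : ℕ} {p q : ℝ≥0∞} (hp : p ≠ ⊤) (hq0 : q ≠ 0) (hq : q ≠ ⊤)
    (F : ℝ → EuclideanSpace ℝ (Fin n) → ℂ) :
    mixedNorm p q F = eLpNorm' (fun t ↦ eLpNorm' (F t) q.toReal volume) p.toReal volume := by
  rw [mixedNorm, if_neg hp, eLpNorm']
  simp only [eLpNorm_eq_eLpNorm' hq0 hq, enorm_eq_self]

/-- Retarded (Duhamel-type) Strichartz-smoothing estimate for admissible pairs
with `p > 2`: for `|w(x)| ≤ ⟨x⟩⁻¹`,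
`‖∫_{-∞}^t e^{i(t-s)Δ}(w g(s,·)) ds‖_{L^p_t L^q_x} ≤ C ‖g‖_{L²(ℝ×ℝⁿ)}`. -/
theorem strichartz_smoothing_retarded (n : ℕ) (hn : 3 ≤ n) (p q : ℝ≥0∞)
    (hp : 2 < p) (hq : 2 ≤ q) (hpq : 2 / p + (n : ℝ≥0∞) / q = (n : ℝ≥0∞) / 2) :
    ∃ C : ℝ≥0∞, C ≠ ⊤ ∧
      ∀ w : EuclideanSpace ℝ (Fin n) → ℂ, Measurable w →
        (∀ x, ‖w x‖ ≤ (1 + ‖x‖ ^ 2) ^ (-(1 : ℝ) / 2)) →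
        ∀ g : 𝓢(ℝ × EuclideanSpace ℝ (Fin n), ℂ),
          mixedNorm p q
              (fun t x =>
                ∫ s in Set.Iic t, schrod n (t - s) (fun y => w y * g (s, y)) x)
            ≤ C * eLpNorm (⇑g) 2 volume := by
  have hn3 : (3 : ℝ) ≤ n := by exact_mod_cast hn
  have hr : (n : ℝ) < n + 1 := by linarith
  have hsrc : ∀ w : EuclideanSpace ℝ (Fin n) → ℂ, Measurable w →
      (∀ x, ‖w x‖ ≤ (1 + ‖x‖ ^ 2) ^ (-(1 : ℝ) / 2)) →
      ∀ (g : 𝓢(ℝ × EuclideanSpace ℝ (Fin n), ℂ)) (r : ℝ), 0 ≤ r →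
        IsSource r fun z ↦ w z.2 * g z := fun w hwm hw g r hr0 ↦
    isSource_mul_schwartz hwm (fun x ↦ (hw x).trans (Real.rpow_le_one_of_one_le_of_nonpos
      (by nlinarith [norm_nonneg x]) (by norm_num))) g hr0
  have hp0 : p ≠ 0 := (zero_lt_two.trans hp).ne'
  have hq0 : q ≠ 0 := (zero_lt_two.trans_le hq).ne'
  have hreal : 2 / p.toReal + n / q.toReal = (n : ℝ) / 2 := by
    have h1 := congrArg ENNReal.toReal hpq
    rw [ENNReal.toReal_add (ENNReal.div_ne_top ofNat_ne_top hp0)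
      (ENNReal.div_ne_top (ENNReal.natCast_ne_top n) hq0)] at h1
    simpa [ENNReal.toReal_div] using h1
  by_cases hptop : p = ⊤
  · have hq2 : q = 2 := by
      rw [hptop, ENNReal.toReal_top, _root_.div_zero, zero_add] at hreal
      have hqr : q.toReal = 2 := by
        have hQ : q.toReal ≠ 0 := fun h ↦ by
          rw [h, _root_.div_zero] at hreal
          linarith
        field_simp at hreal
        exact hreal.symm
      have hqt : q ≠ ⊤ := fun h ↦ by simp [h] at hqr
      rw [← ENNReal.ofReal_toReal hqt, hqr, ENNReal.ofReal_ofNat]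
    refine ⟨(ENNReal.ofReal (1 / (n - 2)) * ENNReal.ofReal (4 * Real.pi ^ 2)) ^ (1 / 2 : ℝ),
      ENNReal.rpow_ne_top_of_nonneg (by norm_num)
        (ENNReal.mul_ne_top ENNReal.ofReal_ne_top ENNReal.ofReal_ne_top), fun w hwm hw g ↦ ?_⟩
    rw [mixedNorm, if_pos hptop, hq2]
    refine essSup_le_of_ae_le _ (Filter.Eventually.of_forall fun t ↦ ?_)
    exact (eLpNorm_duhamel_le_energy hn hr (hsrc w hwm hw g _ (by positivity))
      (hsrc w hwm hw g _ (by positivity)) t).trans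
      (mul_le_mul_right (lintegral_energyDensity_mul_rpow_le hwm hw g.continuous.measurable) _)
  · have hP : 2 < p.toReal := by
      have := (ENNReal.toReal_lt_toReal ofNat_ne_top hptop).2 hp
      simpa using this
    have ha0 : 0 < 2 / p.toReal := by positivity
    have ha1 : 2 / p.toReal < 1 := (div_lt_one (by linarith)).2 hP
    have hqtop : q ≠ ⊤ := fun h ↦ by
      rw [h, ENNReal.toReal_top, _root_.div_zero, add_zero] at hreal
      linarith
    have hQ : 2 < q.toReal := by
      have hQ2 : 2 ≤ q.toReal := by
        have := (ENNReal.toReal_le_toReal ofNat_ne_top hqtop).2 hq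
        simpa using this
      refine lt_of_le_of_ne hQ2 fun h ↦ ?_
      rw [← h] at hreal
      linarith
    obtain ⟨C, hC, hmain⟩ := exists_retarded_pairing_le hn hQ (a := 2 / p.toReal)
      (by linear_combination -hreal) ha0 ha1
    refine ⟨C, hC, fun w hwm hw g ↦ ?_⟩
    have hφ := hsrc w hwm hw g (n + 1 + 1) (by positivity)
    have hφr := hsrc w hwm hw g (n + 1) (by positivity)
    rw [mixedNorm_eq_eLpNorm' hptop hq0 hqtop]
    refine (eLpNorm'_eLpNorm'_le_of_pairing (measurable_duhamel hφ.1) (by linarith)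
      (by linarith) (M := C * (∫⁻ s, energyDensity (fun z ↦ w z.2 * g z) s) ^ (1 / 2 : ℝ))
      fun h hh ↦ ?_).trans
      (mul_le_mul_right (lintegral_energyDensity_mul_rpow_le hwm hw g.continuous.measurable) _)
    have hhs : IsSource ((n : ℝ) + 1) h := hh.isSource (by positivity)
    rw [integral_duhamel_mul_conj hn hr hφ hφr hhs, mul_assoc,
      show p.toReal / (p.toReal - 1) = 2 / (2 - 2 / p.toReal) by field_simp]
    exact hmain _ _ h hr hφ hφr hhs
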